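/- There exists a universal constant C > 0 such that for every N ≥ 1, if A is Haar-distributed on SO(2N) and Q_N(A) = 2 Σ_{k≥1} Tr(A^k)²/k², then |E[Q_N(A)] − 2 log(2N) − (2γ + 2 + π²/12)| ≤ C/N and |Var(Q_N(A)) − (4π²/3 + 2 ζ(3))| ≤ C/N, where γ is the Euler–Mascheroni constant and ζ is the Riemann zeta function. -/

import Mathlib

open MeasureTheory ProbabilityTheory Matrix

noncomputable section

instance matrixMeasurableSpace {m n α : Type*} [MeasurableSpace α] :
    MeasurableSpace (Matrix m n α) :=
  show MeasurableSpace (m → n → α) from inferInstance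

/-- `Q_N(A) = 2 Σ_{k≥1} Tr(A^k)²/k²`. -/
def Q (N : ℕ) (A : Matrix (Fin (2 * N)) (Fin (2 * N)) ℝ) : ℝ :=
  2 * ∑' k : ℕ, ((A ^ (k + 1)).trace) ^ 2 / ((k : ℝ) + 1) ^ 2

section Slater

set_option linter.unusedSectionVars false

variable {X : Type*} [TopologicalSpace X] [CompactSpace X] [MeasurableSpace X] [BorelSpace X]
  (ν : Measure X) [IsProbabilityMeasure ν] {N : ℕ}

/-- The `L²(ν)` pairing of two continuous functions. -/
def ip (f g : C(X, ℝ)) : ℝ := ∫ x, f x * g x ∂ν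

theorem integrable_continuousMap {Y : Type*} [TopologicalSpace Y] [CompactSpace Y]
    [MeasurableSpace Y] [BorelSpace Y] (ρ : Measure Y) [IsFiniteMeasure ρ] (f : C(Y, ℝ)) :
    Integrable f ρ :=
  f.continuous.integrable_of_hasCompactSupport (HasCompactSupport.of_compactSpace f)

theorem ip_comm (f g : C(X, ℝ)) : ip ν f g = ip ν g f := by
  simp only [ip, mul_comm]

theorem ip_mul_left (f g h : C(X, ℝ)) : ip ν (f * g) h = ip ν g (f * h) := by
  simp only [ip, ContinuousMap.mul_apply]
  congr 1; ext x; ring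

theorem ip_add_right (f g h : C(X, ℝ)) : ip ν f (g + h) = ip ν f g + ip ν f h := by
  simp only [ip, ContinuousMap.add_apply, mul_add]
  exact integral_add (integrable_continuousMap ν (f * g)) (integrable_continuousMap ν (f * h))

theorem ip_smul_right (c : ℝ) (f g : C(X, ℝ)) : ip ν f (c • g) = c * ip ν f g := by
  simp only [ip, ContinuousMap.smul_apply, smul_eq_mul, mul_left_comm _ c]
  exact integral_const_mul c _

/-- `ip` as a linear map in its second argument. -/
def ipLin (f : C(X, ℝ)) : C(X, ℝ) →ₗ[ℝ] ℝ where
  toFun := ip ν f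
  map_add' := ip_add_right ν f
  map_smul' c g := by simpa using ip_smul_right ν c f g

theorem ip_sub_right (f g h : C(X, ℝ)) : ip ν f (g - h) = ip ν f g - ip ν f h :=
  map_sub (ipLin ν f) g h

theorem ip_sum_right {ι : Type*} (s : Finset ι) (f : C(X, ℝ)) (g : ι → C(X, ℝ)) :
    ip ν f (∑ i ∈ s, g i) = ∑ i ∈ s, ip ν f (g i) :=
  map_sum (ipLin ν f) g s

theorem ip_sum_left {ι : Type*} (s : Finset ι) (f : C(X, ℝ)) (g : ι → C(X, ℝ)) :
    ip ν (∑ i ∈ s, g i) f = ∑ i ∈ s, ip ν (g i) f := by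
  simp only [ip_comm ν _ f, ip_sum_right]

theorem ip_smul_left (c : ℝ) (f g : C(X, ℝ)) : ip ν (c • f) g = c * ip ν f g := by
  rw [ip_comm, ip_smul_right, ip_comm]

/-- Evaluation of a function at finitely many points. -/
def evalAt (θ : Fin N → X) : C(X, ℝ) →ₗ[ℝ] (Fin N → ℝ) where
  toFun g j := g (θ j)
  map_add' _ _ := rfl
  map_smul' _ _ := rfl

/-- The Slater determinant `det (g i (θ j))`. -/
def slater (θ : Fin N → X) : C(X, ℝ) [⋀^Fin N]→ₗ[ℝ] ℝ :=
  (detRowAlternating (n := Fin N) (R := ℝ)).compLinearMap (evalAt θ)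

theorem slater_apply (θ : Fin N → X) (g : Fin N → C(X, ℝ)) :
    slater θ g = det (of fun i j => g i (θ j)) := rfl

theorem continuous_slater (g : Fin N → C(X, ℝ)) : Continuous fun θ : Fin N → X => slater θ g := by
  simp only [slater_apply]
  refine Continuous.matrix_det ?_
  refine continuous_matrix fun i j => ?_
  exact (g i).continuous.comp (continuous_apply j)

/-- A one-particle multiplication operator acts on Slater determinants row by row. -/
theorem sum_mul_slater (f : C(X, ℝ)) (θ : Fin N → X) (g : Fin N → C(X, ℝ)) :
    (∑ j, f (θ j)) * slater θ g = ∑ i, slater θ (Function.update g i (f * g i)) := by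
  simp only [slater_apply, det_apply', of_apply]
  rw [Finset.sum_comm, Finset.mul_sum]
  refine Finset.sum_congr rfl fun σ _ => ?_
  rw [← Equiv.sum_comp σ.symm]
  simp only [Finset.sum_mul]
  refine Finset.sum_congr rfl fun j _ => ?_
  rw [mul_left_comm]
  congr 1
  rw [← Finset.mul_prod_erase _ _ (Finset.mem_univ (σ.symm j)),
    ← Finset.mul_prod_erase _ (fun i => (Function.update g j (f * g j) (σ i)) (θ i))
      (Finset.mem_univ (σ.symm j))]
  simp only [Equiv.apply_symm_apply, Function.update_self, ContinuousMap.mul_apply]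
  rw [mul_assoc]
  congr 2
  refine Finset.prod_congr rfl fun i hi => ?_
  have : σ i ≠ j := fun h => (Finset.ne_of_mem_erase hi) (by rw [← h, Equiv.symm_apply_apply])
  rw [Function.update_of_ne this]

/-- Andréief's identity. -/
theorem integral_slater_mul_slater [SecondCountableTopology X] (g h : Fin N → C(X, ℝ)) :
    ∫ θ, slater θ g * slater θ h ∂(Measure.pi fun _ : Fin N => ν)
      = (N.factorial : ℝ) * det (of fun i j => ip ν (g i) (h j)) := by
  have key : ∀ σ τ : Equiv.Perm (Fin N),
      ∫ θ : Fin N → X, (Equiv.Perm.sign σ : ℝ) * (∏ i, g (σ i) (θ i)) *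
        ((Equiv.Perm.sign τ : ℝ) * ∏ i, h (τ i) (θ i)) ∂(Measure.pi fun _ : Fin N => ν)
      = (Equiv.Perm.sign σ : ℝ) * (Equiv.Perm.sign τ : ℝ) *
          ∏ i, ip ν (g (σ i)) (h (τ i)) := by
    intro σ τ
    have := integral_fintype_prod_eq_prod (μ := fun _ : Fin N => ν)
      (fun i x => g (σ i) x * h (τ i) x)
    simp only [ip]
    rw [← this, ← integral_const_mul]
    congr 1; ext θ
    rw [Finset.prod_mul_distrib]; ring
  have h_int : ∀ σ τ : Equiv.Perm (Fin N), Integrable (fun θ : Fin N → X =>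
      (Equiv.Perm.sign σ : ℝ) * (∏ i, g (σ i) (θ i)) *
        ((Equiv.Perm.sign τ : ℝ) * ∏ i, h (τ i) (θ i))) (Measure.pi fun _ : Fin N => ν) := by
    intro σ τ
    exact integrable_continuousMap _ ⟨fun θ : Fin N → X =>
      (Equiv.Perm.sign σ : ℝ) * (∏ i, g (σ i) (θ i)) *
        ((Equiv.Perm.sign τ : ℝ) * ∏ i, h (τ i) (θ i)), by fun_prop⟩
  simp only [slater_apply, det_apply', of_apply, Finset.sum_mul_sum]
  rw [integral_finsetSum _ fun σ _ => integrable_finsetSum _ fun τ _ => h_int σ τ]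
  simp_rw [integral_finsetSum _ fun τ _ => h_int _ τ, key]
  have inner : ∀ σ : Equiv.Perm (Fin N), ∑ τ : Equiv.Perm (Fin N), (Equiv.Perm.sign σ : ℝ) *
      (Equiv.Perm.sign τ : ℝ) * ∏ i, ip ν (g (σ i)) (h (τ i))
      = ∑ τ : Equiv.Perm (Fin N), (Equiv.Perm.sign τ : ℝ) * ∏ i, ip ν (g (τ i)) (h i) := by
    intro σ
    rw [← Equiv.sum_comp (Equiv.inv (Equiv.Perm (Fin N))),
      ← Equiv.sum_comp (Equiv.mulLeft σ⁻¹)]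
    refine Finset.sum_congr rfl fun τ _ => ?_
    simp only [Equiv.inv_apply, Equiv.coe_mulLeft, _root_.mul_inv_rev, inv_inv]
    rw [← Equiv.prod_comp (τ⁻¹ * σ)⁻¹]
    have h1 : (Equiv.Perm.sign σ : ℝ) * (Equiv.Perm.sign (τ⁻¹ * σ) : ℝ) = Equiv.Perm.sign τ := by
      rw [Equiv.Perm.sign_mul, Equiv.Perm.sign_inv]
      have := Int.units_mul_self (Equiv.Perm.sign σ)
      rw [mul_comm (Equiv.Perm.sign τ)]
      norm_cast
      rw [← mul_assoc, this, one_mul]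
    rw [h1]
    simp
  simp_rw [inner, Finset.sum_const, Finset.card_univ, Fintype.card_perm, Fintype.card_fin,
    nsmul_eq_mul]

theorem det_updateRow_updateRow_one {i j : Fin N} (hij : i ≠ j) (a b : Fin N → ℝ) :
    det (((1 : Matrix (Fin N) (Fin N) ℝ).updateRow i a).updateRow j b)
      = a i * b j - a j * b i := by
  have h : ((1 : Matrix (Fin N) (Fin N) ℝ).updateRow i a).updateRow j b
      = 1 + (of fun r (s : Fin 2) => ![(Pi.single i 1 : Fin N → ℝ) r, (Pi.single j 1 : Fin N → ℝ) r] s)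
        * (of fun (s : Fin 2) c => ![a c - (Pi.single i 1 : Fin N → ℝ) c,
            b c - (Pi.single j 1 : Fin N → ℝ) c] s) := by
    ext r c
    simp only [Matrix.add_apply, Matrix.mul_apply, Fin.sum_univ_two, of_apply, updateRow_apply,
      Matrix.one_apply, Matrix.cons_val_zero, Matrix.cons_val_one, Pi.single_apply]
    by_cases h1 : r = j
    · subst h1
      simp [hij.symm, eq_comm]
    · by_cases h2 : r = i
      · subst h2
        simp [h1, eq_comm]
      · simp [h1, h2]
  rw [h, det_one_add_mul_comm, det_fin_two]
  simp [Matrix.mul_apply, Pi.single_apply, hij, hij.symm]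

variable (φ : Fin N → C(X, ℝ))

/-- The component of `u` orthogonal to the family `φ`. -/
def resid (u : C(X, ℝ)) : C(X, ℝ) := u - ∑ c, ip ν (φ c) u • φ c

/-- The one-particle excitation sum. -/
def oneSlater (θ : Fin N → X) (v : Fin N → C(X, ℝ)) : ℝ :=
  ∑ i, slater θ (Function.update φ i (v i))

/-- The two-particle excitation sum. -/
def twoSlater (θ : Fin N → X) (v w : Fin N → C(X, ℝ)) : ℝ :=
  ∑ i, ∑ j ∈ Finset.univ.erase i,
    slater θ (Function.update (Function.update φ i (v i)) j (w j))

/-- The mean of the linear statistic of `f`. -/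
def slaterMean (f : C(X, ℝ)) : ℝ := ∑ i, ip ν (φ i) (f * φ i)

/-- The particle-hole amplitudes of `f`. -/
def slaterB (f : C(X, ℝ)) (i : Fin N) : C(X, ℝ) := resid ν φ (f * φ i)

/-- The one-particle amplitudes of the square of the linear statistic of `f`. -/
def slaterA (f : C(X, ℝ)) (i : Fin N) : C(X, ℝ) :=
  (2 * slaterMean ν φ f) • slaterB ν φ f i + resid ν φ (f * slaterB ν φ f i)
    - ∑ j, ip ν (φ j) (f * φ i) • slaterB ν φ f j

/-- The second moment of the linear statistic of `f`. -/
def slaterSq (f : C(X, ℝ)) : ℝ :=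
  slaterMean ν φ f ^ 2 + ∑ i, ip ν (slaterB ν φ f i) (slaterB ν φ f i)

theorem slater_update_basis (θ : Fin N → X) (i c : Fin N) :
    slater θ (Function.update φ i (φ c)) = if c = i then slater θ φ else 0 := by
  split_ifs with h
  · rw [h, Function.update_eq_self]
  · exact (slater θ).map_eq_zero_of_eq _ (i := i) (j := c)
      (by rw [Function.update_self, Function.update_of_ne h]) (Ne.symm h)

theorem slater_update_eq (θ : Fin N → X) (i : Fin N) (u : C(X, ℝ)) :
    slater θ (Function.update φ i u)
      = ip ν (φ i) u * slater θ φ + slater θ (Function.update φ i (resid ν φ u)) := by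
  have hu : u = resid ν φ u + ∑ c, ip ν (φ c) u • φ c := by simp [resid]
  conv_lhs => rw [hu]
  rw [AlternatingMap.map_update_add, AlternatingMap.map_update_sum]
  simp [AlternatingMap.map_update_smul, slater_update_basis, add_comm]

theorem slater_update_update_eq (θ : Fin N → X) {i j : Fin N} (hij : j ≠ i) (v u : C(X, ℝ)) :
    slater θ (Function.update (Function.update φ i v) j u)
      = ip ν (φ j) u * slater θ (Function.update φ i v)
        - ip ν (φ i) u * slater θ (Function.update φ j v)
        + slater θ (Function.update (Function.update φ i v) j (resid ν φ u)) := by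
  have hu : u = resid ν φ u + ∑ c, ip ν (φ c) u • φ c := by simp [resid]
  conv_lhs => rw [hu]
  rw [AlternatingMap.map_update_add, AlternatingMap.map_update_sum, add_comm]
  congr 1
  simp only [AlternatingMap.map_update_smul, smul_eq_mul]
  have hbasis : ∀ c, slater θ (Function.update (Function.update φ i v) j (φ c))
      = (if c = j then slater θ (Function.update φ i v) else 0)
        - (if c = i then slater θ (Function.update φ j v) else 0) := by
    intro c
    by_cases h1 : c = j
    · subst h1
      simp only [if_true, if_neg hij, sub_zero]
      congr 1
      rw [Function.update_eq_self_iff, Function.update_of_ne hij]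
    · by_cases h2 : c = i
      · subst h2
        simp only [if_true, if_neg hij.symm, zero_sub]
        rw [← AlternatingMap.map_swap _ _ hij]
        congr 1
        ext1 r
        by_cases hr : r = j
        · subst hr; simp [Function.update_of_ne hij.symm]
        · by_cases hr' : r = c
          · subst hr'; simp [Function.update_of_ne hij.symm]
          · simp [Equiv.swap_apply_of_ne_of_ne hr hr', Function.update_of_ne hr,
              Function.update_of_ne hr']
      · rw [if_neg h1, if_neg h2, sub_zero]
        exact (slater θ).map_eq_zero_of_eq _ (i := j) (j := c)
          (by rw [Function.update_self, Function.update_of_ne h1, Function.update_of_ne h2])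
          (Ne.symm h1)
  simp only [hbasis, mul_sub, Finset.sum_sub_distrib, mul_ite, mul_zero, Finset.sum_ite_eq',
    Finset.mem_univ, if_true]

theorem oneSlater_add (θ : Fin N → X) (v w : Fin N → C(X, ℝ)) :
    oneSlater φ θ (fun i => v i + w i) = oneSlater φ θ v + oneSlater φ θ w := by
  simp [oneSlater, AlternatingMap.map_update_add, Finset.sum_add_distrib]

theorem oneSlater_sub (θ : Fin N → X) (v w : Fin N → C(X, ℝ)) :
    oneSlater φ θ (fun i => v i - w i) = oneSlater φ θ v - oneSlater φ θ w := by
  simp [oneSlater, AlternatingMap.map_update_sub, Finset.sum_sub_distrib]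

theorem oneSlater_smul (θ : Fin N → X) (c : ℝ) (v : Fin N → C(X, ℝ)) :
    oneSlater φ θ (fun i => c • v i) = c * oneSlater φ θ v := by
  simp [oneSlater, AlternatingMap.map_update_smul, Finset.mul_sum]

theorem sum_mul_slater_basis (f : C(X, ℝ)) (θ : Fin N → X) :
    (∑ j, f (θ j)) * slater θ φ
      = slaterMean ν φ f * slater θ φ + oneSlater φ θ (slaterB ν φ f) := by
  rw [sum_mul_slater, slaterMean, oneSlater, Finset.sum_mul, ← Finset.sum_add_distrib]
  exact Finset.sum_congr rfl fun i _ => slater_update_eq ν φ θ i _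

theorem sum_mul_oneSlater (f : C(X, ℝ)) (θ : Fin N → X) (v : Fin N → C(X, ℝ)) :
    (∑ j, f (θ j)) * oneSlater φ θ v
      = (∑ i, ip ν (φ i) (f * v i)) * slater θ φ + slaterMean ν φ f * oneSlater φ θ v
        + oneSlater φ θ (fun i => resid ν φ (f * v i))
        - oneSlater φ θ (fun i => ∑ j, ip ν (φ j) (f * φ i) • v j)
        + twoSlater φ θ v (slaterB ν φ f) := by
  have h1 : ∀ i, (∑ j, f (θ j)) * slater θ (Function.update φ i (v i))
      = ip ν (φ i) (f * v i) * slater θ φ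
        + slater θ (Function.update φ i (resid ν φ (f * v i)))
        + (slaterMean ν φ f * slater θ (Function.update φ i (v i))
          - ∑ j, ip ν (φ i) (f * φ j) * slater θ (Function.update φ j (v i))
          + ∑ j ∈ Finset.univ.erase i,
              slater θ (Function.update (Function.update φ i (v i)) j (slaterB ν φ f j))) := by
    intro i
    rw [sum_mul_slater, ← Finset.add_sum_erase _ _ (Finset.mem_univ i)]
    congr 1
    · rw [Function.update_self, Function.update_idem, slater_update_eq ν]
    · rw [slaterMean, Finset.sum_mul, ← Finset.sum_sub_distrib,
        ← Finset.add_sum_erase _ _ (Finset.mem_univ i), sub_self, zero_add,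
        ← Finset.sum_add_distrib]
      refine Finset.sum_congr rfl fun j hj => ?_
      have hj' := Finset.ne_of_mem_erase hj
      rw [Function.update_of_ne hj', slater_update_update_eq ν φ θ hj']
      rfl
  have h2 : oneSlater φ θ (fun i => ∑ j, ip ν (φ j) (f * φ i) • v j)
      = ∑ i, ∑ j, ip ν (φ i) (f * φ j) * slater θ (Function.update φ j (v i)) := by
    rw [Finset.sum_comm]
    simp [oneSlater, AlternatingMap.map_update_sum, AlternatingMap.map_update_smul]
  rw [h2, oneSlater, Finset.mul_sum, Finset.sum_congr rfl fun i _ => h1 i]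
  simp only [Finset.sum_add_distrib, Finset.sum_sub_distrib, twoSlater, oneSlater,
    ← Finset.sum_mul, ← Finset.mul_sum]
  ring

theorem ip_resid_eq (u w : C(X, ℝ)) (hw : ∀ c, ip ν (φ c) w = 0) :
    ip ν w (resid ν φ u) = ip ν w u := by
  have hw' : ∀ c, ip ν w (φ c) = 0 := fun c => by rw [ip_comm, hw]
  simp [resid, ip_sub_right, ip_sum_right, ip_smul_right, hw']

variable {φ}
variable (hφ : ∀ i j, ip ν (φ i) (φ j) = if i = j then 1 else 0)
include hφ

theorem ip_resid (u : C(X, ℝ)) (c : Fin N) : ip ν (φ c) (resid ν φ u) = 0 := by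
  simp [resid, ip_sub_right, ip_sum_right, ip_smul_right, hφ]

theorem ip_slaterB (f : C(X, ℝ)) (i c : Fin N) : ip ν (φ c) (slaterB ν φ f i) = 0 :=
  ip_resid ν hφ _ c

theorem ip_slaterA (f : C(X, ℝ)) (i c : Fin N) : ip ν (φ c) (slaterA ν φ f i) = 0 := by
  simp [slaterA, ip_sub_right, ip_add_right, ip_sum_right, ip_smul_right, ip_slaterB ν hφ,
    ip_resid ν hφ]

theorem sq_sum_mul_slater (f : C(X, ℝ)) (θ : Fin N → X) :
    (∑ j, f (θ j)) ^ 2 * slater θ φ = slaterSq ν φ f * slater θ φ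
      + oneSlater φ θ (slaterA ν φ f) + twoSlater φ θ (slaterB ν φ f) (slaterB ν φ f) := by
  have h : ∀ i, ip ν (φ i) (f * slaterB ν φ f i) = ip ν (slaterB ν φ f i) (slaterB ν φ f i) := by
    intro i
    rw [← ip_mul_left, ip_comm]
    exact (ip_resid_eq ν φ (f * φ i) _ (ip_slaterB ν hφ f i)).symm
  rw [sq, mul_assoc, sum_mul_slater_basis ν, mul_add, mul_left_comm, sum_mul_slater_basis ν,
    sum_mul_oneSlater ν]
  have hA : oneSlater φ θ (slaterA ν φ f)
      = 2 * slaterMean ν φ f * oneSlater φ θ (slaterB ν φ f)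
        + oneSlater φ θ (fun i => resid ν φ (f * slaterB ν φ f i))
        - oneSlater φ θ (fun i => ∑ j, ip ν (φ j) (f * φ i) • slaterB ν φ f j) := by
    rw [← oneSlater_smul, ← oneSlater_add, ← oneSlater_sub]
    rfl
  rw [hA, Finset.sum_congr rfl fun i _ => h i, slaterSq]
  ring



variable [SecondCountableTopology X]

omit hφ in
theorem integral_slater_mul_eq_zero (g h : Fin N → C(X, ℝ)) (i : Fin N)
    (hi : ∀ r, ip ν (g r) (h i) = 0) :
    ∫ θ, slater θ g * slater θ h ∂(Measure.pi fun _ : Fin N => ν) = 0 := by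
  rw [integral_slater_mul_slater, det_eq_zero_of_column_eq_zero i (by simpa using hi), mul_zero]

omit hφ in
theorem integral_slater_mul_eq_zero' (g h : Fin N → C(X, ℝ)) (i : Fin N)
    (hi : ∀ r, ip ν (h r) (g i) = 0) :
    ∫ θ, slater θ g * slater θ h ∂(Measure.pi fun _ : Fin N => ν) = 0 := by
  rw [← integral_slater_mul_eq_zero ν h g i hi]
  simp only [mul_comm]

theorem integral_slater_sq :
    ∫ θ, slater θ φ * slater θ φ ∂(Measure.pi fun _ : Fin N => ν) = N.factorial := by
  have : (of fun i j => ip ν (φ i) (φ j)) = (1 : Matrix (Fin N) (Fin N) ℝ) := by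
    ext i j; simp [hφ, Matrix.one_apply]
  rw [integral_slater_mul_slater, this, det_one, mul_one]

omit hφ in
theorem integrable_slater_mul (g h : Fin N → C(X, ℝ)) :
    Integrable (fun θ => slater θ g * slater θ h) (Measure.pi fun _ : Fin N => ν) :=
  integrable_continuousMap _ ⟨fun θ : Fin N → X => slater θ g * slater θ h,
    (continuous_slater g).mul (continuous_slater h)⟩

variable {v w : Fin N → C(X, ℝ)} (hv : ∀ i c, ip ν (φ c) (v i) = 0)
  (hw : ∀ i c, ip ν (φ c) (w i) = 0)

include hv in
omit hφ in
theorem integral_slater_mul_oneSlater :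
    ∫ θ, slater θ φ * oneSlater φ θ v ∂(Measure.pi fun _ : Fin N => ν) = 0 := by
  simp only [oneSlater, Finset.mul_sum]
  rw [integral_finsetSum _ fun i _ => integrable_slater_mul ν _ _]
  refine Finset.sum_eq_zero fun i _ => integral_slater_mul_eq_zero ν _ _ i fun r => ?_
  rw [Function.update_self, hv]

include hv in
omit hφ in
theorem integral_slater_mul_twoSlater :
    ∫ θ, slater θ φ * twoSlater φ θ v v ∂(Measure.pi fun _ : Fin N => ν) = 0 := by
  simp only [twoSlater, Finset.mul_sum]
  rw [integral_finsetSum _ fun i _ => integrable_finsetSum _ fun j _ => integrable_slater_mul ν _ _]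
  refine Finset.sum_eq_zero fun i _ => ?_
  rw [integral_finsetSum _ fun i _ => integrable_slater_mul ν _ _]
  refine Finset.sum_eq_zero fun j _ => integral_slater_mul_eq_zero ν _ _ j fun r => ?_
  rw [Function.update_self, hv]

include hv hw in
theorem integral_oneSlater_mul_oneSlater :
    ∫ θ, oneSlater φ θ v * oneSlater φ θ w ∂(Measure.pi fun _ : Fin N => ν)
      = N.factorial * ∑ i, ip ν (v i) (w i) := by
  simp only [oneSlater, Finset.sum_mul_sum]
  rw [integral_finsetSum _ fun i _ => integrable_finsetSum _ fun j _ => integrable_slater_mul ν _ _,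
    Finset.mul_sum]
  refine Finset.sum_congr rfl fun i _ => ?_
  rw [integral_finsetSum _ fun i _ => integrable_slater_mul ν _ _,
    Finset.sum_eq_single i]
  · rw [integral_slater_mul_slater]
    congr 1
    have : (of fun r c => ip ν (Function.update φ i (v i) r) (Function.update φ i (w i) c))
        = (1 : Matrix (Fin N) (Fin N) ℝ).updateRow i (Pi.single i (ip ν (v i) (w i))) := by
      ext r c
      simp only [of_apply, updateRow_apply, Matrix.one_apply, Pi.single_apply]
      by_cases hr : r = i
      · subst hr
        by_cases hc : c = r
        · subst hc; simp
        · simp [hc, ip_comm ν (v r) (φ c), hv]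
      · by_cases hc : c = i
        · subst hc; simp [hr, hw]
        · simp [hr, hc, hφ]
    have h2 : (Pi.single i (ip ν (v i) (w i)) : Fin N → ℝ)
        = ip ν (v i) (w i) • (1 : Matrix (Fin N) (Fin N) ℝ) i := by
      ext c; simp [Pi.single_apply, Matrix.one_apply, eq_comm]
    rw [this, h2, det_updateRow_smul]
    have : (1 : Matrix (Fin N) (Fin N) ℝ).updateRow i ((1 : Matrix (Fin N) (Fin N) ℝ) i) = 1 :=
      updateRow_eq_self _ _
    rw [this, det_one, mul_one]
  · intro j _ hj
    refine integral_slater_mul_eq_zero ν _ _ i fun r => ?_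
    rw [Function.update_of_ne hj.symm]
    by_cases hr : r = i
    · subst hr; rw [Function.update_self, ip_comm, hv]
    · rw [Function.update_of_ne hr, hφ, if_neg hr]
  · simp

include hv hw in
theorem integral_oneSlater_mul_twoSlater :
    ∫ θ, oneSlater φ θ v * twoSlater φ θ w w ∂(Measure.pi fun _ : Fin N => ν) = 0 := by
  simp only [oneSlater, twoSlater, Finset.sum_mul, Finset.mul_sum]
  rw [integral_finsetSum _ fun i _ => integrable_finsetSum _ fun j _ =>
    integrable_finsetSum _ fun k _ => integrable_slater_mul ν _ _]
  refine Finset.sum_eq_zero fun j _ => ?_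
  rw [integral_finsetSum _ fun j _ => integrable_finsetSum _ fun k _ => integrable_slater_mul ν _ _]
  refine Finset.sum_eq_zero fun k hk => ?_
  rw [integral_finsetSum _ fun k _ => integrable_slater_mul ν _ _]
  refine Finset.sum_eq_zero fun i _ => ?_
  have hkj := Finset.ne_of_mem_erase hk
  have key : ∀ l, l ≠ i → (l = j ∨ l = k) →
      ∫ θ, slater θ (Function.update φ i (v i)) *
        slater θ (Function.update (Function.update φ j (w j)) k (w k))
        ∂(Measure.pi fun _ : Fin N => ν) = 0 := by
    intro l hl hl'
    refine integral_slater_mul_eq_zero' ν _ _ l fun r => ?_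
    rw [Function.update_of_ne hl]
    by_cases hr : r = k
    · subst hr; rw [Function.update_self, ip_comm, hw]
    · rw [Function.update_of_ne hr]
      by_cases hr' : r = j
      · subst hr'; rw [Function.update_self, ip_comm, hw]
      · rw [Function.update_of_ne hr', hφ, if_neg (by rintro rfl; tauto)]
  by_cases h : j = i
  · exact key k (by rw [← h]; exact hkj) (Or.inr rfl)
  · exact key j h (Or.inl rfl)

include hv hw in
theorem integral_double_slater {i j : Fin N} (hij : j ≠ i) :
    ∫ θ, slater θ (Function.update (Function.update φ i (v i)) j (v j)) *
        slater θ (Function.update (Function.update φ i (w i)) j (w j))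
        ∂(Measure.pi fun _ : Fin N => ν)
      = N.factorial * (ip ν (v i) (w i) * ip ν (v j) (w j)
          - ip ν (v i) (w j) * ip ν (v j) (w i)) := by
  rw [integral_slater_mul_slater]
  congr 1
  have : (of fun r c => ip ν (Function.update (Function.update φ i (v i)) j (v j) r)
        (Function.update (Function.update φ i (w i)) j (w j) c))
      = ((1 : Matrix (Fin N) (Fin N) ℝ).updateRow i
          (fun c => if c = i then ip ν (v i) (w i) else if c = j then ip ν (v i) (w j) else 0)
          ).updateRow j
          (fun c => if c = i then ip ν (v j) (w i) else if c = j then ip ν (v j) (w j) else 0) := by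
    ext r c
    simp only [of_apply, updateRow_apply, Matrix.one_apply]
    have h1 : ∀ a c, ip ν (v a) (Function.update (Function.update φ i (w i)) j (w j) c)
        = if c = i then ip ν (v a) (w i) else if c = j then ip ν (v a) (w j) else 0 := by
      intro a c
      by_cases hc : c = j
      · subst hc; simp [hij]
      · by_cases hc' : c = i
        · subst hc'; simp [hc]
        · simp [hc, hc', ip_comm ν (v a), hv]
    by_cases hr : r = j
    · subst hr; simp [h1]
    · by_cases hr' : r = i
      · subst hr'; simp [hr, h1]
      · rw [Function.update_of_ne hr, Function.update_of_ne hr', if_neg hr, if_neg hr']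
        by_cases hc : c = j
        · subst hc; rw [Function.update_self, hw, if_neg hr]
        · by_cases hc' : c = i
          · subst hc'; rw [Function.update_of_ne hc, Function.update_self, hw, if_neg hr']
          · rw [Function.update_of_ne hc, Function.update_of_ne hc', hφ]
  rw [this, det_updateRow_updateRow_one hij.symm]
  simp [hij]

omit hφ in
theorem update_update_comm_slater (θ : Fin N → X) {i j : Fin N} (hij : j ≠ i)
    (a b : C(X, ℝ)) : slater θ (Function.update (Function.update φ i a) j b)
      = slater θ (Function.update (Function.update φ j b) i a) := by
  rw [Function.update_comm hij]

include hv hw in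
theorem integral_twoSlater_mul_twoSlater :
    ∫ θ, twoSlater φ θ v v * twoSlater φ θ w w ∂(Measure.pi fun _ : Fin N => ν)
      = N.factorial * (2 * (∑ i, ip ν (v i) (w i)) ^ 2
          - 2 * ∑ i, ∑ j, ip ν (v i) (w j) * ip ν (v j) (w i)) := by
  have key : ∀ i, ∀ j ∈ Finset.univ.erase i,
      ∫ θ, slater θ (Function.update (Function.update φ i (v i)) j (v j)) * twoSlater φ θ w w
        ∂(Measure.pi fun _ : Fin N => ν)
      = N.factorial * (2 * (ip ν (v i) (w i) * ip ν (v j) (w j)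
          - ip ν (v i) (w j) * ip ν (v j) (w i))) := by
    intro i j hj
    have hij := Finset.ne_of_mem_erase hj
    simp only [twoSlater, Finset.mul_sum]
    rw [integral_finsetSum _ fun i _ => integrable_finsetSum _ fun j _ =>
      integrable_slater_mul ν _ _]
    simp_rw [integral_finsetSum _ fun j _ => integrable_slater_mul ν _ _]
    have hz : ∀ k, ∀ l ∈ Finset.univ.erase k,
        ∫ θ, slater θ (Function.update (Function.update φ i (v i)) j (v j)) *
          slater θ (Function.update (Function.update φ k (w k)) l (w l))
          ∂(Measure.pi fun _ : Fin N => ν)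
        = (if k = i then if l = j then N.factorial * (ip ν (v i) (w i) * ip ν (v j) (w j)
            - ip ν (v i) (w j) * ip ν (v j) (w i)) else 0 else 0) +
          (if k = j then if l = i then N.factorial * (ip ν (v i) (w i) * ip ν (v j) (w j)
            - ip ν (v i) (w j) * ip ν (v j) (w i)) else 0 else 0) := by
      intro k l hl
      have hkl := Finset.ne_of_mem_erase hl
      have zero : ∀ p, p ≠ k → p ≠ l → (p = i ∨ p = j) →
          ∫ θ, slater θ (Function.update (Function.update φ i (v i)) j (v j)) *
            slater θ (Function.update (Function.update φ k (w k)) l (w l))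
            ∂(Measure.pi fun _ : Fin N => ν) = 0 := by
        intro p hpk hpl hp
        refine integral_slater_mul_eq_zero ν _ _ p fun r => ?_
        rw [Function.update_of_ne hpl, Function.update_of_ne hpk]
        by_cases hr : r = j
        · subst hr; rw [Function.update_self, ip_comm, hv]
        · rw [Function.update_of_ne hr]
          by_cases hr' : r = i
          · subst hr'; rw [Function.update_self, ip_comm, hv]
          · rw [Function.update_of_ne hr', hφ, if_neg (by rintro rfl; tauto)]
      by_cases h1 : k = i
      · subst h1
        by_cases h2 : l = j
        · subst h2
          simp [hkl.symm, integral_double_slater ν hφ hv hw hij]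
        · rw [zero j hij (Ne.symm h2) (Or.inr rfl)]
          simp [h2, hij.symm]
      · by_cases h2 : l = i
        · subst h2
          by_cases h3 : k = j
          · subst h3
            simp only [update_update_comm_slater (φ := φ) _ hkl,
              integral_double_slater ν hφ hv hw hij]
            simp [h1]
          · rw [zero j (Ne.symm h3) hij (Or.inr rfl)]
            simp [h1, h3]
        · rw [zero i (Ne.symm h1) (Ne.symm h2) (Or.inl rfl)]
          simp [h1, h2]
    rw [Finset.sum_congr rfl fun k _ => Finset.sum_congr rfl fun l hl => hz k l hl]
    simp only [Finset.sum_add_distrib, Finset.sum_ite_irrel, Finset.sum_const_zero,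
      Finset.sum_ite_eq', Finset.mem_univ, if_true, Finset.mem_erase, and_true, hij, hij.symm,
      ne_eq, not_false_eq_true]
    ring
  have step : ∀ θ, twoSlater φ θ v v * twoSlater φ θ w w = ∑ i, ∑ j ∈ Finset.univ.erase i,
      slater θ (Function.update (Function.update φ i (v i)) j (v j)) * twoSlater φ θ w w := by
    intro θ
    conv_lhs => rw [twoSlater]
    simp only [Finset.sum_mul]
  have h_int : ∀ i j, Integrable (fun θ => slater θ (Function.update (Function.update φ i (v i)) j
      (v j)) * twoSlater φ θ w w) (Measure.pi fun _ : Fin N => ν) := by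
    intro i j
    simp only [twoSlater, Finset.mul_sum]
    exact integrable_finsetSum _ fun i _ => integrable_finsetSum _ fun j _ =>
      integrable_slater_mul ν _ _
  simp_rw [step]
  rw [integral_finsetSum _ fun i _ => integrable_finsetSum _ fun j _ => h_int i j]
  simp_rw [integral_finsetSum _ fun j _ => h_int _ j]
  rw [Finset.sum_congr rfl fun i _ => Finset.sum_congr rfl fun j hj => key i j hj]
  have full : ∀ i, ∑ j ∈ Finset.univ.erase i, (N.factorial : ℝ) * (2 *
      (ip ν (v i) (w i) * ip ν (v j) (w j) - ip ν (v i) (w j) * ip ν (v j) (w i)))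
      = ∑ j, (N.factorial : ℝ) * (2 *
      (ip ν (v i) (w i) * ip ν (v j) (w j) - ip ν (v i) (w j) * ip ν (v j) (w i))) := by
    intro i
    rw [← Finset.add_sum_erase _ _ (Finset.mem_univ i)]
    ring
  simp_rw [full, ← Finset.mul_sum, Finset.sum_sub_distrib]
  rw [sq, Finset.sum_mul_sum]
  ring

/-- The second moment of a linear statistic in the determinantal ensemble. -/
theorem integral_sq_mul_slater_sq (f : C(X, ℝ)) :
    ∫ θ, (∑ j, f (θ j)) ^ 2 * slater θ φ ^ 2 ∂(Measure.pi fun _ : Fin N => ν)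
      = N.factorial * slaterSq ν φ f := by
  have h : ∀ θ, (∑ j, f (θ j)) ^ 2 * slater θ φ ^ 2
      = slaterSq ν φ f * (slater θ φ * slater θ φ)
        + slater θ φ * oneSlater φ θ (slaterA ν φ f)
        + slater θ φ * twoSlater φ θ (slaterB ν φ f) (slaterB ν φ f) := by
    intro θ
    rw [sq (slater θ φ), ← mul_assoc, sq_sum_mul_slater ν hφ]
    ring
  simp_rw [h]
  have i1 := integrable_slater_mul ν φ φ
  have i2 : Integrable (fun θ => slater θ φ * oneSlater φ θ (slaterA ν φ f))
      (Measure.pi fun _ : Fin N => ν) := by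
    simp only [oneSlater, Finset.mul_sum]
    exact integrable_finsetSum _ fun j _ => integrable_slater_mul ν _ _
  have i3 : Integrable (fun θ => slater θ φ * twoSlater φ θ (slaterB ν φ f) (slaterB ν φ f))
      (Measure.pi fun _ : Fin N => ν) := by
    simp only [twoSlater, Finset.mul_sum]
    exact integrable_finsetSum _ fun i _ => integrable_finsetSum _ fun j _ =>
      integrable_slater_mul ν _ _
  rw [integral_add ((i1.const_mul _).fun_add i2) i3, integral_add (i1.const_mul _) i2,
    integral_const_mul, integral_slater_sq ν hφ,
    integral_slater_mul_oneSlater ν fun i c => ip_slaterA ν hφ f i c,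
    integral_slater_mul_twoSlater ν fun i c => ip_slaterB ν hφ f i c]
  ring

/-- The covariance of the squares of two linear statistics. -/
def slaterCov (φ : Fin N → C(X, ℝ)) (f g : C(X, ℝ)) : ℝ :=
  ∑ i, ip ν (slaterA ν φ f i) (slaterA ν φ g i)
    + (2 * (∑ i, ip ν (slaterB ν φ f i) (slaterB ν φ g i)) ^ 2
      - 2 * ∑ i, ∑ j, ip ν (slaterB ν φ f i) (slaterB ν φ g j)
          * ip ν (slaterB ν φ f j) (slaterB ν φ g i))

/-- Mixed second moments of the squares of two linear statistics. -/
theorem integral_sq_mul_sq_mul_slater_sq (f g : C(X, ℝ)) :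
    ∫ θ, (∑ j, f (θ j)) ^ 2 * (∑ j, g (θ j)) ^ 2 * slater θ φ ^ 2
        ∂(Measure.pi fun _ : Fin N => ν)
      = N.factorial * (slaterSq ν φ f * slaterSq ν φ g + slaterCov ν φ f g) := by
  have hA := fun f : C(X, ℝ) => fun i c => ip_slaterA ν hφ f i c
  have hB := fun f : C(X, ℝ) => fun i c => ip_slaterB ν hφ f i c
  have h : ∀ θ, (∑ j, f (θ j)) ^ 2 * (∑ j, g (θ j)) ^ 2 * slater θ φ ^ 2
      = slaterSq ν φ f * slaterSq ν φ g * (slater θ φ * slater θ φ)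
        + slaterSq ν φ f * (slater θ φ * oneSlater φ θ (slaterA ν φ g))
        + slaterSq ν φ f * (slater θ φ * twoSlater φ θ (slaterB ν φ g) (slaterB ν φ g))
        + slaterSq ν φ g * (slater θ φ * oneSlater φ θ (slaterA ν φ f))
        + slaterSq ν φ g * (slater θ φ * twoSlater φ θ (slaterB ν φ f) (slaterB ν φ f))
        + oneSlater φ θ (slaterA ν φ f) * oneSlater φ θ (slaterA ν φ g)
        + oneSlater φ θ (slaterA ν φ f) * twoSlater φ θ (slaterB ν φ g) (slaterB ν φ g)
        + oneSlater φ θ (slaterA ν φ g) * twoSlater φ θ (slaterB ν φ f) (slaterB ν φ f)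
        + twoSlater φ θ (slaterB ν φ f) (slaterB ν φ f)
          * twoSlater φ θ (slaterB ν φ g) (slaterB ν φ g) := by
    intro θ
    have : (∑ j, f (θ j)) ^ 2 * (∑ j, g (θ j)) ^ 2 * slater θ φ ^ 2
      = ((∑ j, f (θ j)) ^ 2 * slater θ φ) * ((∑ j, g (θ j)) ^ 2 * slater θ φ) := by ring
    rw [this, sq_sum_mul_slater ν hφ, sq_sum_mul_slater ν hφ]
    ring
  simp_rw [h]
  have one_cont : ∀ v, Continuous fun θ : Fin N → X => oneSlater φ θ v := fun v =>
    continuous_finsetSum _ fun i _ => continuous_slater _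
  have two_cont : ∀ v w, Continuous fun θ : Fin N → X => twoSlater φ θ v w := fun v w =>
    continuous_finsetSum _ fun i _ => continuous_finsetSum _ fun j _ => continuous_slater _
  have zero_cont := continuous_slater (X := X) φ
  have h_int : ∀ F G : (Fin N → X) → ℝ, Continuous F → Continuous G → Integrable
      (fun θ => F θ * G θ) (Measure.pi fun _ : Fin N => ν) := fun F G hF hG =>
    integrable_continuousMap _ ⟨fun θ => F θ * G θ, hF.mul hG⟩
  have i1 := (h_int _ _ zero_cont zero_cont).const_mul (slaterSq ν φ f * slaterSq ν φ g)
  have i2 := fun f g => (h_int _ _ zero_cont (one_cont (slaterA ν φ g))).const_mul (slaterSq ν φ f)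
  have i3 := fun f g => (h_int _ _ zero_cont (two_cont (slaterB ν φ g) (slaterB ν φ g))).const_mul
    (slaterSq ν φ f)
  have i4 := h_int _ _ (one_cont (slaterA ν φ f)) (one_cont (slaterA ν φ g))
  have i5 := fun f g => h_int _ _ (one_cont (slaterA ν φ f))
    (two_cont (slaterB ν φ g) (slaterB ν φ g))
  have i6 := h_int _ _ (two_cont (slaterB ν φ f) (slaterB ν φ f))
    (two_cont (slaterB ν φ g) (slaterB ν φ g))
  have s1 := i1.fun_add (i2 f g)
  have s2 := s1.fun_add (i3 f g)
  have s3 := s2.fun_add (i2 g f)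
  have s4 := s3.fun_add (i3 g f)
  have s5 := s4.fun_add i4
  have s6 := s5.fun_add (i5 f g)
  have s7 := s6.fun_add (i5 g f)
  rw [integral_add s7 i6, integral_add s6 (i5 g f), integral_add s5 (i5 f g), integral_add s4 i4,
    integral_add s3 (i3 g f), integral_add s2 (i2 g f), integral_add s1 (i3 f g),
    integral_add i1 (i2 f g)]
  simp only [integral_const_mul, integral_slater_sq ν hφ,
    integral_slater_mul_oneSlater ν (hA _), integral_slater_mul_twoSlater ν (hB _),
    integral_oneSlater_mul_oneSlater ν hφ (hA f) (hA g),
    integral_oneSlater_mul_twoSlater ν hφ (hA _) (hB _),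
    integral_twoSlater_mul_twoSlater ν hφ (hB f) (hB g), slaterCov]
  ring

end Slater

section Circle

instance fact_two_pi_pos : Fact (0 < 2 * Real.pi) := ⟨Real.two_pi_pos⟩

/-- The circle of angles. -/
abbrev Ang : Type := AddCircle (2 * Real.pi)

/-- The normalized measure on the circle of angles. -/
abbrev angM : Measure Ang := AddCircle.haarAddCircle

/-- `cos (k x)` on the circle. -/
def cosC (k : ℤ) : C(Ang, ℝ) := ⟨fun x => (fourier k x : ℂ).re, by fun_prop⟩

/-- `sin (k x)` on the circle. -/
def sinC (k : ℤ) : C(Ang, ℝ) := ⟨fun x => (fourier k x : ℂ).im, by fun_prop⟩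

theorem fourier_coe_two_pi (k : ℤ) (t : ℝ) :
    (fourier k (t : Ang) : ℂ) = Complex.exp ((k * t : ℝ) * Complex.I) := by
  rw [fourier_coe_apply]
  congr 1
  have : (Real.pi : ℂ) ≠ 0 := by exact_mod_cast Real.pi_ne_zero
  push_cast
  field_simp

theorem cosC_coe (k : ℤ) (t : ℝ) : cosC k (t : Ang) = Real.cos (k * t) := by
  simp only [cosC, ContinuousMap.coe_mk, fourier_coe_two_pi, Complex.exp_ofReal_mul_I_re]

theorem sinC_coe (k : ℤ) (t : ℝ) : sinC k (t : Ang) = Real.sin (k * t) := by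
  simp only [sinC, ContinuousMap.coe_mk, fourier_coe_two_pi, Complex.exp_ofReal_mul_I_im]

theorem cosC_zero : cosC 0 = 1 := by
  ext x; induction x using QuotientAddGroup.induction_on with | _ t => simp [cosC_coe]

theorem cosC_neg (k : ℤ) : cosC (-k) = cosC k := by
  ext x; induction x using QuotientAddGroup.induction_on with | _ t => simp [cosC_coe]

theorem cosC_mul_cosC (j k : ℤ) (x : Ang) :
    2 * (cosC j x * cosC k x) = cosC (j + k) x + cosC (j - k) x := by
  induction x using QuotientAddGroup.induction_on with
  | _ t =>
    simp only [cosC_coe, Int.cast_add, Int.cast_sub, add_mul, sub_mul, Real.cos_add, Real.cos_sub]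
    ring

theorem sinC_mul_sinC (j k : ℤ) (x : Ang) :
    2 * (sinC j x * sinC k x) = cosC (j - k) x - cosC (j + k) x := by
  induction x using QuotientAddGroup.induction_on with
  | _ t =>
    simp only [cosC_coe, sinC_coe, Int.cast_add, Int.cast_sub, add_mul, sub_mul, Real.cos_add,
      Real.cos_sub]
    ring

theorem sinC_sq_add_cosC_sq (k : ℤ) (x : Ang) : sinC k x ^ 2 + cosC k x ^ 2 = 1 := by
  induction x using QuotientAddGroup.induction_on with
  | _ t => simp [cosC_coe, sinC_coe]

theorem hasDerivAt_cosC (k : ℤ) (x : Ang) (v t₀ : ℝ) :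
    HasDerivAt (fun t : ℝ => cosC k (x + ((t * v : ℝ) : Ang)))
      (-(k * v * sinC k (x + ((t₀ * v : ℝ) : Ang)))) t₀ := by
  induction x using QuotientAddGroup.induction_on with
  | _ y =>
    simp only [← QuotientAddGroup.mk_add]
    have := ((((hasDerivAt_id t₀).mul_const v).const_add y).const_mul (k : ℝ)).cos
    convert this using 1
    · ext t; exact cosC_coe _ _
    · simp only [id]
      rw [show sinC k _ = _ from sinC_coe k (y + t₀ * v)]
      ring

theorem hasDerivAt_sinC (k : ℤ) (x : Ang) (v t₀ : ℝ) :
    HasDerivAt (fun t : ℝ => sinC k (x + ((t * v : ℝ) : Ang)))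
      (k * v * cosC k (x + ((t₀ * v : ℝ) : Ang))) t₀ := by
  induction x using QuotientAddGroup.induction_on with
  | _ y =>
    simp only [← QuotientAddGroup.mk_add]
    have := ((((hasDerivAt_id t₀).mul_const v).const_add y).const_mul (k : ℝ)).sin
    convert this using 1
    · ext t; exact sinC_coe _ _
    · simp only [id]
      rw [show cosC k _ = _ from cosC_coe k (y + t₀ * v)]
      ring

theorem integral_cosC (k : ℤ) : ∫ x, cosC k x ∂angM = if k = 0 then 1 else 0 := by
  split_ifs with h
  · subst h; simp [cosC_zero]
  · have hk : (k : ℝ) ≠ 0 := by exact_mod_cast h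
    have key : ∀ x : Ang, cosC k (x + ((Real.pi / k : ℝ) : Ang)) = -cosC k x := by
      intro x
      induction x using QuotientAddGroup.induction_on with
      | _ y =>
        rw [← QuotientAddGroup.mk_add, show cosC k _ = _ from cosC_coe k _, cosC_coe, mul_add,
          mul_div_cancel₀ _ hk, Real.cos_add_pi]
    have := integral_add_right_eq_self (μ := angM) (fun x => cosC k x) ((Real.pi / k : ℝ) : Ang)
    simp only [key, integral_neg] at this
    linarith

theorem ip_cosC (j k : ℤ) : 2 * ip angM (cosC j) (cosC k)
    = (if j + k = 0 then 1 else 0) + (if j - k = 0 then 1 else 0) := by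
  rw [ip, ← integral_const_mul, ← integral_cosC, ← integral_cosC, ← integral_add
    (integrable_continuousMap _ _) (integrable_continuousMap _ _)]
  simp only [cosC_mul_cosC]

/-- The normalized cosine basis. -/
def phi (a : ℕ) : C(Ang, ℝ) := (if a = 0 then 1 else √2 : ℝ) • cosC a

theorem ip_phi (a b : ℕ) : ip angM (phi a) (phi b) = if a = b then 1 else 0 := by
  have h := ip_cosC a b
  have h2 : √2 * √2 = (2 : ℝ) := Real.mul_self_sqrt (by norm_num)
  rw [phi, phi, ip_smul_left, ip_smul_right]
  by_cases ha : a = 0 <;> by_cases hb : b = 0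
  · subst ha; subst hb; simp at h ⊢; linarith
  · subst ha; simp [hb, Ne.symm hb] at h ⊢; exact h
  · subst hb; simp [ha] at h ⊢; exact h
  · have h1 : ¬ ((a : ℤ) + b = 0) := by omega
    rw [if_neg h1] at h
    rw [if_neg ha, if_neg hb, ← mul_assoc, h2, h, zero_add]
    simp only [sub_eq_zero, Nat.cast_inj]

end Circle

section Coefficients

/-- The weights distinguishing the constant mode from the other cosine modes. -/
def cw (a : ℕ) : ℝ := if a = 0 then 1 / √2 else 1

theorem cw_nonneg (a : ℕ) : 0 ≤ cw a := by unfold cw; split_ifs <;> positivity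

theorem cw_le_one (a : ℕ) : cw a ≤ 1 := by
  unfold cw; split_ifs
  · rw [div_le_one (by positivity)]
    exact Real.one_le_sqrt.mpr (by norm_num)
  · rfl

theorem cw_of_pos {a : ℕ} (h : a ≠ 0) : cw a = 1 := if_neg h

theorem cw_zero_sq : cw 0 ^ 2 = 1 / 2 := by simp [cw]

theorem phi_eq (a : ℕ) : phi a = (√2 * cw a) • cosC a := by
  unfold phi cw; split_ifs with h
  · congr 1; field_simp
  · simp

/-- The statistic `2 cos (k x)`, whose sum over the eigenangles is the trace of the `k`-th power. -/
def fC (k : ℕ) : C(Ang, ℝ) := (2 : ℝ) • cosC k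

/-- The matrix coefficients of multiplication by `2 cos (k x)` in the cosine basis. -/
def cM (k p a : ℕ) : ℝ :=
  cw p * cw a * ((if p = a + k then 1 else 0) + (if a = p + k then 1 else 0)
    + (if p + a = k then 1 else 0))

theorem cM_nonneg (k p a : ℕ) : 0 ≤ cM k p a := by
  have := cw_nonneg p
  have := cw_nonneg a
  unfold cM
  positivity

theorem cM_le_three (k p a : ℕ) : cM k p a ≤ 3 := by
  have h1 : cw p * cw a ≤ 1 := mul_le_one₀ (cw_le_one p) (cw_nonneg a) (cw_le_one a)
  have h2 := mul_nonneg (cw_nonneg p) (cw_nonneg a)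
  unfold cM
  split_ifs <;> linarith

theorem cM_support {k p a : ℕ} (h : cM k p a ≠ 0) : p = a + k ∨ a = p + k ∨ p + a = k := by
  by_contra! h'
  exact h (by simp [cM, h'])

theorem fC_mul_phi {k : ℕ} (hk : k ≠ 0) (a : ℕ) {L : ℕ} (hL : a + k < L) :
    fC k * phi a = ∑ p ∈ Finset.range L, cM k p a • phi p := by
  have hterm : ∀ p, cM k p a • phi p = (√2 * cw a) • ((if p = a + k then cw p ^ 2 • cosC p else 0)
      + (if a = p + k then cw p ^ 2 • cosC p else 0)
      + (if p + a = k then cw p ^ 2 • cosC p else 0)) := by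
    intro p
    rw [phi_eq, cM, smul_smul]
    ext x
    split_ifs <;> simp <;> ring
  have h1 : ∑ p ∈ Finset.range L, (if p = a + k then cw p ^ 2 • cosC p else 0)
      = cosC (a + k) := by
    rw [Finset.sum_ite_eq' , if_pos (Finset.mem_range.2 hL), cw_of_pos (by omega)]
    simp
  have h23 : ∑ p ∈ Finset.range L, (if a = p + k then cw p ^ 2 • cosC p else 0)
      + ∑ p ∈ Finset.range L, (if p + a = k then cw p ^ 2 • cosC p else 0) = cosC (a - k) := by
    rcases lt_trichotomy a k with h | h | h
    · rw [Finset.sum_eq_zero fun p _ => if_neg (by omega),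
        Finset.sum_eq_single (k - a) (fun p _ hp => if_neg (by omega))
          (fun hp => absurd (Finset.mem_range.2 (by omega)) hp), if_pos (by omega),
        cw_of_pos (by omega), ← cosC_neg]
      simp [Nat.cast_sub h.le]
    · subst h
      rw [Finset.sum_eq_single 0 (fun p _ hp => if_neg (by omega))
          (fun hp => absurd (Finset.mem_range.2 (by omega)) hp),
        Finset.sum_eq_single 0 (fun p _ hp => if_neg (by omega))
          (fun hp => absurd (Finset.mem_range.2 (by omega)) hp), if_pos (by omega),
        if_pos (by omega), cw_zero_sq, ← add_smul]
      norm_num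
    · rw [Finset.sum_eq_zero (f := fun p => if p + a = k then cw p ^ 2 • cosC p else 0)
          fun p _ => if_neg (by omega),
        Finset.sum_eq_single (a - k) (fun p _ hp => if_neg (by omega))
          (fun hp => absurd (Finset.mem_range.2 (by omega)) hp), if_pos (by omega),
        cw_of_pos (by omega)]
      simp [Nat.cast_sub h.le]
  simp only [hterm, ← Finset.smul_sum, Finset.sum_add_distrib]
  rw [add_assoc, h23, h1, phi_eq, fC]
  ext x
  have := cosC_mul_cosC a k x
  simp only [ContinuousMap.mul_apply, ContinuousMap.smul_apply, ContinuousMap.add_apply,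
    smul_eq_mul]
  rw [← this]; ring

theorem ip_phi_fC_mul_phi {k : ℕ} (hk : k ≠ 0) (p a : ℕ) :
    ip angM (phi p) (fC k * phi a) = cM k p a := by
  rw [fC_mul_phi hk a (L := a + k + p + 1) (by omega), ip_sum_right]
  simp only [ip_smul_right, ip_phi]
  rw [Finset.sum_eq_single p (fun q _ hq => by rw [if_neg hq.symm, mul_zero])
    (fun h => absurd (Finset.mem_range.2 (by omega)) h)]
  simp

variable (N : ℕ)

/-- The occupied cosine modes. -/
def modes (i : Fin N) : C(Ang, ℝ) := phi i

theorem ip_modes (i j : Fin N) : ip angM (modes N i) (modes N j) = if i = j then 1 else 0 := by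
  simp only [modes, ip_phi, Fin.ext_iff]

/-- A combination of unoccupied cosine modes. -/
def virt (L : ℕ) (u : ℕ → ℝ) : C(Ang, ℝ) := ∑ p ∈ Finset.Ico N L, u p • phi p

theorem ip_virt (L : ℕ) (u v : ℕ → ℝ) :
    ip angM (virt N L u) (virt N L v) = ∑ p ∈ Finset.Ico N L, u p * v p := by
  simp only [virt, ip_sum_left, ip_sum_right, ip_smul_left, ip_smul_right, ip_phi]
  refine Finset.sum_congr rfl fun p hp => ?_
  simp [Finset.sum_ite_eq', hp, mul_comm]

theorem resid_sum {ι : Type*} (s : Finset ι) (c : ι → ℝ) (g : ι → C(Ang, ℝ)) :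
    resid angM (modes N) (∑ i ∈ s, c i • g i) = ∑ i ∈ s, c i • resid angM (modes N) (g i) := by
  simp only [resid, ip_sum_right, ip_smul_right, smul_sub, Finset.sum_sub_distrib, Finset.smul_sum,
    Finset.sum_smul, smul_smul]
  rw [Finset.sum_comm]

theorem resid_phi (p : ℕ) : resid angM (modes N) (phi p) = if p < N then 0 else phi p := by
  simp only [resid, modes, ip_phi]
  split_ifs with h
  · rw [Finset.sum_eq_single (⟨p, h⟩ : Fin N)]
    · simp
    · intro b _ hb
      rw [if_neg (fun h' => hb (Fin.ext h')), zero_smul]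
    · simp
  · rw [Finset.sum_eq_zero, sub_zero]
    intro b _
    rw [if_neg (by omega), zero_smul]

theorem resid_fC_mul_phi {k : ℕ} (hk : k ≠ 0) (a : ℕ) {L : ℕ} (hL : a + k < L) :
    resid angM (modes N) (fC k * phi a) = virt N L (fun p => cM k p a) := by
  rw [fC_mul_phi hk a hL, resid_sum, virt]
  simp only [resid_phi, smul_ite, smul_zero]
  rw [Finset.range_eq_Ico]
  rcases le_total N L with h | h
  · rw [← Finset.sum_Ico_consecutive _ (Nat.zero_le N) h, Finset.sum_eq_zero, zero_add]
    · exact Finset.sum_congr rfl fun p hp => if_neg (by simp at hp; omega)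
    · intro p hp
      exact if_pos (by simpa using hp)
  · rw [Finset.Ico_eq_empty_of_le h, Finset.sum_empty]
    exact Finset.sum_eq_zero fun p hp => if_pos (by simp at hp; omega)

theorem slaterB_fC {k : ℕ} (hk : k ≠ 0) (i : Fin N) {L : ℕ} (hL : N + k ≤ L) :
    slaterB angM (modes N) (fC k) i = virt N L (fun p => cM k p i) :=
  resid_fC_mul_phi N hk i (by omega)

/-- The mean of the trace of the `k`-th power. -/
def kap (k : ℕ) : ℝ := ∑ a ∈ Finset.range N, cM k a a

theorem slaterMean_fC {k : ℕ} (hk : k ≠ 0) : slaterMean angM (modes N) (fC k) = kap N k := by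
  simp only [slaterMean, modes, ip_phi_fC_mul_phi hk, kap, Finset.sum_range]

/-- The second-order coefficients of `2 cos (k x)`. -/
def cT (k p a : ℕ) : ℝ :=
  ∑ c ∈ Finset.range (N + k), (if c < N then -1 else 1) * (cM k p c * cM k c a)

/-- The coefficients of the one-particle amplitudes of the squared trace. -/
def cA (k p a : ℕ) : ℝ := 2 * kap N k * cM k p a + cT N k p a

theorem virt_add (L : ℕ) (u v : ℕ → ℝ) : virt N L u + virt N L v = virt N L (fun p => u p + v p) := by
  simp [virt, add_smul, Finset.sum_add_distrib]

theorem virt_smul (L : ℕ) (c : ℝ) (u : ℕ → ℝ) : c • virt N L u = virt N L (fun p => c * u p) := by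
  simp [virt, Finset.smul_sum, smul_smul]

theorem virt_sum {ι : Type*} (s : Finset ι) (L : ℕ) (c : ι → ℝ) (u : ι → ℕ → ℝ) :
    ∑ i ∈ s, c i • virt N L (u i) = virt N L (fun p => ∑ i ∈ s, c i * u i p) := by
  simp only [virt, Finset.smul_sum, smul_smul, Finset.sum_smul]
  exact Finset.sum_comm

theorem slaterA_fC {k : ℕ} (hk : k ≠ 0) (i : Fin N) {L : ℕ} (hL : N + 2 * k ≤ L) :
    slaterA angM (modes N) (fC k) i = virt N L (fun p => cA N k p i) := by
  have hB : ∀ j, slaterB angM (modes N) (fC k) j = virt N L (fun p => cM k p j) := fun j =>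
    slaterB_fC N hk j (by omega)
  have h2 : resid angM (modes N) (fC k * slaterB angM (modes N) (fC k) i)
      = virt N L (fun p => ∑ c ∈ Finset.Ico N (N + k), cM k c i * cM k p c) := by
    rw [slaterB_fC N hk i le_rfl, virt, Finset.mul_sum]
    simp only [mul_smul_comm]
    rw [resid_sum, ← virt_sum]
    refine Finset.sum_congr rfl fun c hc => ?_
    rw [resid_fC_mul_phi N hk c (L := L) (by simp at hc; omega)]
  have h3 : ∑ j, ip angM (modes N j) (fC k * modes N i) • slaterB angM (modes N) (fC k) j
      = virt N L (fun p => ∑ c ∈ Finset.range N, cM k c i * cM k p c) := by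
    have hM : ∀ j : Fin N, ip angM (modes N j) (fC k * modes N i) = cM k j i := fun j =>
      ip_phi_fC_mul_phi hk _ _
    simp only [hM, hB]
    rw [virt_sum]
    congr 1; ext p
    rw [Finset.sum_range]
  rw [slaterA, h2, h3, slaterMean_fC N hk, hB, virt_smul, virt_add, sub_eq_add_neg,
    ← neg_one_smul ℝ, virt_smul, virt_add]
  congr 1; ext p
  have hT : cT N k p i = ∑ c ∈ Finset.range N, -(cM k c i * cM k p c)
      + ∑ c ∈ Finset.Ico N (N + k), cM k c i * cM k p c := by
    rw [cT, ← Finset.sum_range_add_sum_Ico _ (Nat.le_add_right N k)]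
    congr 1
    · refine Finset.sum_congr rfl fun c hc => ?_
      rw [if_pos (Finset.mem_range.1 hc)]; ring
    · refine Finset.sum_congr rfl fun c hc => ?_
      rw [if_neg (by simp at hc; omega)]; ring
  rw [cA, hT, Finset.sum_neg_distrib]
  ring

/-- Overlaps of the particle-hole amplitudes. -/
def cG (L k l a b : ℕ) : ℝ := ∑ p ∈ Finset.Ico N L, cM k p a * cM l p b

/-- The second moment of the trace of the `k`-th power in the eigenangle ensemble. -/
def trSq (k : ℕ) : ℝ := slaterSq angM (modes N) (fC k)

/-- The covariance of the squared traces in the eigenangle ensemble. -/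
def trCov (k l : ℕ) : ℝ := slaterCov angM (modes N) (fC k) (fC l)

theorem trSq_eq {k : ℕ} (hk : k ≠ 0) {L : ℕ} (hL : N + k ≤ L) :
    trSq N k = kap N k ^ 2 + ∑ a ∈ Finset.range N, cG N L k k a a := by
  rw [trSq, slaterSq, slaterMean_fC N hk, Finset.sum_range]
  simp only [slaterB_fC N hk _ hL, ip_virt, cG]

theorem trCov_eq {k l : ℕ} (hk : k ≠ 0) (hl : l ≠ 0) {L : ℕ} (hL : N + 2 * k ≤ L)
    (hL' : N + 2 * l ≤ L) :
    trCov N k l = ∑ a ∈ Finset.range N, ∑ p ∈ Finset.Ico N L, cA N k p a * cA N l p a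
      + (2 * (∑ a ∈ Finset.range N, cG N L k l a a) ^ 2
        - 2 * ∑ a ∈ Finset.range N, ∑ b ∈ Finset.range N, cG N L k l a b * cG N L k l b a) := by
  simp only [trCov, slaterCov, Finset.sum_range, slaterA_fC N hk _ hL, slaterA_fC N hl _ hL',
    slaterB_fC N hk _ (by omega : N + k ≤ L), slaterB_fC N hl _ (by omega : N + l ≤ L), ip_virt, cG]

end Coefficients

section CoefficientBounds

theorem cM_symm (k p a : ℕ) : cM k p a = cM k a p := by
  unfold cM
  rw [add_comm p a]
  ring

theorem sum_cM_le (k p : ℕ) (s : Finset ℕ) : ∑ c ∈ s, cM k p c ≤ 3 := by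
  have h1 : ∀ c, cM k p c ≤ (if c = p - k then 1 else 0) + (if c = p + k then 1 else 0)
      + (if c = k - p then 1 else 0) := by
    intro c
    have hw : cw p * cw c ≤ 1 := mul_le_one₀ (cw_le_one p) (cw_nonneg c) (cw_le_one c)
    have hw' := mul_nonneg (cw_nonneg p) (cw_nonneg c)
    refine (mul_le_of_le_one_left (by positivity) hw).trans ?_
    gcongr <;> split_ifs <;> first | omega | norm_num
  refine (Finset.sum_le_sum fun c _ => h1 c).trans ?_
  simp only [Finset.sum_add_distrib, Finset.sum_ite_eq']
  split_ifs <;> norm_num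

theorem cM_of_lt {k p a : ℕ} (h : a < p) :
    cM k p a = cw a * ((if p = a + k then 1 else 0) + (if p + a = k then 1 else 0)) := by
  rw [cM, cw_of_pos (by omega), one_mul, if_neg (by omega : ¬ a = p + k), add_zero]

theorem cM_sq_of_lt {k p a : ℕ} (h : a < p) :
    cM k p a ^ 2 = (if p = a + k then 1 else 0) + (if p + a = k then 1 else 0) := by
  rw [cM_of_lt h, mul_pow]
  by_cases ha : a = 0
  · subst ha
    rw [cw_zero_sq]
    simp only [zero_add, add_zero]
    split_ifs <;> norm_num
  · rw [cw_of_pos ha]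
    split_ifs <;> first | omega | norm_num

variable {N : ℕ}

theorem kap_eq {k : ℕ} (hk : k ≠ 0) :
    kap N k = if Even k ∧ k < 2 * N then 1 else 0 := by
  have h : ∀ a, cM k a a = if 2 * a = k then 1 else 0 := by
    intro a
    have h1 : ¬ a = a + k := by omega
    by_cases h2 : 2 * a = k
    · rw [cM, cw_of_pos (by omega), if_neg h1, if_pos (by omega), if_pos h2]; norm_num
    · rw [cM, if_neg h1, if_neg (by omega), if_neg h2]; norm_num
  simp only [kap, h]
  split_ifs with h1
  · obtain ⟨⟨r, hr⟩, h2⟩ := h1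
    rw [Finset.sum_eq_single r (fun b _ hb => if_neg (by omega))
      (fun hr' => absurd (Finset.mem_range.2 (by omega)) hr'), if_pos (by omega)]
  · refine Finset.sum_eq_zero fun a ha => if_neg fun h2 => h1 ⟨⟨a, by omega⟩, ?_⟩
    have := Finset.mem_range.1 ha
    omega

theorem kap_abs_le {k : ℕ} (hk : k ≠ 0) : |kap N k| ≤ 1 := by
  rw [kap_eq hk]; split_ifs <;> norm_num

theorem cT_support {k p a : ℕ} (ha : a < N) (hp : N ≤ p) (h : cT N k p a ≠ 0) :
    p = a + 2 * k ∨ p + a = 2 * k := by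
  obtain ⟨c, hc, hne⟩ := Finset.exists_ne_zero_of_sum_ne_zero h
  have h1 := cM_support (left_ne_zero_of_mul (right_ne_zero_of_mul hne))
  have h2 := cM_support (right_ne_zero_of_mul (right_ne_zero_of_mul hne))
  have := Finset.mem_range.1 hc
  omega

theorem cT_abs_le (k p a : ℕ) : |cT N k p a| ≤ 9 := by
  refine (Finset.abs_sum_le_sum_abs _ _).trans ?_
  have : ∀ c ∈ Finset.range (N + k), |(if c < N then -1 else 1) * (cM k p c * cM k c a)|
      ≤ cM k p c * 3 := by
    intro c _
    have h1 := cM_nonneg k p c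
    have h2 := cM_nonneg k c a
    rw [abs_mul, abs_of_nonneg (mul_nonneg h1 h2)]
    have : |(if c < N then -1 else 1 : ℝ)| = 1 := by split_ifs <;> norm_num
    rw [this, one_mul]
    exact mul_le_mul_of_nonneg_left (cM_le_three _ _ _) h1
  refine (Finset.sum_le_sum this).trans ?_
  rw [← Finset.sum_mul]
  linarith [sum_cM_le k p (Finset.range (N + k))]

theorem cT_shift {k a : ℕ} (hk : k ≠ 0) (ha0 : a ≠ 0) (ha : a < N) :
    cT N k (a + 2 * k) a = if a + k < N then -1 else 1 := by
  rw [cT, Finset.sum_eq_single (a + k)]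
  · have h1 : cM k (a + 2 * k) (a + k) = 1 := by
      rw [cM_of_lt (by omega), cw_of_pos (by omega), if_pos (by omega), if_neg (by omega)]; norm_num
    have h2 : cM k (a + k) a = 1 := by
      rw [cM_of_lt (by omega), cw_of_pos (by omega), if_pos (by omega), if_neg (by omega)]; norm_num
    rw [h1, h2]; norm_num
  · intro c hc hca
    by_contra hne
    have h1 := cM_support (left_ne_zero_of_mul (right_ne_zero_of_mul hne))
    have h2 := cM_support (right_ne_zero_of_mul (right_ne_zero_of_mul hne))
    have := Finset.mem_range.1 hc
    omega
  · intro h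
    exact absurd (Finset.mem_range.2 (by omega)) h

theorem cA_support {k p a : ℕ} (ha : a < N) (hp : N ≤ p) (h : cA N k p a ≠ 0) :
    p = a + k ∨ p + a = k ∨ p = a + 2 * k ∨ p + a = 2 * k := by
  by_cases h1 : cM k p a = 0
  · have : cT N k p a ≠ 0 := by simpa [cA, h1] using h
    have := cT_support ha hp this
    omega
  · have := cM_support h1
    omega

theorem cA_abs_le {k : ℕ} (hk : k ≠ 0) (p a : ℕ) : |cA N k p a| ≤ 15 := by
  have h1 := cT_abs_le (N := N) k p a
  have h2 := kap_abs_le (N := N) hk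
  have h3 := cM_le_three k p a
  have h4 := cM_nonneg k p a
  have h5 : |2 * kap N k * cM k p a| ≤ 6 := by
    rw [abs_mul, abs_mul, abs_of_nonneg h4, abs_two]
    nlinarith [abs_nonneg (kap N k)]
  exact (abs_add_le _ _).trans (by linarith)

variable (N) in
/-- Pairs of an occupied and an unoccupied mode. -/
abbrev pairs (L : ℕ) : Finset (ℕ × ℕ) := Finset.range N ×ˢ Finset.Ico N L

theorem mem_pairs {L : ℕ} {x : ℕ × ℕ} : x ∈ pairs N L ↔ x.1 < N ∧ N ≤ x.2 ∧ x.2 < L := by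
  simp [pairs]

theorem card_shift_le (L u : ℕ) : ((pairs N L).filter fun x => x.2 = x.1 + u).card ≤ u := by
  refine (Finset.card_le_card_of_injOn (t := Finset.range u) (fun x => x.2 - N) ?_ ?_).trans
    (by simp)
  · intro x hx
    simp only [Finset.coe_filter, Set.mem_ofPred_eq, mem_pairs] at hx
    simp; omega
  · intro x hx y hy hxy
    simp only [Finset.coe_filter, Set.mem_ofPred_eq, mem_pairs] at hx hy
    simp only at hxy
    ext <;> omega

theorem card_shift_le' (L u : ℕ) : ((pairs N L).filter fun x => x.2 = x.1 + u).card ≤ N := by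
  refine (Finset.card_le_card_of_injOn (t := Finset.range N) (fun x => x.1) ?_ ?_).trans
    (by simp)
  · intro x hx
    simp only [Finset.coe_filter, Set.mem_ofPred_eq, mem_pairs] at hx
    simp; omega
  · intro x hx y hy hxy
    simp only [Finset.coe_filter, Set.mem_ofPred_eq, mem_pairs] at hx hy
    simp only at hxy
    ext <;> omega

theorem card_refl_le (L u : ℕ) : ((pairs N L).filter fun x => x.2 + x.1 = u).card ≤ N := by
  refine (Finset.card_le_card_of_injOn (t := Finset.range N) (fun x => x.1) ?_ ?_).trans
    (by simp)
  · intro x hx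
    simp only [Finset.coe_filter, Set.mem_ofPred_eq, mem_pairs] at hx
    simp; omega
  · intro x hx y hy hxy
    simp only [Finset.coe_filter, Set.mem_ofPred_eq, mem_pairs] at hx hy
    simp only at hxy
    ext <;> omega

theorem card_both_le (L u v : ℕ) :
    ((pairs N L).filter fun x => x.2 = x.1 + u ∧ x.2 + x.1 = v).card ≤ 1 := by
  rw [Finset.card_le_one]
  intro x hx y hy
  simp only [Finset.mem_filter, mem_pairs] at hx hy
  ext <;> omega

theorem abs_sum_le_card {ι : Type*} [DecidableEq ι] {s t : Finset ι} {F : ι → ℝ} {C : ℝ}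
    (hC : 0 ≤ C) (hF : ∀ x ∈ s, |F x| ≤ C) (ht : ∀ x ∈ s, F x ≠ 0 → x ∈ t) :
    |∑ x ∈ s, F x| ≤ C * t.card := by
  have h1 : ∑ x ∈ s, F x = ∑ x ∈ s ∩ t, F x := by
    refine (Finset.sum_subset Finset.inter_subset_left fun x hx hx' => ?_).symm
    by_contra h
    exact hx' (Finset.mem_inter.2 ⟨hx, ht x hx h⟩)
  rw [h1]
  refine (Finset.abs_sum_le_sum_abs _ _).trans ?_
  refine (Finset.sum_le_card_nsmul _ _ C fun x hx => hF x (Finset.mem_inter.1 hx).1).trans ?_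
  rw [nsmul_eq_mul, mul_comm]
  exact mul_le_mul_of_nonneg_left (by exact_mod_cast Finset.card_le_card Finset.inter_subset_right) hC

theorem sum_cG_diag (L k l : ℕ) : ∑ a ∈ Finset.range N, cG N L k l a a
    = ∑ x ∈ pairs N L, cM k x.2 x.1 * cM l x.2 x.1 := by
  rw [pairs, Finset.sum_product]; rfl

theorem sum_cG_diag_eq_zero {L k l : ℕ} (hkl : k < l) (h : k + l < 2 * N) :
    ∑ a ∈ Finset.range N, cG N L k l a a = 0 := by
  rw [sum_cG_diag]
  refine Finset.sum_eq_zero fun x hx => ?_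
  by_contra hne
  have h1 := cM_support (left_ne_zero_of_mul hne)
  have h2 := cM_support (right_ne_zero_of_mul hne)
  have := mem_pairs.1 hx
  omega

theorem abs_cM_mul_cM_le (k l p a q b : ℕ) : |cM k p a * cM l q b| ≤ 9 := by
  have h1 := cM_nonneg k p a
  have h2 := cM_nonneg l q b
  have h3 := cM_le_three k p a
  have h4 := cM_le_three l q b
  rw [abs_of_nonneg (mul_nonneg h1 h2)]
  nlinarith

theorem abs_sum_cG_diag_le {L k l : ℕ} (hkl : k < l) :
    |∑ a ∈ Finset.range N, cG N L k l a a| ≤ 9 := by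
  rw [sum_cG_diag]
  refine (abs_sum_le_card (C := 9) (by norm_num) (fun x _ => abs_cM_mul_cM_le _ _ _ _ _ _)
    (t := (pairs N L).filter fun x => x.2 = x.1 + k ∧ x.2 + x.1 = l) fun x hx hne => ?_).trans ?_
  · have h1 := cM_support (left_ne_zero_of_mul hne)
    have h2 := cM_support (right_ne_zero_of_mul hne)
    have := mem_pairs.1 hx
    simp only [Finset.mem_filter, hx, true_and]
    omega
  · have : (((pairs N L).filter fun x => x.2 = x.1 + k ∧ x.2 + x.1 = l).card : ℝ) ≤ 1 := by
      exact_mod_cast card_both_le L k l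
    linarith

theorem sum_cM_pairs_le (L k : ℕ) : ∑ x ∈ pairs N L, cM k x.2 x.1 ≤ 6 * N := by
  refine (le_abs_self _).trans ((abs_sum_le_card (C := 3) (by norm_num)
    (fun x _ => by rw [abs_of_nonneg (cM_nonneg _ _ _)]; exact cM_le_three _ _ _)
    (t := ((pairs N L).filter fun x => x.2 = x.1 + k) ∪
      ((pairs N L).filter fun x => x.2 + x.1 = k)) fun x hx hne => ?_).trans ?_)
  · have h1 := cM_support hne
    have := mem_pairs.1 hx
    simp only [Finset.mem_union, Finset.mem_filter, hx, true_and]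
    omega
  · have h := Finset.card_union_le ((pairs N L).filter fun x => x.2 = x.1 + k)
      ((pairs N L).filter fun x => x.2 + x.1 = k)
    have h1 := card_shift_le' (N := N) L k
    have h2 := card_refl_le (N := N) L k
    have : ((((pairs N L).filter fun x => x.2 = x.1 + k) ∪
      ((pairs N L).filter fun x => x.2 + x.1 = k)).card : ℝ) ≤ 2 * N := by
      exact_mod_cast (by omega)
    linarith

theorem sum_cM_pairs_le' (L : ℕ) {k : ℕ} (hk : k < N) :
    ∑ x ∈ pairs N L, cM k x.2 x.1 ≤ 3 * k := by
  refine (le_abs_self _).trans ((abs_sum_le_card (C := 3) (by norm_num)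
    (fun x _ => by rw [abs_of_nonneg (cM_nonneg _ _ _)]; exact cM_le_three _ _ _)
    (t := (pairs N L).filter fun x => x.2 = x.1 + k) fun x hx hne => ?_).trans ?_)
  · have h1 := cM_support hne
    have := mem_pairs.1 hx
    simp only [Finset.mem_filter, hx, true_and]
    omega
  · have : (((pairs N L).filter fun x => x.2 = x.1 + k).card : ℝ) ≤ k := by
      exact_mod_cast card_shift_le (N := N) L k
    linarith

theorem cG_nonneg (L k l a b : ℕ) : 0 ≤ cG N L k l a b :=
  Finset.sum_nonneg fun _ _ => mul_nonneg (cM_nonneg _ _ _) (cM_nonneg _ _ _)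

theorem cG_le (L k l a b : ℕ) : cG N L k l a b ≤ 9 := by
  have : ∀ p ∈ Finset.Ico N L, cM k p a * cM l p b ≤ cM k a p * 3 := fun p _ => by
    rw [cM_symm k p]
    exact mul_le_mul_of_nonneg_left (cM_le_three _ _ _) (cM_nonneg _ _ _)
  refine (Finset.sum_le_sum this).trans ?_
  rw [← Finset.sum_mul]
  linarith [sum_cM_le k a (Finset.Ico N L)]

theorem exchange_le (L k l : ℕ) :
    ∑ a ∈ Finset.range N, ∑ b ∈ Finset.range N, cG N L k l a b * cG N L k l b a
      ≤ 27 * ∑ x ∈ pairs N L, cM k x.2 x.1 := by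
  have h1 : ∀ a b, cG N L k l a b * cG N L k l b a ≤ 9 * cG N L k l a b := fun a b => by
    nlinarith [cG_nonneg (N := N) L k l a b, cG_le (N := N) L k l b a]
  refine (Finset.sum_le_sum fun a _ => Finset.sum_le_sum fun b _ => h1 a b).trans ?_
  rw [pairs, Finset.sum_product, Finset.mul_sum]
  refine Finset.sum_le_sum fun a _ => ?_
  simp only [cG, ← Finset.mul_sum]
  rw [Finset.sum_comm]
  simp only [← Finset.mul_sum]
  have : ∑ p ∈ Finset.Ico N L, cM k p a * ∑ b ∈ Finset.range N, cM l p b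
      ≤ ∑ p ∈ Finset.Ico N L, cM k p a * 3 :=
    Finset.sum_le_sum fun p _ => mul_le_mul_of_nonneg_left (sum_cM_le _ _ _) (cM_nonneg _ _ _)
  rw [← Finset.sum_mul] at this
  linarith

theorem exchange_nonneg (L k l : ℕ) :
    0 ≤ ∑ a ∈ Finset.range N, ∑ b ∈ Finset.range N, cG N L k l a b * cG N L k l b a :=
  Finset.sum_nonneg fun _ _ => Finset.sum_nonneg fun _ _ => mul_nonneg (cG_nonneg _ _ _ _ _)
    (cG_nonneg _ _ _ _ _)

theorem exchange_eq_zero {L k l : ℕ} (hkl : k < l) (hk : k < N)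
    (h : ¬ (2 * N ≤ k + l ∧ l < 2 * N + k)) :
    ∑ a ∈ Finset.range N, ∑ b ∈ Finset.range N, cG N L k l a b * cG N L k l b a = 0 := by
  refine Finset.sum_eq_zero fun a ha => Finset.sum_eq_zero fun b hb => ?_
  by_contra hne
  obtain ⟨p, hp, h1⟩ := Finset.exists_ne_zero_of_sum_ne_zero (left_ne_zero_of_mul hne)
  obtain ⟨q, hq, h2⟩ := Finset.exists_ne_zero_of_sum_ne_zero (right_ne_zero_of_mul hne)
  have e1 := cM_support (left_ne_zero_of_mul h1)
  have e2 := cM_support (right_ne_zero_of_mul h1)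
  have e3 := cM_support (left_ne_zero_of_mul h2)
  have e4 := cM_support (right_ne_zero_of_mul h2)
  simp only [Finset.mem_range, Finset.mem_Ico] at ha hb hp hq
  omega

theorem sum_cA (L k l : ℕ) : ∑ a ∈ Finset.range N, ∑ p ∈ Finset.Ico N L, cA N k p a * cA N l p a
    = ∑ x ∈ pairs N L, cA N k x.2 x.1 * cA N l x.2 x.1 := by
  rw [pairs, Finset.sum_product]

theorem abs_cA_mul_cA_le {k l : ℕ} (hk : k ≠ 0) (hl : l ≠ 0) (p a : ℕ) :
    |cA N k p a * cA N l p a| ≤ 225 := by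
  have h1 := cA_abs_le (N := N) hk p a
  have h2 := cA_abs_le (N := N) hl p a
  rw [abs_mul]
  nlinarith [abs_nonneg (cA N k p a), abs_nonneg (cA N l p a)]

theorem abs_sum_cA_le {k l : ℕ} (hk : k ≠ 0) (hl : l ≠ 0) (L : ℕ) :
    |∑ a ∈ Finset.range N, ∑ p ∈ Finset.Ico N L, cA N k p a * cA N l p a| ≤ 900 * N := by
  rw [sum_cA]
  refine (abs_sum_le_card (C := 225) (by norm_num) (fun x _ => abs_cA_mul_cA_le hk hl _ _)
    (t := (((pairs N L).filter fun x => x.2 = x.1 + k) ∪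
      ((pairs N L).filter fun x => x.2 + x.1 = k)) ∪
      (((pairs N L).filter fun x => x.2 = x.1 + 2 * k) ∪
      ((pairs N L).filter fun x => x.2 + x.1 = 2 * k))) fun x hx hne => ?_).trans ?_
  · have := mem_pairs.1 hx
    have h1 := cA_support this.1 this.2.1 (left_ne_zero_of_mul hne)
    simp only [Finset.mem_union, Finset.mem_filter, hx, true_and]
    omega
  · have h1 := card_shift_le' (N := N) L k
    have h2 := card_refl_le (N := N) L k
    have h3 := card_shift_le' (N := N) L (2 * k)
    have h4 := card_refl_le (N := N) L (2 * k)
    have : (((((pairs N L).filter fun x => x.2 = x.1 + k) ∪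
      ((pairs N L).filter fun x => x.2 + x.1 = k)) ∪
      (((pairs N L).filter fun x => x.2 = x.1 + 2 * k) ∪
      ((pairs N L).filter fun x => x.2 + x.1 = 2 * k))).card : ℝ) ≤ 4 * N := by
      have u1 := Finset.card_union_le (((pairs N L).filter fun x => x.2 = x.1 + k) ∪
        ((pairs N L).filter fun x => x.2 + x.1 = k))
        (((pairs N L).filter fun x => x.2 = x.1 + 2 * k) ∪
        ((pairs N L).filter fun x => x.2 + x.1 = 2 * k))
      have u2 := Finset.card_union_le ((pairs N L).filter fun x => x.2 = x.1 + k)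
        ((pairs N L).filter fun x => x.2 + x.1 = k)
      have u3 := Finset.card_union_le ((pairs N L).filter fun x => x.2 = x.1 + 2 * k)
        ((pairs N L).filter fun x => x.2 + x.1 = 2 * k)
      exact_mod_cast (by omega)
    linarith

theorem abs_sum_cA_le_of_ne {k l : ℕ} (hk : k ≠ 0) (hkl : k < l) (hl : l ≠ 2 * k)
    (L : ℕ) :
    |∑ a ∈ Finset.range N, ∑ p ∈ Finset.Ico N L, cA N k p a * cA N l p a| ≤ 3600 := by
  rw [sum_cA]
  let U : Finset ℕ := {k, 2 * k, l, 2 * l}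
  refine (abs_sum_le_card (C := 225) (by norm_num)
    (fun x _ => abs_cA_mul_cA_le hk (by omega) _ _)
    (t := (pairs N L).filter fun x => x.2 - x.1 ∈ U ∧ x.2 + x.1 ∈ U) fun x hx hne => ?_).trans ?_
  · have := mem_pairs.1 hx
    have h1 := cA_support this.1 this.2.1 (left_ne_zero_of_mul hne)
    have h2 := cA_support this.1 this.2.1 (right_ne_zero_of_mul hne)
    rw [Finset.mem_filter]
    refine ⟨hx, ?_⟩
    simp only [U, Finset.mem_insert, Finset.mem_singleton]
    constructor <;> omega
  · have h1 : ((pairs N L).filter fun x => x.2 - x.1 ∈ U ∧ x.2 + x.1 ∈ U).card ≤ (U ×ˢ U).card := by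
      refine Finset.card_le_card_of_injOn (fun x => (x.2 - x.1, x.2 + x.1)) ?_ ?_
      · intro x hx
        have := Finset.mem_filter.1 hx
        exact Finset.mem_product.2 this.2
      · intro x hx y hy hxy
        have h1 := mem_pairs.1 (Finset.mem_filter.1 hx).1
        have h2 := mem_pairs.1 (Finset.mem_filter.1 hy).1
        simp only [Prod.mk.injEq] at hxy
        ext <;> omega
    have h2 : U.card ≤ 4 := Finset.card_le_four
    have h3 : (((pairs N L).filter fun x => x.2 - x.1 ∈ U ∧ x.2 + x.1 ∈ U).card : ℝ) ≤ 16 := by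
      rw [Finset.card_product] at h1
      exact_mod_cast h1.trans (Nat.mul_le_mul h2 h2)
    linarith

theorem sum_cA_eq_zero_of_ne {k l : ℕ} (hkl : k < l) (hl : l ≠ 2 * k)
    (h : k + l < N) (L : ℕ) :
    ∑ a ∈ Finset.range N, ∑ p ∈ Finset.Ico N L, cA N k p a * cA N l p a = 0 := by
  rw [sum_cA]
  refine Finset.sum_eq_zero fun x hx => ?_
  by_contra hne
  have := mem_pairs.1 hx
  have h1 := cA_support this.1 this.2.1 (left_ne_zero_of_mul hne)
  have h2 := cA_support this.1 this.2.1 (right_ne_zero_of_mul hne)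
  omega

/-- Evaluation of a sum over pairs at a fixed distance. -/
theorem sum_pairs_shift {L u : ℕ} (hL : N + u ≤ L) (f : ℕ → ℝ) :
    ∑ x ∈ pairs N L, (if x.2 = x.1 + u then f x.1 else 0) = ∑ a ∈ Finset.Ico (N - u) N, f a := by
  rw [pairs, Finset.sum_product]
  simp only [Finset.sum_ite_eq', Finset.mem_Ico]
  rw [← Finset.sum_filter]
  refine Finset.sum_congr ?_ fun _ _ => rfl
  ext a; simp; omega

theorem sum_cA_double {k L : ℕ} (hk : k ≠ 0) (h : 3 * k < N) (hL : N + 2 * k ≤ L) :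
    ∑ a ∈ Finset.range N, ∑ p ∈ Finset.Ico N L, cA N k p a * cA N (2 * k) p a = 0 := by
  have h1 : ∀ x ∈ pairs N L, cA N k x.2 x.1 * cA N (2 * k) x.2 x.1
      = if x.2 = x.1 + 2 * k then (if x.1 + k < N then -2 else 2) else 0 := by
    intro x hx
    have hx' := mem_pairs.1 hx
    split_ifs with h2 h3
    all_goals try
      have e1 : cT N (2 * k) x.2 x.1 = 0 := by
        by_contra hne
        have := cT_support hx'.1 hx'.2.1 hne
        omega
      have e2 : cM (2 * k) x.2 x.1 = 1 := by
        rw [cM_of_lt (by omega), cw_of_pos (by omega), if_pos h2, if_neg (by omega)]; norm_num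
      have e3 : cM k x.2 x.1 = 0 := by
        rw [cM_of_lt (by omega), if_neg (by omega), if_neg (by omega)]; norm_num
      have e4 : kap N (2 * k) = 1 := by
        rw [kap_eq (by omega), if_pos ⟨even_two_mul k, by omega⟩]
      have e5 := cT_shift (N := N) hk (by omega : x.1 ≠ 0) hx'.1
      rw [← h2] at e5
      simp only [cA, e1, e2, e3, e4, e5, h3]
      norm_num
    by_contra hne
    have h1 := cA_support hx'.1 hx'.2.1 (left_ne_zero_of_mul hne)
    have h2 := cA_support hx'.1 hx'.2.1 (right_ne_zero_of_mul hne)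
    omega
  rw [sum_cA, Finset.sum_congr rfl h1, sum_pairs_shift (u := 2 * k) hL
    (fun a => if a + k < N then (-2 : ℝ) else 2),
    ← Finset.sum_Ico_consecutive _ (by omega : N - 2 * k ≤ N - k) (by omega : N - k ≤ N),
    Finset.sum_congr (rfl : Finset.Ico (N - 2 * k) (N - k) = _) (g := fun _ => (-2 : ℝ)),
    Finset.sum_congr (rfl : Finset.Ico (N - k) N = _) (g := fun _ => (2 : ℝ))]
  · simp only [Finset.sum_const, Nat.card_Ico, nsmul_eq_mul]
    rw [show N - k - (N - 2 * k) = k by omega, show N - (N - k) = k by omega]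
    ring
  · intro a ha
    rw [if_neg (by simp at ha; omega)]
  · intro a ha
    rw [if_pos (by simp at ha; omega)]

end CoefficientBounds

section CovarianceBounds

variable {N : ℕ}

theorem sum_cM_sq {L k : ℕ} (hL : N + k ≤ L) :
    ∑ a ∈ Finset.range N, cG N L k k a a
      = (min k N : ℕ) + (min N (k + 1 - N) : ℕ) := by
  have h1 : ∀ a ∈ Finset.range N, cG N L k k a a
      = (if N ≤ a + k then 1 else 0) + (if a + N ≤ k then 1 else 0) := by
    intro a ha
    have ha' := Finset.mem_range.1 ha
    have h2 : ∀ p ∈ Finset.Ico N L, cM k p a * cM k p a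
        = (if p = a + k then 1 else 0) + (if p = k - a then (if a + N ≤ k then 1 else 0) else 0) := by
      intro p hp
      have hp' := Finset.mem_Ico.1 hp
      rw [← sq, cM_sq_of_lt (by omega)]
      congr 1
      split_ifs <;> first | rfl | omega
    rw [cG, Finset.sum_congr rfl h2, Finset.sum_add_distrib, Finset.sum_ite_eq',
      Finset.sum_ite_eq']
    simp only [Finset.mem_Ico]
    congr 1 <;> split_ifs <;> first | rfl | omega
  rw [Finset.sum_congr rfl h1, Finset.sum_add_distrib, Finset.sum_boole, Finset.sum_boole]
  congr 2
  · have : (Finset.range N).filter (fun a => N ≤ a + k) = Finset.Ico (N - k) N := by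
      ext a; simp; omega
    rw [this, Nat.card_Ico]; omega
  · have : (Finset.range N).filter (fun a => a + N ≤ k) = Finset.range (min N (k + 1 - N)) := by
      ext a; simp; omega
    rw [this, Finset.card_range]

theorem trSq_of_lt {k : ℕ} (hk : k ≠ 0) (hkN : k < N) :
    trSq N k = k + if Even k then 1 else 0 := by
  rw [trSq_eq N hk le_rfl, sum_cM_sq le_rfl, kap_eq hk,
    show min k N = k by omega, show min N (k + 1 - N) = 0 by omega]
  have : (Even k ∧ k < 2 * N) ↔ Even k := and_iff_left (by omega)
  simp only [this]
  split_ifs <;> push_cast <;> ring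

theorem abs_trSq_sub_le (hN : 1 ≤ N) {k : ℕ} (hk : k ≠ 0) (hkN : N ≤ k) :
    |trSq N k - (min k (2 * N) : ℕ)| ≤ 2 := by
  rw [trSq_eq N hk le_rfl, sum_cM_sq le_rfl, kap_eq hk]
  have h1 : (min k N + min N (k + 1 - N) : ℕ) ≤ min k (2 * N) + 1 := by omega
  have h2 : min k (2 * N) ≤ (min k N + min N (k + 1 - N) : ℕ) := by omega
  have h1' : (((min k N : ℕ) + (min N (k + 1 - N) : ℕ) : ℕ) : ℝ) ≤ ((min k (2 * N) + 1 : ℕ) : ℝ) :=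
    Nat.cast_le.2 h1
  have h2' : ((min k (2 * N) : ℕ) : ℝ) ≤ (((min k N : ℕ) + (min N (k + 1 - N) : ℕ) : ℕ) : ℝ) :=
    Nat.cast_le.2 h2
  push_cast at h1' h2' ⊢
  rw [abs_le]
  split_ifs <;> constructor <;> linarith

theorem trCov_symm (k l : ℕ) : trCov N k l = trCov N l k := by
  simp only [trCov, slaterCov]
  congr 1
  · exact Finset.sum_congr rfl fun i _ => ip_comm _ _ _
  · congr 1
    · congr 2
      exact Finset.sum_congr rfl fun i _ => ip_comm _ _ _
    · congr 1
      refine Finset.sum_congr rfl fun i _ => Finset.sum_congr rfl fun j _ => ?_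
      rw [mul_comm, ip_comm, ip_comm _ (slaterB angM (modes N) (fC k) i)]

theorem trCov_self {k : ℕ} (hk : k ≠ 0) (h : 4 * k < N) :
    trCov N k k = 2 * k ^ 2 + 4 * k * if Even k then 1 else 0 := by
  have hL : N + 2 * k ≤ N + 2 * k := le_rfl
  rw [trCov_eq N hk hk hL hL, sum_cM_sq (by omega), show min k N = k by omega,
    show min N (k + 1 - N) = 0 by omega]
  have hG : ∀ a ∈ Finset.range N, ∀ b ∈ Finset.range N, cG N (N + 2 * k) k k a b
      * cG N (N + 2 * k) k k b a = if b = a then (if N ≤ a + k then 1 else 0) else 0 := by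
    intro a ha b hb
    have ha' := Finset.mem_range.1 ha
    have hb' := Finset.mem_range.1 hb
    by_cases hab : b = a
    · subst hab
      rw [if_pos rfl]
      have h2 : ∀ p ∈ Finset.Ico N (N + 2 * k), cM k p b * cM k p b
          = (if p = b + k then 1 else 0) := by
        intro p hp
        have hp' := Finset.mem_Ico.1 hp
        rw [← sq, cM_sq_of_lt (by omega), if_neg (by omega : ¬ p + b = k), add_zero]
      rw [cG, Finset.sum_congr rfl h2, Finset.sum_ite_eq']
      simp only [Finset.mem_Ico]
      split_ifs <;> first | omega | norm_num
    · rw [if_neg hab]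
      by_contra hne
      obtain ⟨p, hp, h1⟩ := Finset.exists_ne_zero_of_sum_ne_zero (left_ne_zero_of_mul hne)
      have e1 := cM_support (left_ne_zero_of_mul h1)
      have e2 := cM_support (right_ne_zero_of_mul h1)
      have := Finset.mem_Ico.1 hp
      omega
  have hA : ∀ x ∈ pairs N (N + 2 * k), cA N k x.2 x.1 * cA N k x.2 x.1
      = (if x.2 = x.1 + k then 4 * (if Even k then 1 else 0) else 0)
        + (if x.2 = x.1 + 2 * k then 1 else 0) := by
    intro x hx
    have hx' := mem_pairs.1 hx
    have e4 : kap N k = if Even k then 1 else 0 := by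
      rw [kap_eq hk]
      simp only [show (Even k ∧ k < 2 * N) ↔ Even k from and_iff_left (by omega)]
    have e1 : x.2 ≠ x.1 + 2 * k → cT N k x.2 x.1 = 0 := by
      intro h2
      by_contra hne
      have := cT_support hx'.1 hx'.2.1 hne
      omega
    by_cases h2 : x.2 = x.1 + k
    · have e3 : cM k x.2 x.1 = 1 := by
        rw [cM_of_lt (by omega), cw_of_pos (by omega), if_pos h2, if_neg (by omega)]; norm_num
      rw [if_pos h2, if_neg (by omega : ¬ x.2 = x.1 + 2 * k), cA, e3, e1 (by omega), e4]
      split_ifs <;> norm_num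
    · have e3 : cM k x.2 x.1 = 0 := by
        rw [cM_of_lt (by omega), if_neg h2, if_neg (by omega)]; norm_num
      rw [if_neg h2, cA, e3]
      by_cases h3 : x.2 = x.1 + 2 * k
      · have e5 := cT_shift (N := N) hk (by omega : x.1 ≠ 0) hx'.1
        rw [← h3] at e5
        rw [e5, if_pos h3]
        split_ifs <;> norm_num
      · rw [e1 h3, if_neg h3]; norm_num
  rw [sum_cA, Finset.sum_congr rfl hA, Finset.sum_add_distrib,
    sum_pairs_shift (by omega) (fun _ => (4 * if Even k then 1 else 0 : ℝ)),
    sum_pairs_shift (by omega) (fun _ => (1 : ℝ)),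
    Finset.sum_congr rfl fun a ha => Finset.sum_congr rfl fun b hb => hG a ha b hb]
  simp only [Finset.sum_ite_eq', Finset.sum_const, Nat.card_Ico, nsmul_eq_mul]
  rw [show N - (N - k) = k by omega, show N - (N - 2 * k) = 2 * k by omega]
  have : ∑ a ∈ Finset.range N, (if a ∈ Finset.range N then (if N ≤ a + k then 1 else 0) else 0 : ℝ)
      = k := by
    rw [Finset.sum_congr rfl fun a ha => if_pos ha, Finset.sum_boole]
    have : (Finset.range N).filter (fun a => N ≤ a + k) = Finset.Ico (N - k) N := by
      ext a; simp; omega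
    rw [this, Nat.card_Ico, show N - (N - k) = k by omega]
  rw [this]
  push_cast
  ring

theorem abs_trCov_self_le (hN : 1 ≤ N) {k : ℕ} (hk : k ≠ 0) :
    |trCov N k k| ≤ 1300 * (N : ℝ) ^ 2 := by
  have hN' : (1 : ℝ) ≤ N := by exact_mod_cast hN
  have hL : N + 2 * k ≤ N + 2 * k := le_rfl
  rw [trCov_eq N hk hk hL hL, sum_cM_sq (by omega)]
  have h1 := abs_sum_cA_le (N := N) hk hk (N + 2 * k)
  have h2 := exchange_le (N := N) (N + 2 * k) k k
  have h3 := exchange_nonneg (N := N) (N + 2 * k) k k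
  have h4 := sum_cM_pairs_le (N := N) (N + 2 * k) k
  have h5 : (((min k N : ℕ) + (min N (k + 1 - N) : ℕ) : ℕ) : ℝ) ≤ ((2 * N : ℕ) : ℝ) :=
    Nat.cast_le.2 (by omega)
  push_cast at h5 ⊢
  have h6 : (0 : ℝ) ≤ (min (k : ℝ) N) + (min (N : ℝ) ((k + 1 - N : ℕ) : ℝ)) := by positivity
  set u := (min (k : ℝ) N) + (min (N : ℝ) ((k + 1 - N : ℕ) : ℝ))
  have h7 : u ^ 2 ≤ (2 * N) ^ 2 := pow_le_pow_left₀ h6 h5 2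
  rw [abs_le] at h1 ⊢
  constructor <;> nlinarith

theorem trCov_eq_zero {k l : ℕ} (hk : k ≠ 0) (hkl : k < l) (h : k + l < N) :
    trCov N k l = 0 := by
  rw [trCov_eq N hk (by omega) (L := N + 2 * l) (by omega) (by omega),
    sum_cG_diag_eq_zero hkl (by omega), exchange_eq_zero hkl (by omega) (by omega)]
  by_cases hl : l = 2 * k
  · subst hl
    rw [sum_cA_double hk (by omega) (by omega)]; norm_num
  · rw [sum_cA_eq_zero_of_ne hkl hl h]; norm_num

theorem abs_trCov_le (hN : 1 ≤ N) {k l : ℕ} (hk : k ≠ 0) (hkl : k < l) :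
    |trCov N k l| ≤ 1400 * N := by
  have hN' : (1 : ℝ) ≤ N := by exact_mod_cast hN
  rw [trCov_eq N hk (by omega) (L := N + 2 * l) (by omega) (by omega)]
  have h1 := abs_sum_cA_le (N := N) hk (by omega : l ≠ 0) (N + 2 * l)
  have h2 := exchange_le (N := N) (N + 2 * l) k l
  have h3 := exchange_nonneg (N := N) (N + 2 * l) k l
  have h4 := sum_cM_pairs_le (N := N) (N + 2 * l) k
  have h5 := abs_sum_cG_diag_le (N := N) (L := N + 2 * l) hkl
  have h6 := sq_le_sq' (abs_le.1 h5).1 (abs_le.1 h5).2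
  have h7 := sq_nonneg (∑ a ∈ Finset.range N, cG N (N + 2 * l) k l a a)
  rw [abs_le] at h1 ⊢
  constructor <;> linarith

theorem abs_trCov_le' {k l : ℕ} (hk : k ≠ 0) (hkl : k < l) (hkN : k < N) :
    |trCov N k l| ≤ 4000 + (if 2 * N ≤ k + l ∧ l < 2 * N + k then 162 * (k : ℝ) else 0)
      + (if l = 2 * k then 900 * (N : ℝ) else 0) := by
  rw [trCov_eq N hk (by omega) (L := N + 2 * l) (by omega) (by omega)]
  have h1 : |∑ a ∈ Finset.range N, ∑ p ∈ Finset.Ico N (N + 2 * l), cA N k p a * cA N l p a|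
      ≤ 3600 + if l = 2 * k then 900 * (N : ℝ) else 0 := by
    split_ifs with h
    · linarith [abs_sum_cA_le (N := N) hk (by omega : l ≠ 0) (N + 2 * l)]
    · linarith [abs_sum_cA_le_of_ne (N := N) hk hkl h (N + 2 * l)]
  have h2 : ∑ a ∈ Finset.range N, ∑ b ∈ Finset.range N, cG N (N + 2 * l) k l a b
      * cG N (N + 2 * l) k l b a
      ≤ if 2 * N ≤ k + l ∧ l < 2 * N + k then 81 * (k : ℝ) else 0 := by
    split_ifs with h
    · linarith [exchange_le (N := N) (N + 2 * l) k l, sum_cM_pairs_le' (N + 2 * l) hkN]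
    · rw [exchange_eq_zero hkl hkN h]
  have h2' : (if 2 * N ≤ k + l ∧ l < 2 * N + k then 162 * (k : ℝ) else 0)
      = 2 * if 2 * N ≤ k + l ∧ l < 2 * N + k then 81 * (k : ℝ) else 0 := by
    split_ifs <;> ring
  have h3 := exchange_nonneg (N := N) (N + 2 * l) k l
  have h5 := abs_sum_cG_diag_le (N := N) (L := N + 2 * l) hkl
  have h6 := sq_le_sq' (abs_le.1 h5).1 (abs_le.1 h5).2
  have h7 := sq_nonneg (∑ a ∈ Finset.range N, cG N (N + 2 * l) k l a a)
  rw [abs_le] at h1 ⊢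
  rw [h2']
  constructor <;> linarith

end CovarianceBounds

section Flow

/-- The derivative of a bounded function along a measure-preserving flow has mean zero. -/
theorem integral_eq_zero_of_flow {X : Type*} [MeasurableSpace X] {μ : Measure X}
    [IsProbabilityMeasure μ] {R : ℝ → X → X} (hR : ∀ t, MeasurePreserving (R t) μ μ)
    (hadd : ∀ s t x, R (s + t) x = R s (R t x)) {G G' : X → ℝ} (hG : Measurable G)
    (hG' : Measurable G') (hGi : Integrable G μ)
    (hd : ∀ x, HasDerivAt (fun t => G (R t x)) (G' x) 0) {S : Set X} (hS : ∀ᵐ x ∂μ, x ∈ S)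
    (hRS : ∀ t, ∀ x ∈ S, R t x ∈ S) {C : ℝ} (hC : ∀ x ∈ S, |G' x| ≤ C) :
    ∫ x, G' x ∂μ = 0 := by
  have hd' : ∀ x t, HasDerivAt (fun t => G (R t x)) (G' (R t x)) t := by
    intro x t
    have h := hd (R t x)
    rw [← sub_self t] at h
    have := HasDerivAt.comp_sub_const t t h
    have e : (fun s => G (R (s - t) (R t x))) = fun s => G (R s x) := by
      ext s
      rw [← hadd, sub_add_cancel]
    rwa [e] at this
  have hconst : ∀ t, ∫ x, G (R t x) ∂μ = ∫ x, G x ∂μ := by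
    intro t
    have hm := (hR t).map_eq
    conv_rhs => rw [← hm]
    rw [integral_map (hR t).measurable.aemeasurable hG.aestronglyMeasurable]
  have h0 : ∫ x, G' (R 0 x) ∂μ = ∫ x, G' x ∂μ := by
    have hm := (hR 0).map_eq
    conv_rhs => rw [← hm]
    rw [integral_map (hR 0).measurable.aemeasurable hG'.aestronglyMeasurable]
  have key := hasDerivAt_integral_of_dominated_loc_of_deriv_le (μ := μ) (x₀ := (0 : ℝ))
    (s := Set.univ) (F := fun t x => G (R t x)) (F' := fun t x => G' (R t x)) (bound := fun _ => C)
    Filter.univ_mem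
    (Filter.Eventually.of_forall fun t => (hG.comp (hR t).measurable).aestronglyMeasurable)
    ((hR 0).integrable_comp_of_integrable hGi)
    (hG'.comp (hR 0).measurable).aestronglyMeasurable
    (hS.mono fun x hx t _ => hC _ (hRS t x hx)) (integrable_const C)
    (Filter.Eventually.of_forall fun x t _ => hd' x t)
  have h1 := key.2
  simp only [hconst, h0] at h1
  exact h1.unique (hasDerivAt_const _ _)

end Flow

section Torus

variable {N : ℕ}

/-- The torus of eigenangles. -/
abbrev Tor (N : ℕ) : Type := Fin N → Ang

/-- The normalized measure on the torus. -/
abbrev torM (N : ℕ) : Measure (Tor N) := Measure.pi fun _ => angM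

/-- `g` is the partial derivative of `f` in the `i`-th angle. -/
def HasPartial (i : Fin N) (f g : C(Tor N, ℝ)) : Prop :=
  ∀ θ : Tor N, HasDerivAt (fun t : ℝ => f (θ + Pi.single i (t : Ang))) (g θ) 0

theorem HasPartial.const_one (i : Fin N) : HasPartial i 1 0 := fun _ => hasDerivAt_const _ _

theorem HasPartial.add {i : Fin N} {f g f' g' : C(Tor N, ℝ)} (hf : HasPartial i f f')
    (hg : HasPartial i g g') : HasPartial i (f + g) (f' + g') := fun θ => (hf θ).add (hg θ)

theorem HasPartial.sub {i : Fin N} {f g f' g' : C(Tor N, ℝ)} (hf : HasPartial i f f')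
    (hg : HasPartial i g g') : HasPartial i (f - g) (f' - g') := fun θ => (hf θ).sub (hg θ)

theorem HasPartial.smul {i : Fin N} {f f' : C(Tor N, ℝ)} (c : ℝ) (hf : HasPartial i f f') :
    HasPartial i (c • f) (c • f') := fun θ => (hf θ).const_mul c

theorem HasPartial.mul {i : Fin N} {f g f' g' : C(Tor N, ℝ)} (hf : HasPartial i f f')
    (hg : HasPartial i g g') : HasPartial i (f * g) (f' * g + f * g') := fun θ => by
  simpa using (hf θ).fun_mul (hg θ)

theorem HasPartial.zero (i : Fin N) : HasPartial i 0 0 := fun _ => hasDerivAt_const _ _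

theorem HasPartial.sum {ι : Type*} {i : Fin N} {f f' : ι → C(Tor N, ℝ)} (S : Finset ι)
    (hf : ∀ p ∈ S, HasPartial i (f p) (f' p)) :
    HasPartial i (∑ p ∈ S, f p) (∑ p ∈ S, f' p) := by
  classical
  induction S using Finset.induction_on with
  | empty => simpa using HasPartial.zero i
  | insert a S ha ih =>
    rw [Finset.sum_insert ha, Finset.sum_insert ha]
    exact (hf a (by simp)).add (ih fun p hp => hf p (by simp [hp]))

theorem HasPartial.prod {ι : Type*} [DecidableEq ι] {i : Fin N} {f f' : ι → C(Tor N, ℝ)}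
    (S : Finset ι) (hf : ∀ p ∈ S, HasPartial i (f p) (f' p)) :
    HasPartial i (∏ p ∈ S, f p) (∑ p ∈ S, (∏ q ∈ S.erase p, f q) * f' p) := by
  intro θ
  have := HasDerivAt.fun_finsetProd (u := S) (x := (0 : ℝ))
    (f := fun p t => f p (θ + Pi.single i (t : Ang))) (f' := fun p => f' p θ)
    (fun p hp => hf p hp θ)
  simpa [ContinuousMap.prod_apply, ContinuousMap.sum_apply, smul_eq_mul] using this

theorem measurePreserving_translate (i : Fin N) (t : ℝ) :
    MeasurePreserving (fun θ : Tor N => θ + Pi.single i (t : Ang)) (torM N) (torM N) :=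
  measurePreserving_add_right _ _

theorem integral_partial {i : Fin N} {f g : C(Tor N, ℝ)} (h : HasPartial i f g) :
    ∫ θ, g θ ∂torM N = 0 := by
  refine integral_eq_zero_of_flow
    (R := fun (t : ℝ) (θ : Tor N) => θ + (Pi.single i (t : Ang) : Tor N)) (S := Set.univ)
    (fun t => measurePreserving_translate i t) ?_ f.continuous.measurable g.continuous.measurable
    (integrable_continuousMap _ f) (fun θ => h θ) (by simp) (by simp) (C := ‖g‖)
    (fun θ _ => g.norm_coe_le_norm θ)
  intro s t θ
  rw [add_assoc, ← Pi.single_add, ← QuotientAddGroup.mk_add, add_comm s t]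

theorem HasPartial.hasDerivAt {i : Fin N} {f g : C(Tor N, ℝ)} (h : HasPartial i f g) (θ : Tor N)
    (t : ℝ) : HasDerivAt (fun t : ℝ => f (θ + Pi.single i (t : Ang)))
      (g (θ + Pi.single i (t : Ang))) t := by
  have h := h (θ + Pi.single i (t : Ang))
  rw [← sub_self t] at h
  have := HasDerivAt.comp_sub_const t t h
  have e : (fun s : ℝ => f (θ + Pi.single i (t : Ang) + Pi.single i ((s - t : ℝ) : Ang)))
      = fun s : ℝ => f (θ + Pi.single i (s : Ang)) := by
    ext s
    rw [add_assoc, ← Pi.single_add, ← QuotientAddGroup.mk_add, add_sub_cancel]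
  rwa [e] at this

/-- Evaluation of a function of one angle at the `j`-th angle. -/
def atC (j : Fin N) (f : C(Ang, ℝ)) : C(Tor N, ℝ) := f.comp ⟨fun θ => θ j, continuous_apply j⟩

theorem hasPartial_cosC (i j : Fin N) (k : ℤ) :
    HasPartial i (atC j (cosC k)) (if i = j then (-k : ℝ) • atC j (sinC k) else 0) := by
  intro θ
  split_ifs with h
  · subst h
    simpa [atC] using hasDerivAt_cosC k (θ i) 1 0
  · simpa [atC, Pi.single_eq_of_ne (Ne.symm h)] using hasDerivAt_const (0 : ℝ) (cosC k (θ j))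

theorem hasPartial_sinC (i j : Fin N) (k : ℤ) :
    HasPartial i (atC j (sinC k)) (if i = j then (k : ℝ) • atC j (cosC k) else 0) := by
  intro θ
  split_ifs with h
  · subst h
    simpa [atC] using hasDerivAt_sinC k (θ i) 1 0
  · simpa [atC, Pi.single_eq_of_ne (Ne.symm h)] using hasDerivAt_const (0 : ℝ) (sinC k (θ j))

/-- The sum of `2 cos (k θ_j)`: the trace of the `k`-th power in terms of the eigenangles. -/
def TT (N k : ℕ) : C(Tor N, ℝ) := ∑ j, atC j (fC k)

theorem TT_apply (k : ℕ) (θ : Tor N) : TT N k θ = ∑ j, fC k (θ j) := by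
  simp [TT, atC]

/-- The gradient of `TT N k`. -/
def TT' (N k : ℕ) (i : Fin N) : C(Tor N, ℝ) := (-2 * k : ℝ) • atC i (sinC k)

theorem hasPartial_fC (i j : Fin N) (k : ℕ) :
    HasPartial i (atC j (fC k)) (if i = j then TT' N k i else 0) := by
  have h := (hasPartial_cosC i j k).smul 2
  have e : (if i = j then TT' N k i else 0)
      = (2 : ℝ) • if i = j then (-k : ℝ) • atC j (sinC k) else 0 := by
    split_ifs with h
    · subst h; ext θ; simp [TT']; ring
    · simp
  rw [e, show atC j (fC k) = (2 : ℝ) • atC j (cosC k) from rfl]; exact_mod_cast h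

theorem hasPartial_TT (i : Fin N) (k : ℕ) : HasPartial i (TT N k) (TT' N k i) := by
  have := HasPartial.sum (i := i) Finset.univ fun j _ => hasPartial_fC i j k
  simpa [TT] using this

theorem hasPartial_TT' (i : Fin N) (k : ℕ) :
    HasPartial i (TT' N k i) ((-k ^ 2 : ℝ) • atC i (fC k)) := by
  have h := (hasPartial_sinC i i k).smul (-2 * k : ℝ)
  have e : (-k ^ 2 : ℝ) • atC i (fC k) = (-2 * k : ℝ) • ((k : ℝ) • atC i (cosC k)) := by
    ext θ; simp [atC, fC]; ring
  rw [e, TT']; simpa using h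

/-- Pairs of distinct indices, in increasing order. -/
def incPairs (N : ℕ) : Finset (Σ _ : Fin N, Fin N) := Finset.univ.sigma fun i => Finset.Ioi i

/-- The Vandermonde determinant in the variables `2 cos θ_j`. -/
def vdm (N : ℕ) : C(Tor N, ℝ) := ∏ p ∈ incPairs N, (atC p.2 (fC 1) - atC p.1 (fC 1))

/-- The gradient of `vdm N`. -/
def vdm' (N : ℕ) (i : Fin N) : C(Tor N, ℝ) :=
  ∑ p ∈ incPairs N, (∏ q ∈ (incPairs N).erase p, (atC q.2 (fC 1) - atC q.1 (fC 1))) *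
    ((if i = p.2 then TT' N 1 i else 0) - (if i = p.1 then TT' N 1 i else 0))

theorem hasPartial_vdm (i : Fin N) : HasPartial i (vdm N) (vdm' N i) :=
  HasPartial.prod _ fun p _ => (hasPartial_fC i p.2 1).sub (hasPartial_fC i p.1 1)

end Torus

section Drift

theorem fC_apply (k : ℕ) (x : Ang) : fC k x = 2 * cosC k x := by simp [fC]

theorem cosC_natAbs (k : ℤ) : cosC (k.natAbs : ℤ) = cosC k := by
  rcases Int.natAbs_eq k with h | h
  · rw [← h]
  · conv_rhs => rw [h]
    rw [cosC_neg]

theorem telescope_cosC (k : ℤ) (x y : Ang) (n : ℕ) :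
    (2 * cosC 1 x - 2 * cosC 1 y) * ∑ m ∈ Finset.range n, (cosC m x * cosC (k - m) y)
      = cosC n x * cosC (k - n + 1) y - cosC (k + 1) y
        - cosC (n - 1) x * cosC (k - n) y + cosC 1 x * cosC k y := by
  induction n with
  | zero =>
    have : cosC (-1) = cosC 1 := cosC_neg 1
    simp [cosC_zero, this]
  | succ n ih =>
    rw [Finset.sum_range_succ, mul_add, ih]
    have h1 := cosC_mul_cosC n 1 x
    have h2 := cosC_mul_cosC (k - n) 1 y
    push_cast
    rw [show (n : ℤ) + 1 - 1 = n by ring, show k - (n + 1 : ℤ) + 1 = k - n by ring,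
      show k - (n + 1 : ℤ) = k - n - 1 by ring]
    linear_combination (cosC (k - n) y) * h1 - (cosC n x) * h2

theorem pair_identity (k : ℕ) (x y : Ang) :
    (fC 1 x - fC 1 y) * ∑ m ∈ Finset.range k, (fC m x * fC (k - m) y + fC m y * fC (k - m) x)
      = 4 * ((cosC (k + 1) x - cosC (k - 1) x) - (cosC (k + 1) y - cosC (k - 1) y)) := by
  have h1 := telescope_cosC k x y k
  have h2 := telescope_cosC k y x k
  have e : ∑ m ∈ Finset.range k, (fC m x * fC (k - m) y + fC m y * fC (k - m) x)
      = 4 * ∑ m ∈ Finset.range k, (cosC m x * cosC (k - m) y)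
        + 4 * ∑ m ∈ Finset.range k, (cosC m y * cosC (k - m) x) := by
    rw [Finset.mul_sum, Finset.mul_sum, ← Finset.sum_add_distrib]
    refine Finset.sum_congr rfl fun m hm => ?_
    rw [fC_apply, fC_apply, fC_apply, fC_apply, Nat.cast_sub (Finset.mem_range.mp hm).le]
    ring
  rw [e, fC_apply, fC_apply]
  have z : cosC 0 = 1 := cosC_zero
  simp only [sub_self, zero_add, z, ContinuousMap.one_apply] at h1 h2
  push_cast
  linear_combination 4 * h1 - 4 * h2

variable {N : ℕ}

/-- The zeroth-order term of the loop equation for the `k`-th trace. -/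
def bb (N k : ℕ) : C(Tor N, ℝ) :=
  (k : ℝ) • ∑ j ∈ Finset.range k, (TT N (k - 2 * j : ℤ).natAbs - TT N j * TT N (k - j))

/-- The inner product of the gradients of the `k`-th and `l`-th traces. -/
def gam (N k l : ℕ) : C(Tor N, ℝ) :=
  (k * l : ℝ) • (TT N (k - l : ℤ).natAbs - TT N (k + l))

theorem sum_TT'_mul_TT' (k l : ℕ) : ∑ i, TT' N k i * TT' N l i = gam N k l := by
  ext θ
  simp only [ContinuousMap.sum_apply, ContinuousMap.mul_apply, gam, ContinuousMap.smul_apply,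
    ContinuousMap.sub_apply, TT_apply, TT', fC_apply, atC, ContinuousMap.comp_apply,
    ContinuousMap.coe_mk, smul_eq_mul, cosC_natAbs]
  rw [← Finset.sum_sub_distrib, Finset.mul_sum]
  refine Finset.sum_congr rfl fun i _ => ?_
  have := sinC_mul_sinC k l (θ i)
  push_cast
  linear_combination (2 * k * l : ℝ) * this

theorem sum_incPairs_comm (f : Fin N → Fin N → ℝ) :
    ∑ p ∈ incPairs N, (f p.2 p.1 + f p.1 p.2) = ∑ i, ∑ j, f i j - ∑ i, f i i := by
  rw [incPairs, Finset.sum_sigma, Finset.sum_sum_Ioi_add_eq_sum_sum_off_diag,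
    ← Finset.sum_sub_distrib, Finset.sum_comm' (t' := Finset.univ) (s' := fun i => {i}ᶜ)]
  · refine Finset.sum_congr rfl fun i _ => ?_
    rw [eq_sub_iff_add_eq, add_comm, Finset.compl_eq_univ_sdiff, Finset.sdiff_singleton_eq_erase,
      Finset.add_sum_erase _ _ (Finset.mem_univ i)]
  · simp [eq_comm]

theorem sum_vdm'_mul_TT' (k : ℕ) :
    2 * ∑ i, vdm' N i * TT' N k i
      = vdm N * (bb N k + (k ^ 2 : ℝ) • TT N k) := by
  ext θ
  have step : ∑ i, vdm' N i θ * TT' N k i θ = vdm N θ * (-(k / 2 : ℝ) *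
      ∑ p ∈ incPairs N, ∑ m ∈ Finset.range k,
        (fC m (θ p.2) * fC (k - m) (θ p.1) + fC m (θ p.1) * fC (k - m) (θ p.2))) := by
    simp only [vdm', ContinuousMap.sum_apply, Finset.sum_mul]
    rw [Finset.sum_comm, Finset.mul_sum, Finset.mul_sum]
    refine Finset.sum_congr rfl fun p hp => ?_
    have hpair := pair_identity k (θ p.2) (θ p.1)
    have hs := sinC_mul_sinC 1 k (θ p.2)
    have hs' := sinC_mul_sinC 1 k (θ p.1)
    have e1 : cosC (1 - k) = cosC (k - 1) := by rw [← cosC_neg]; congr 1; ring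
    rw [e1, add_comm (1 : ℤ)] at hs hs'
    have hv : vdm N θ = (∏ q ∈ (incPairs N).erase p,
        (fC 1 (θ q.2) - fC 1 (θ q.1))) * (fC 1 (θ p.2) - fC 1 (θ p.1)) := by
      have := Finset.mul_prod_erase _ (fun q => fC 1 (θ q.2) - fC 1 (θ q.1)) hp
      refine Eq.trans ?_ (this.symm.trans (mul_comm _ _))
      simp [vdm, atC, ContinuousMap.prod_apply]
    have hq : (∏ q ∈ (incPairs N).erase p, (atC q.2 (fC 1) - atC q.1 (fC 1))) θ
        = ∏ q ∈ (incPairs N).erase p, (fC 1 (θ q.2) - fC 1 (θ q.1)) := by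
      simp [atC, ContinuousMap.prod_apply]
    have hl : ∀ i, (((∏ q ∈ (incPairs N).erase p, (atC q.2 (fC 1) - atC q.1 (fC 1))) *
        ((if i = p.2 then TT' N 1 i else 0) - (if i = p.1 then TT' N 1 i else 0)) :
          C(Tor N, ℝ)) θ) * TT' N k i θ
        = (∏ q ∈ (incPairs N).erase p, (fC 1 (θ q.2) - fC 1 (θ q.1))) *
          ((if i = p.2 then TT' N 1 i θ * TT' N k i θ else 0)
            - (if i = p.1 then TT' N 1 i θ * TT' N k i θ else 0)) := by
      intro i
      rw [ContinuousMap.mul_apply, hq, ContinuousMap.sub_apply]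
      split_ifs <;> simp <;> ring
    simp only [hl]
    rw [← Finset.mul_sum, Finset.sum_sub_distrib, Finset.sum_ite_eq', Finset.sum_ite_eq', hv,
      mul_assoc]
    congr 1
    simp only [Finset.mem_univ, if_true, TT', ContinuousMap.smul_apply, atC,
      ContinuousMap.comp_apply, ContinuousMap.coe_mk, smul_eq_mul]
    push_cast
    linear_combination (2 * k : ℝ) * hs - (2 * k : ℝ) * hs' + (k / 2 : ℝ) * hpair
  have hsum : ∑ p ∈ incPairs N, ∑ m ∈ Finset.range k,
        (fC m (θ p.2) * fC (k - m) (θ p.1) + fC m (θ p.1) * fC (k - m) (θ p.2))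
      = ∑ m ∈ Finset.range k, (TT N m θ * TT N (k - m) θ - TT N (k - 2 * m : ℤ).natAbs θ)
        - k * TT N k θ := by
    have := sum_incPairs_comm (N := N)
      fun i j => ∑ m ∈ Finset.range k, fC m (θ i) * fC (k - m) (θ j)
    simp only [Finset.sum_add_distrib] at this ⊢
    rw [this, Finset.sum_sub_distrib, sub_sub]
    congr 1
    · rw [Finset.sum_comm' (s' := fun _ => Finset.univ) (t' := Finset.univ) (by simp)]
      simp only [TT_apply, Finset.sum_mul_sum]
      rw [Finset.sum_comm]
      simp_rw [Finset.sum_comm (s := Finset.range k)]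
    · have hk : (k : ℝ) * TT N k θ = ∑ m ∈ Finset.range k, TT N k θ := by simp
      rw [Finset.sum_comm, hk, ← Finset.sum_add_distrib]
      refine Finset.sum_congr rfl fun m hm => ?_
      rw [TT_apply, TT_apply, ← Finset.sum_add_distrib]
      refine Finset.sum_congr rfl fun i _ => ?_
      have := cosC_mul_cosC m (k - m) (θ i)
      rw [fC_apply, fC_apply, fC_apply, fC_apply, Nat.cast_sub (Finset.mem_range.mp hm).le,
        cosC_natAbs]
      rw [show (m : ℤ) + (k - m) = k by ring, show (m : ℤ) - (k - m) = -(k - 2 * m) by ring,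
        cosC_neg] at this
      linear_combination 2 * this
  simp only [ContinuousMap.mul_apply, ContinuousMap.sum_apply, ContinuousMap.add_apply,
    ContinuousMap.smul_apply, bb, ContinuousMap.sub_apply, smul_eq_mul]
  rw [show (2 : C(Tor N, ℝ)) θ = 2 from rfl, step, hsum]
  simp only [Finset.sum_sub_distrib]
  ring

end Drift

section TorusLoop

variable {N : ℕ}

/-- Integration against the squared Vandermonde determinant. -/
def vint (N : ℕ) : C(Tor N, ℝ) →ₗ[ℝ] ℝ where
  toFun f := ∫ θ, (f * vdm N ^ 2) θ ∂torM N
  map_add' f g := by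
    simp only [add_mul, ContinuousMap.add_apply]
    exact integral_add (integrable_continuousMap _ (f * vdm N ^ 2))
      (integrable_continuousMap _ (g * vdm N ^ 2))
  map_smul' c f := by
    simp only [smul_mul_assoc, ContinuousMap.smul_apply, smul_eq_mul, RingHom.id_apply]
    exact integral_const_mul _ _

/-- The product of the traces with exponents `s j`, `j ∈ S`. -/
def traceProd (N : ℕ) (S : Finset ℕ) (s : ℕ → ℕ) : C(Tor N, ℝ) := ∏ j ∈ S, TT N (s j)

/-- The loop expression associated with a product of traces and one more trace. -/
def loopC (N : ℕ) (S : Finset ℕ) (s : ℕ → ℕ) (k : ℕ) : C(Tor N, ℝ) :=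
  traceProd N S s * bb N k + ∑ j ∈ S, traceProd N (S.erase j) s * gam N (s j) k

/-- The gradient of a product of traces. -/
def traceProd' (N : ℕ) (S : Finset ℕ) (s : ℕ → ℕ) (i : Fin N) : C(Tor N, ℝ) :=
  ∑ j ∈ S, traceProd N (S.erase j) s * TT' N (s j) i

theorem hasPartial_traceProd (i : Fin N) (S : Finset ℕ) (s : ℕ → ℕ) :
    HasPartial i (traceProd N S s) (traceProd' N S s i) :=
  HasPartial.prod S fun j _ => hasPartial_TT i (s j)

/-- The loop equation on the torus. -/
theorem vint_loopC (S : Finset ℕ) (s : ℕ → ℕ) (k : ℕ) {u : C(Tor N, ℝ)}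
    {u' : Fin N → C(Tor N, ℝ)} (hu : ∀ i, HasPartial i u (u' i)) :
    vint N (loopC N S s k * u) = -vint N (∑ i, traceProd N S s * TT' N k i * u' i) := by
  set F := traceProd N S s with hF
  have hp := fun i => integral_partial
    ((((hasPartial_vdm (N := N) i).mul (hasPartial_vdm i)).mul (hasPartial_traceProd i S s)).mul
      (hasPartial_TT' i k) |>.mul (hu i))
  have key : (loopC N S s k * u + ∑ i, F * TT' N k i * u' i) * vdm N ^ 2
      = ∑ i, ((((vdm' N i * vdm N + vdm N * vdm' N i) * traceProd N S s
        + vdm N * vdm N * traceProd' N S s i) * TT' N k i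
        + vdm N * vdm N * traceProd N S s * (-k ^ 2 : ℝ) • atC i (fC k)) * u
        + vdm N * vdm N * traceProd N S s * TT' N k i * u' i) := by
    have h1 := sum_vdm'_mul_TT' (N := N) k
    have h2 : ∑ i, traceProd' N S s i * TT' N k i
        = ∑ j ∈ S, traceProd N (S.erase j) s * gam N (s j) k := by
      simp only [traceProd', Finset.sum_mul, ← sum_TT'_mul_TT', Finset.mul_sum, ← mul_assoc]
      exact Finset.sum_comm
    have h3 : ∑ i : Fin N, (-k ^ 2 : ℝ) • atC i (fC k) = -((k ^ 2 : ℝ) • TT N k) := by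
      rw [← Finset.smul_sum, neg_smul]; rfl
    have h4 : ∀ i, ((((vdm' N i * vdm N + vdm N * vdm' N i) * traceProd N S s
        + vdm N * vdm N * traceProd' N S s i) * TT' N k i
        + vdm N * vdm N * traceProd N S s * (-k ^ 2 : ℝ) • atC i (fC k)) * u
        + vdm N * vdm N * traceProd N S s * TT' N k i * u' i)
        = vdm N * F * u * 2 * (vdm' N i * TT' N k i)
          + vdm N ^ 2 * u * (traceProd' N S s i * TT' N k i)
          + vdm N ^ 2 * F * u * ((-k ^ 2 : ℝ) • atC i (fC k))
          + vdm N ^ 2 * (F * TT' N k i * u' i) := fun i => by rw [← hF]; ring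
    simp only [h4, Finset.sum_add_distrib, ← Finset.mul_sum]
    rw [h2, h3, loopC, ← hF]
    linear_combination (-(vdm N) * F * u) * h1
  have h0 : vint N (loopC N S s k * u + ∑ i, F * TT' N k i * u' i) = 0 := by
    show ∫ θ, ((loopC N S s k * u + ∑ i, F * TT' N k i * u' i) * vdm N ^ 2) θ ∂torM N = 0
    rw [key]
    simp only [ContinuousMap.sum_apply]
    rw [integral_finsetSum _ fun i _ => integrable_continuousMap _ _]
    exact Finset.sum_eq_zero fun i _ => hp i
  rw [map_add] at h0
  linarith

end TorusLoop

section Vandermonde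

variable {N : ℕ}

theorem fC_one_mul_fC (n : ℕ) (x : Ang) :
    fC 1 x * fC (n + 2) x = fC (n + 3) x + fC (n + 1) x := by
  have := cosC_mul_cosC (n + 2) 1 x
  simp only [fC_apply]
  push_cast
  rw [show (n : ℤ) + 2 + 1 = n + 3 by ring, show (n : ℤ) + 2 - 1 = n + 1 by ring] at this
  linear_combination 2 * this

theorem exists_monic_fC (n : ℕ) :
    (∃ p : Polynomial ℝ, p.IsMonicOfDegree (n + 1) ∧ ∀ x, p.eval (fC 1 x) = fC (n + 1) x) ∧
    ∃ p : Polynomial ℝ, p.IsMonicOfDegree (n + 2) ∧ ∀ x, p.eval (fC 1 x) = fC (n + 2) x := by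
  induction n with
  | zero =>
    refine ⟨⟨Polynomial.X, Polynomial.isMonicOfDegree_X ℝ, fun x => by simp⟩,
      ⟨Polynomial.X ^ 2 - Polynomial.C 2,
        (Polynomial.isMonicOfDegree_X_pow ℝ 2).sub (by simp), fun x => ?_⟩⟩
    have := cosC_mul_cosC 1 1 x
    simp [fC_apply, cosC_zero] at this ⊢
    linear_combination 2 * this
  | succ n ih =>
    obtain ⟨⟨p, hp, hp'⟩, ⟨q, hq, hq'⟩⟩ := ih
    refine ⟨⟨q, hq, hq'⟩, ⟨Polynomial.X * q - p, ?_, fun x => ?_⟩⟩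
    · refine Polynomial.IsMonicOfDegree.sub ?_ (by rw [hp.1]; omega)
      have := (Polynomial.isMonicOfDegree_X ℝ).mul hq
      rwa [show 1 + (n + 2) = n + 1 + 2 by ring] at this
    · rw [Polynomial.eval_sub, Polynomial.eval_mul, Polynomial.eval_X, hp', hq', fC_one_mul_fC]
      ring

theorem vdm_apply (θ : Tor N) :
    vdm N θ = ∏ i, ∏ j ∈ Finset.Ioi i, (fC 1 (θ j) - fC 1 (θ i)) := by
  rw [vdm, ContinuousMap.prod_apply, incPairs, Finset.prod_sigma]
  rfl

/-- The Slater determinant of the cosine modes is a multiple of the Vandermonde determinant. -/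
theorem exists_slater_eq (N : ℕ) :
    ∃ c : ℝ, c ≠ 0 ∧ ∀ θ : Tor N, slater θ (modes N) = c * vdm N θ := by
  have hex : ∀ a : ℕ, ∃ c : ℝ, c ≠ 0 ∧ ∃ p : Polynomial ℝ, p.IsMonicOfDegree a ∧
      ∀ x, phi a x = c * p.eval (fC 1 x) := by
    intro a
    rcases a with _ | a
    · exact ⟨1, one_ne_zero, 1, by rw [Polynomial.isMonicOfDegree_zero_iff],
        fun x => by simp [phi, cosC_zero]⟩
    · obtain ⟨p, hp, hp'⟩ := (exists_monic_fC a).1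
      exact ⟨√2 / 2, by positivity, p, hp, fun x => by
        rw [hp', phi, fC_apply]; push_cast; simp; ring⟩
  choose c hc p hp hcp using hex
  refine ⟨∏ i : Fin N, c i, Finset.prod_ne_zero_iff.mpr fun i _ => hc i, fun θ => ?_⟩
  have hv := det_eval_matrixOfPolynomials_eq_det_vandermonde (fun j => fC 1 (θ j))
    (fun i : Fin N => p i) (fun i => (hp i).1) (fun i => (hp i).2)
  rw [det_vandermonde, ← vdm_apply] at hv
  rw [hv, ← det_mul_row, slater_apply, ← det_transpose]
  congr 1
  ext i j
  simp [modes, hcp]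

theorem continuous_translate (i : Fin N) (θ : Tor N) :
    Continuous fun t : ℝ => θ + (Pi.single i (t : Ang) : Tor N) :=
  continuous_const.add ((continuous_single i).comp (AddCircle.continuous_mk' _))

theorem atC_sub_mem_nonZeroDivisors {i j : Fin N} (hij : i ≠ j) :
    atC j (fC 1) - atC i (fC 1) ∈ nonZeroDivisors C(Tor N, ℝ) := by
  rw [mem_nonZeroDivisors_iff_right]
  intro h hh
  ext θ
  by_contra hθ
  have hev : ∀ᶠ t : ℝ in nhds 0, h (θ + Pi.single j (t : Ang)) ≠ 0 := by
    have hc : Continuous fun t : ℝ => h (θ + Pi.single j (t : Ang)) :=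
      h.continuous.comp (continuous_translate j θ)
    exact hc.continuousAt.eventually_ne (by simpa using hθ)
  have hd := (hasPartial_fC j j 1).sub (hasPartial_fC j i 1)
  rw [if_pos rfl, if_neg hij.symm, sub_zero] at hd
  have hd2 := hasPartial_TT' j 1
  have h0 : (fun t : ℝ => (atC j (fC 1) - atC i (fC 1)) (θ + Pi.single j (t : Ang)))
      =ᶠ[nhds 0] fun _ => 0 := by
    filter_upwards [hev] with t ht
    have := DFunLike.congr_fun hh (θ + Pi.single j (t : Ang))
    exact (mul_eq_zero.mp this).resolve_left ht
  have h1 : (fun t : ℝ => TT' N 1 j (θ + Pi.single j (t : Ang))) =ᶠ[nhds 0] fun _ => 0 := by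
    filter_upwards [h0.eventually_nhds] with t ht
    rw [← (hd.hasDerivAt θ t).deriv, Filter.EventuallyEq.deriv_eq ht, deriv_const]
  have h2 := h1.deriv_eq
  rw [(hd2.hasDerivAt θ 0).deriv, deriv_const] at h2
  have h3 := h1.self_of_nhds
  have h4 := sinC_sq_add_cosC_sq 1 (θ j)
  simp [TT', atC, fC_apply] at h2 h3
  rw [h2, h3] at h4
  norm_num at h4

theorem vdm_mem_nonZeroDivisors : vdm N ∈ nonZeroDivisors C(Tor N, ℝ) := by
  refine Submonoid.prod_mem _ fun p hp => atC_sub_mem_nonZeroDivisors ?_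
  simp only [incPairs, Finset.mem_sigma, Finset.mem_Ioi] at hp
  exact hp.2.ne

theorem eq_zero_of_vint_sq {f : C(Tor N, ℝ)} (h : vint N (f * f) = 0) : f = 0 := by
  have h1 : ∫ θ, ((f * vdm N) ^ 2) θ ∂torM N = 0 := by
    rw [← h]
    show _ = ∫ θ, (f * f * vdm N ^ 2) θ ∂torM N
    rw [show f * f * vdm N ^ 2 = (f * vdm N) ^ 2 by ring]
  have h3' : ∀ θ, ((f * vdm N) ^ 2) θ = 0 := by
    intro θ
    by_contra hne
    have := integral_pos_of_integrable_nonneg_nonzero (μ := torM N)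
      ((f * vdm N) ^ 2).continuous (integrable_continuousMap _ _)
      (fun θ => by rw [ContinuousMap.pow_apply]; exact sq_nonneg _) hne
    exact this.ne' h1
  have h3 : f * vdm N = 0 := by
    ext θ
    simpa using h3' θ
  exact (mem_nonZeroDivisors_iff_right.mp vdm_mem_nonZeroDivisors) f h3

theorem vint_sq_nonneg (f : C(Tor N, ℝ)) : 0 ≤ vint N (f * f) := by
  refine integral_nonneg fun θ => ?_
  simp only [ContinuousMap.mul_apply, ContinuousMap.pow_apply, Pi.zero_apply]
  exact mul_nonneg (mul_self_nonneg _) (sq_nonneg _)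

/-- A function on the torus with vanishing gradient is constant. -/
theorem eq_const_of_partial_zero {f : C(Tor N, ℝ)} (h : ∀ i, HasPartial i f 0) :
    ∃ c : ℝ, f = c • (1 : C(Tor N, ℝ)) := by
  have h1 : ∀ (i : Fin N) (θ : Tor N) (a : Ang), f (θ + Pi.single i a) = f θ := by
    intro i θ a
    induction a using QuotientAddGroup.induction_on with
    | _ t =>
      have := is_const_of_deriv_eq_zero (f := fun t : ℝ => f (θ + Pi.single i (t : Ang)))
        (fun t => ((h i).hasDerivAt θ t).differentiableAt)
        (fun t => ((h i).hasDerivAt θ t).deriv) t 0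
      simpa using this
  have h2 : ∀ (S : Finset (Fin N)) (θ : Tor N), f (∑ i ∈ S, Pi.single i (θ i)) = f 0 := by
    intro S θ
    induction S using Finset.induction_on with
    | empty => simp
    | insert a S ha ih => rw [Finset.sum_insert ha, add_comm, h1, ih]
  refine ⟨f 0, ?_⟩
  ext θ
  have := h2 Finset.univ θ
  rw [Finset.univ_sum_single] at this
  simpa using this

end Vandermonde

section Uniqueness

variable {N : ℕ}

/-- The span of the products of traces of total exponent at most `d`. -/
def traceSpan (N d : ℕ) : Submodule ℝ C(Tor N, ℝ) :=
  Submodule.span ℝ {f | ∃ m : Multiset ℕ, m.sum ≤ d ∧ f = (m.map (TT N)).prod}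

theorem traceSpan_mono {d e : ℕ} (h : d ≤ e) : traceSpan N d ≤ traceSpan N e :=
  Submodule.span_mono fun _ ⟨m, hm, hf⟩ => ⟨m, hm.trans h, hf⟩

theorem mul_mem_traceSpan {d e : ℕ} {f g : C(Tor N, ℝ)} (hf : f ∈ traceSpan N d)
    (hg : g ∈ traceSpan N e) : f * g ∈ traceSpan N (d + e) := by
  have h := Submodule.mul_mem_mul hf hg
  rw [traceSpan, traceSpan, Submodule.span_mul_span] at h
  refine Submodule.span_mono ?_ h
  rintro _ ⟨_, ⟨m, hm, rfl⟩, _, ⟨n, hn, rfl⟩, rfl⟩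
  exact ⟨m + n, by rw [Multiset.sum_add]; omega, by simp⟩

theorem one_mem_traceSpan : (1 : C(Tor N, ℝ)) ∈ traceSpan N 0 :=
  Submodule.subset_span ⟨0, by simp, by simp⟩

theorem TT_mem_traceSpan (k : ℕ) : TT N k ∈ traceSpan N k :=
  Submodule.subset_span ⟨{k}, by simp, by simp⟩

theorem traceProd_mem_traceSpan (S : Finset ℕ) (s : ℕ → ℕ) :
    traceProd N S s ∈ traceSpan N (∑ j ∈ S, s j) :=
  Submodule.subset_span ⟨S.val.map s, le_rfl, by rw [Multiset.map_map]; rfl⟩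

theorem bb_mem_traceSpan (k : ℕ) : bb N k ∈ traceSpan N k := by
  refine Submodule.smul_mem _ _ (Submodule.sum_mem _ fun j hj => Submodule.sub_mem _ ?_ ?_)
  · have := Finset.mem_range.mp hj
    exact traceSpan_mono (by omega) (TT_mem_traceSpan _)
  · have := Finset.mem_range.mp hj
    exact traceSpan_mono (by omega) (mul_mem_traceSpan (TT_mem_traceSpan j)
      (TT_mem_traceSpan (k - j)))

theorem gam_mem_traceSpan (k l : ℕ) : gam N k l ∈ traceSpan N (k + l) :=
  Submodule.smul_mem _ _ (Submodule.sub_mem _ (traceSpan_mono (by omega) (TT_mem_traceSpan _))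
    (TT_mem_traceSpan _))

theorem loopC_mem_traceSpan (S : Finset ℕ) (s : ℕ → ℕ) (k : ℕ) :
    loopC N S s k ∈ traceSpan N (∑ j ∈ S, s j + k) := by
  refine Submodule.add_mem _ (mul_mem_traceSpan (traceProd_mem_traceSpan S s)
    (bb_mem_traceSpan k)) (Submodule.sum_mem _ fun j hj => ?_)
  refine traceSpan_mono ?_ (mul_mem_traceSpan (traceProd_mem_traceSpan (S.erase j) s)
    (gam_mem_traceSpan (s j) k))
  rw [← Finset.sum_erase_add S s hj]
  omega

theorem TT_zero : TT N 0 = (2 * N : ℝ) • (1 : C(Tor N, ℝ)) := by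
  ext θ
  simp [TT_apply, fC_apply, cosC_zero, mul_comm]

instance finite_traceSpan (d : ℕ) : FiniteDimensional ℝ (traceSpan N d) := by
  have hfin : ((fun m : Multiset ℕ => (m.map (TT N)).prod) ''
      Set.Iic (d • Multiset.range (d + 1))).Finite := (Set.finite_Iic _).image _
  have := FiniteDimensional.span_of_finite ℝ hfin
  suffices h : traceSpan N d ≤ Submodule.span ℝ ((fun m : Multiset ℕ => (m.map (TT N)).prod) ''
      Set.Iic (d • Multiset.range (d + 1))) from Submodule.finiteDimensional_of_le h
  refine Submodule.span_le.mpr ?_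
  rintro _ ⟨m, hm, rfl⟩
  have h0 : m.filter (· = 0) = Multiset.replicate (m.count 0) 0 := Multiset.filter_eq' m 0
  have hsplit := Multiset.filter_add_not (· = 0) m
  rw [← hsplit, h0, Multiset.map_add, Multiset.prod_add, Multiset.map_replicate,
    Multiset.prod_replicate, TT_zero, smul_pow, one_pow, smul_one_mul]
  refine Submodule.smul_mem _ _ (Submodule.subset_span ⟨m.filter (fun a => ¬ a = 0), ?_, rfl⟩)
  rw [Set.mem_Iic, Multiset.le_iff_count]
  intro a
  rw [Multiset.count_nsmul]
  by_cases ha : a ∈ m.filter (fun a => ¬ a = 0)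
  · have ha' := Multiset.mem_filter.mp ha
    have h1 : m.count a * a ≤ m.sum := by
      have h2 : Multiset.replicate (m.count a) a ≤ m := Multiset.le_count_iff_replicate_le.mp le_rfl
      obtain ⟨t, ht⟩ := Multiset.le_iff_exists_add.mp h2
      conv_rhs => rw [ht]
      rw [Multiset.sum_add, Multiset.sum_replicate, smul_eq_mul]
      exact Nat.le_add_right _ _
    have hpos : 0 < a := Nat.pos_of_ne_zero ha'.2
    have hc : 0 < m.count a := Multiset.count_pos.mpr ha'.1
    have h3 : a ≤ d := by nlinarith
    have h4 : (Multiset.range (d + 1)).count a = 1 :=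
      Multiset.count_eq_one_of_mem (Multiset.nodup_range _) (by simp; omega)
    rw [h4, mul_one, Multiset.count_filter_of_pos (p := fun a => ¬ a = 0) ha'.2]
    nlinarith
  · rw [Multiset.count_eq_zero_of_notMem ha]; positivity

theorem exists_traceProd (m : Multiset ℕ) :
    ∃ (S : Finset ℕ) (s : ℕ → ℕ), ∑ j ∈ S, s j = m.sum ∧ (m.map (TT N)).prod = traceProd N S s := by
  induction m using Quotient.inductionOn with
  | _ l =>
    refine ⟨Finset.range l.length, fun i => l.getD i 0, ?_, ?_⟩
    · rw [Finset.sum_range]; simp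
    · rw [traceProd, Finset.prod_range]
      simp only [Multiset.quot_mk_to_coe, Multiset.map_coe, Multiset.prod_coe, Fin.is_lt,
        List.getD_eq_getElem]
      rw [← List.prod_ofFn]
      congr 1
      refine List.ext_getElem (by simp) (by simp)

/-- A pair consisting of a function and its image under the generator of the radial diffusion, the
latter being annihilated by `L`. -/
def LoopPair (L : C(Tor N, ℝ) → ℝ) (d : ℕ) (f g : C(Tor N, ℝ)) : Prop :=
  g ∈ traceSpan N d ∧ L g = 0 ∧ ∃ f' : Fin N → C(Tor N, ℝ), (∀ i, HasPartial i f (f' i)) ∧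
    ∀ (u : C(Tor N, ℝ)) (u' : Fin N → C(Tor N, ℝ)), (∀ i, HasPartial i u (u' i)) →
      vint N (g * u) = -vint N (∑ i, f' i * u' i)

variable {L : C(Tor N, ℝ) → ℝ}
  (hadd : ∀ d, ∀ f ∈ traceSpan N d, ∀ g ∈ traceSpan N d, L (f + g) = L f + L g)
  (hsmul : ∀ d, ∀ f ∈ traceSpan N d, ∀ c : ℝ, L (c • f) = c * L f)

include hsmul in
theorem loopPair_zero (d : ℕ) : LoopPair L d 0 0 := by
  refine ⟨Submodule.zero_mem _, ?_, 0, fun i => HasPartial.zero i, fun u u' _ => by simp⟩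
  simpa using hsmul 0 0 (Submodule.zero_mem _) 0

include hadd in
theorem LoopPair.add {d : ℕ} {f g f₂ g₂ : C(Tor N, ℝ)} (h : LoopPair L d f g)
    (h₂ : LoopPair L d f₂ g₂) : LoopPair L d (f + f₂) (g + g₂) := by
  obtain ⟨hg, hL, f', hf', hu⟩ := h
  obtain ⟨hg₂, hL₂, f₂', hf₂', hu₂⟩ := h₂
  refine ⟨Submodule.add_mem _ hg hg₂, by rw [hadd d _ hg _ hg₂, hL, hL₂, add_zero], f' + f₂',
    fun i => (hf' i).add (hf₂' i), fun u u' h => ?_⟩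
  rw [add_mul, map_add, hu u u' h, hu₂ u u' h]
  simp only [Pi.add_apply, add_mul, Finset.sum_add_distrib, map_add]
  ring

include hsmul in
theorem LoopPair.smul {d : ℕ} {f g : C(Tor N, ℝ)} (c : ℝ) (h : LoopPair L d f g) :
    LoopPair L d (c • f) (c • g) := by
  obtain ⟨hg, hL, f', hf', hu⟩ := h
  refine ⟨Submodule.smul_mem _ _ hg, by rw [hsmul d _ hg, hL, mul_zero], c • f',
    fun i => (hf' i).smul c, fun u u' h => ?_⟩
  simp only [smul_mul_assoc, map_smul, hu u u' h, Pi.smul_apply, ← Finset.smul_sum, smul_neg]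

variable (hloop : ∀ S s k, L (loopC N S s k) = 0)

include hadd hsmul hloop in
theorem exists_loopPair {d : ℕ} {f : C(Tor N, ℝ)} (hf : f ∈ traceSpan N d) :
    ∃ g, LoopPair L d f g := by
  induction hf using Submodule.span_induction with
  | zero => exact ⟨0, loopPair_zero hsmul d⟩
  | add f f₂ _ _ h h₂ =>
    obtain ⟨g, hg⟩ := h
    obtain ⟨g₂, hg₂⟩ := h₂
    exact ⟨_, hg.add hadd hg₂⟩
  | smul c f _ h =>
    obtain ⟨g, hg⟩ := h
    exact ⟨_, hg.smul hsmul c⟩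
  | mem f h =>
    obtain ⟨m, hm, rfl⟩ := h
    obtain ⟨S, s, hS, hprod⟩ := exists_traceProd (N := N) m
    rw [hprod]
    have hmem : ∀ j ∈ S, loopC N (S.erase j) s (s j) ∈ traceSpan N d := fun j hj => by
      refine traceSpan_mono ?_ (loopC_mem_traceSpan _ _ _)
      rw [Finset.sum_erase_add S s hj]; omega
    refine ⟨∑ j ∈ S, loopC N (S.erase j) s (s j), Submodule.sum_mem _ hmem, ?_,
      traceProd' N S s, fun i => hasPartial_traceProd i S s, fun u u' hu => ?_⟩
    · have : ∀ T ⊆ S, L (∑ j ∈ T, loopC N (S.erase j) s (s j)) = 0 := by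
        intro T
        induction T using Finset.induction_on with
        | empty => intro _; simpa using hsmul 0 0 (Submodule.zero_mem _) 0
        | insert a T ha ih =>
          intro hT
          rw [Finset.insert_subset_iff] at hT
          rw [Finset.sum_insert ha, hadd d _ (hmem a hT.1) _
            (Submodule.sum_mem _ fun j hj => hmem j (hT.2 hj)), hloop, ih hT.2, add_zero]
      exact this S subset_rfl
    · rw [Finset.sum_mul, map_sum, Finset.sum_congr rfl fun j _ => vint_loopC (S.erase j) s (s j) hu,
        Finset.sum_neg_distrib, ← map_sum, Finset.sum_comm]
      simp only [traceProd', Finset.sum_mul]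

include hadd hsmul hloop in
/-- The loop equations determine the expectations of products of traces. -/
theorem vint_eq_of_loop (hone : L 1 = 1) {d : ℕ} {F : C(Tor N, ℝ)} (hF : F ∈ traceSpan N d) :
    vint N F = L F * vint N 1 := by
  let K : Submodule ℝ C(Tor N, ℝ) :=
    { carrier := {g | ∃ f ∈ traceSpan N d, LoopPair L d f g}
      zero_mem' := ⟨0, Submodule.zero_mem _, loopPair_zero hsmul d⟩
      add_mem' := by
        rintro g g₂ ⟨f, hf, h⟩ ⟨f₂, hf₂, h₂⟩
        exact ⟨_, Submodule.add_mem _ hf hf₂, h.add hadd h₂⟩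
      smul_mem' := by
        rintro c g ⟨f, hf, h⟩
        exact ⟨_, Submodule.smul_mem _ _ hf, h.smul hsmul c⟩ }
  have hone' : (1 : C(Tor N, ℝ)) ∈ traceSpan N d := traceSpan_mono (Nat.zero_le d) one_mem_traceSpan
  let K' : Submodule ℝ C(Tor N, ℝ) := K ⊔ Submodule.span ℝ {1}
  have hK' : K' ≤ traceSpan N d := by
    refine sup_le ?_ (Submodule.span_le.mpr (by simpa using hone'))
    rintro g ⟨f, _, h⟩
    exact h.1
  have : FiniteDimensional ℝ K' := Submodule.finiteDimensional_of_le hK'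
  let Φ : K' →ₗ[ℝ] Module.Dual ℝ K' :=
    ((LinearMap.mul ℝ C(Tor N, ℝ)).compr₂ (vint N)).compl₁₂ K'.subtype K'.subtype
  have hΦ : ∀ v w : K', Φ v w = vint N (v * w) := fun _ _ => rfl
  have hinj : Function.Injective Φ := by
    rw [injective_iff_map_eq_zero]
    intro v hv
    have := hΦ v v
    rw [hv] at this
    exact Subtype.ext (eq_zero_of_vint_sq this.symm)
  have hsurj : Function.Surjective Φ :=
    (LinearMap.injective_iff_surjective_of_finrank_eq_finrank
      (Subspace.dual_finrank_eq (K := ℝ) (V := K')).symm).mp hinj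
  obtain ⟨⟨w, hw⟩, hwF⟩ := hsurj
    ((LinearMap.mul ℝ C(Tor N, ℝ)).compr₂ (vint N) F ∘ₗ K'.subtype)
  have hwF' : ∀ v ∈ K', vint N (w * v) = vint N (F * v) := fun v hv =>
    LinearMap.congr_fun hwF ⟨v, hv⟩
  set h := F - w with hh
  have hwh : w + h = F := by rw [hh]; ring
  have hhmem : h ∈ traceSpan N d := Submodule.sub_mem _ hF (hK' hw)
  have horth : ∀ v ∈ K', vint N (v * h) = 0 := fun v hv => by
    rw [hh, mul_sub, map_sub, mul_comm v F, mul_comm v w, hwF' v hv, sub_self]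
  clear_value h
  have hzero : h = 0 := by
    obtain ⟨g, hg⟩ := exists_loopPair hadd hsmul hloop hhmem
    have hgh := horth g (Submodule.mem_sup_left ⟨h, hhmem, hg⟩)
    obtain ⟨-, -, f', hf', hu⟩ := hg
    rw [hu h f' hf', neg_eq_zero, map_sum,
      Finset.sum_eq_zero_iff_of_nonneg fun i _ => vint_sq_nonneg _] at hgh
    obtain ⟨c, hc⟩ := eq_const_of_partial_zero fun i => by
      have := hf' i
      rwa [eq_zero_of_vint_sq (hgh i (Finset.mem_univ i))] at this
    refine eq_zero_of_vint_sq ?_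
    have h1 := horth 1 (Submodule.mem_sup_right (Submodule.mem_span_singleton_self 1))
    rw [one_mul] at h1
    conv_lhs => rw [hc]
    rw [smul_mul_assoc, one_mul, ← hc, map_smul, h1, smul_zero]
  rw [hzero, add_zero] at hwh
  subst hwh
  obtain ⟨g, ⟨f, hf, hg⟩, o, ho, rfl⟩ := Submodule.mem_sup.mp hw
  obtain ⟨c, rfl⟩ := Submodule.mem_span_singleton.mp ho
  have h1 : vint N g = 0 := by
    have := hg.2.2.choose_spec.2 1 0 fun i => HasPartial.const_one i
    simpa using this
  rw [map_add, h1, hadd d _ hg.1 _ (Submodule.smul_mem _ _ hone'), hg.2.1, map_smul, hsmul d _ hone',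
    hone]
  simp

end Uniqueness

section Eigenangles

open Polynomial

theorem det_aeval_eq_prod {n K : Type*} [Fintype n] [DecidableEq n] [Field K] [IsAlgClosed K]
    (A : Matrix n n K) {q : K[X]} (hq : q.Monic) :
    (aeval A q).det = (A.charpoly.roots.map fun z => q.eval z).prod := by
  have hcard : Multiset.card A.charpoly.roots = Fintype.card n := by
    rw [← (IsAlgClosed.splits A.charpoly).natDegree_eq_card_roots,
      Matrix.charpoly_natDegree_eq_dim]
  have key : ∀ s : Multiset K, (aeval A (s.map fun r => X - C r).prod).det =
      (A.charpoly.roots.map fun z => ((s.map fun r => X - C r).prod).eval z).prod := by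
    intro s
    induction s using Multiset.induction_on with
    | empty => simp
    | cons r s ih =>
      have h1 : (aeval A (X - C r)).det = (A.charpoly.roots.map fun z => z - r).prod := by
        have h2 := (IsAlgClosed.splits A.charpoly).eval_eq_prod_roots_of_monic A.charpoly_monic r
        have h3 : aeval A (X - C r) = -(Matrix.scalar n r - A) := by
          simp [Matrix.algebraMap_eq_diagonal, Matrix.scalar_apply]
        rw [h3, Matrix.det_neg, ← Matrix.eval_charpoly, h2, ← hcard,
          ← Multiset.card_map (fun z => r - z), ← Multiset.prod_map_neg, Multiset.map_map]
        simp
      simp only [Multiset.map_cons, Multiset.prod_cons, map_mul, Matrix.det_mul, eval_mul,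
        Multiset.prod_map_mul, ih, h1]
      simp
  conv_lhs => rw [(IsAlgClosed.splits q).eq_prod_roots_of_monic hq]
  rw [key, ← (IsAlgClosed.splits q).eq_prod_roots_of_monic hq]

theorem roots_charpoly_pow {n K : Type*} [Fintype n] [DecidableEq n] [Field K] [IsAlgClosed K]
    (A : Matrix n n K) (k : ℕ) :
    (A ^ k).charpoly.roots = A.charpoly.roots.map (· ^ k) := by
  have : Infinite K := IsAlgClosed.instInfinite
  have hcard : Multiset.card A.charpoly.roots = Fintype.card n := by
    rw [← (IsAlgClosed.splits A.charpoly).natDegree_eq_card_roots,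
      Matrix.charpoly_natDegree_eq_dim]
  rcases Nat.eq_zero_or_pos k with rfl | hk
  · simp only [pow_zero, Matrix.charpoly_one, Multiset.map_const', hcard]
    rw [Polynomial.roots_pow, ← map_one C, roots_X_sub_C, Multiset.nsmul_singleton]
  have h : (A ^ k).charpoly = ((A.charpoly.roots.map (· ^ k)).map fun z => X - C z).prod := by
    refine Polynomial.funext fun c => ?_
    have hqm : (X ^ k - C c : K[X]).Monic := monic_X_pow_sub_C c hk.ne'
    have h1 := det_aeval_eq_prod A hqm
    have h3 : aeval A (X ^ k - C c : K[X]) = -(Matrix.scalar n c - A ^ k) := by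
      simp [Matrix.algebraMap_eq_diagonal, Matrix.scalar_apply]
    rw [h3, Matrix.det_neg, ← Matrix.eval_charpoly] at h1
    rw [eval_multiset_prod, Multiset.map_map, Multiset.map_map]
    have h4 : (A.charpoly.roots.map fun z => (X ^ k - C c : K[X]).eval z).prod =
        (-1) ^ Fintype.card n * (A.charpoly.roots.map fun z => c - z ^ k).prod := by
      rw [← hcard, ← Multiset.card_map (fun z => c - z ^ k), ← Multiset.prod_map_neg,
        Multiset.map_map]
      simp
    rw [h4] at h1
    have := mul_left_cancel₀ (pow_ne_zero _ (neg_ne_zero.mpr one_ne_zero)) h1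
    rw [this]
    simp
  rw [h, roots_multiset_prod_X_sub_C]

theorem exists_half_multiset (N : ℕ) (R : Multiset ℂ) (hcard : Multiset.card R = 2 * N)
    (hR : ∀ z ∈ R, ‖z‖ = 1) (hconj : R.map (starRingEnd ℂ) = R) (hprod : R.prod = 1) :
    ∃ S : Multiset ℂ, Multiset.card S = N ∧ (∀ z ∈ S, ‖z‖ = 1) ∧
      R = S + S.map (starRingEnd ℂ) := by
  induction N generalizing R with
  | zero => exact ⟨0, rfl, by simp, by simpa using hcard⟩
  | succ N ih =>
    have hconj1 : ∀ z ∈ R, z * starRingEnd ℂ z = 1 := fun z hz => by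
      rw [Complex.mul_conj, Complex.normSq_eq_norm_sq, hR z hz]; simp
    obtain ⟨z, R', hR'⟩ : ∃ z R', R = z ::ₘ (starRingEnd ℂ z) ::ₘ R' := by
      by_cases hz : ∃ z ∈ R, starRingEnd ℂ z ≠ z
      · obtain ⟨z, hz, hne⟩ := hz
        obtain ⟨T, hT⟩ := Multiset.exists_cons_of_mem hz
        have h2 : starRingEnd ℂ z ∈ R := by
          rw [← hconj]; exact Multiset.mem_map_of_mem _ hz
        rw [hT, Multiset.mem_cons] at h2
        obtain ⟨T', hT'⟩ := Multiset.exists_cons_of_mem (h2.resolve_left hne)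
        exact ⟨z, T', by rw [hT, hT']⟩
      · push Not at hz
        have hdup : ¬ R.Nodup := by
          intro hnd
          have hsub : R ≤ {1, -1} := by
            rw [Multiset.le_iff_subset hnd]
            intro z hzR
            have := hconj1 z hzR
            rw [hz z hzR, ← sq, sq_eq_one_iff] at this
            simpa using this
          have heq : R = {1, -1} := Multiset.eq_of_le_of_card_le hsub (by simp; omega)
          rw [heq] at hprod
          norm_num at hprod
        obtain ⟨z, hz2⟩ : ∃ z, 1 < R.count z := by
          rw [Multiset.nodup_iff_count_le_one] at hdup
          push Not at hdup
          exact hdup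
        have := Multiset.le_count_iff_replicate_le.mp (show 2 ≤ R.count z from hz2)
        obtain ⟨T, hT⟩ := Multiset.le_iff_exists_add.mp this
        have hzR : z ∈ R := Multiset.count_pos.mp (by omega)
        exact ⟨z, T, by rw [hz z hzR, hT, Multiset.replicate_succ, Multiset.replicate_one,
          Multiset.cons_add, Multiset.singleton_add]⟩
    subst hR'
    have hz1 := hconj1 z (by simp)
    obtain ⟨S, hS, hS1, hS2⟩ := ih R' (by simp at hcard; omega) (fun w hw => hR w (by simp [hw]))
      (by
        simp only [Multiset.map_cons, Complex.conj_conj] at hconj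
        rw [Multiset.cons_swap] at hconj
        simpa using hconj)
      (by
        rw [Multiset.prod_cons, Multiset.prod_cons, ← mul_assoc, hz1, one_mul] at hprod
        exact hprod)
    refine ⟨z ::ₘ S, by simp [hS], ?_, ?_⟩
    · intro w hw
      rcases Multiset.mem_cons.mp hw with rfl | hw
      · exact hR _ (by simp)
      · exact hS1 w hw
    · rw [Multiset.map_cons, Multiset.cons_add, Multiset.add_cons, ← hS2]

open scoped Matrix.Norms.L2Operator in
theorem norm_eq_one_of_mem_roots_charpoly {n : Type*} [Fintype n] [DecidableEq n]
    {A : Matrix n n ℂ} (hA : A ∈ Matrix.unitaryGroup n ℂ) {z : ℂ} (hz : z ∈ A.charpoly.roots) :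
    ‖z‖ = 1 :=
  spectrum.norm_eq_one_of_unitary hA
    (Matrix.mem_spectrum_of_isRoot_charpoly (Polynomial.isRoot_of_mem_roots hz))

theorem exists_eq_map_univ {α : Type*} {N : ℕ} {S : Multiset α} (hS : Multiset.card S = N) :
    ∃ f : Fin N → α, S = Finset.univ.val.map f := by
  induction N generalizing S with
  | zero => exact ⟨Fin.elim0, by rw [Multiset.card_eq_zero.mp hS]; simp⟩
  | succ N ih =>
    obtain ⟨a, ha⟩ := Multiset.card_pos_iff_exists_mem.mp (show 0 < Multiset.card S by omega)
    obtain ⟨T, rfl⟩ := Multiset.exists_cons_of_mem ha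
    obtain ⟨f, rfl⟩ := ih (S := T) (by simpa using hS)
    refine ⟨Fin.cons a f, ?_⟩
    simp [Fin.univ_succ]

theorem exists_eigenangles {N : ℕ} {A : Matrix (Fin (2 * N)) (Fin (2 * N)) ℝ}
    (hA : A ∈ Matrix.specialOrthogonalGroup (Fin (2 * N)) ℝ) :
    ∃ θ : Tor N, ∀ k : ℕ, (A ^ k).trace = TT N k θ := by
  set B : Matrix (Fin (2 * N)) (Fin (2 * N)) ℂ := A.map Complex.ofRealHom with hB
  obtain ⟨hAo, hAd⟩ := Matrix.mem_specialOrthogonalGroup_iff.mp hA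
  have hAo' := (Matrix.mem_orthogonalGroup_iff _ _).mp hAo
  have hBo : B ∈ Matrix.unitaryGroup (Fin (2 * N)) ℂ := by
    rw [Matrix.mem_unitaryGroup_iff, Matrix.star_eq_conjTranspose]
    have : Bᴴ = (Aᵀ).map Complex.ofRealHom := by
      ext i j; simp [hB, Matrix.conjTranspose_apply]
    rw [this, hB, ← Matrix.map_mul, hAo']
    simp
  have hsplit : B.charpoly.Splits := IsAlgClosed.splits _
  have hcard : Multiset.card B.charpoly.roots = 2 * N := by
    rw [← hsplit.natDegree_eq_card_roots, Matrix.charpoly_natDegree_eq_dim, Fintype.card_fin]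
  have hconj : B.charpoly.roots.map (starRingEnd ℂ) = B.charpoly.roots := by
    rw [← hsplit.roots_map]
    congr 1
    rw [hB, Matrix.charpoly_map, Polynomial.map_map]
    congr 1
    ext x; simp
  have hprod : B.charpoly.roots.prod = 1 := by
    rw [← Matrix.det_eq_prod_roots_charpoly, hB, ← RingHom.mapMatrix_apply, ← RingHom.map_det,
      hAd, map_one]
  obtain ⟨S, hS, hS1, hS2⟩ := exists_half_multiset N _ hcard
    (fun z hz => norm_eq_one_of_mem_roots_charpoly hBo hz) hconj hprod
  obtain ⟨f, hf⟩ := exists_eq_map_univ hS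
  refine ⟨fun i => ((f i).arg : Ang), fun k => ?_⟩
  have htr : ((A ^ k).trace : ℂ) = (B ^ k).trace := by
    rw [hB, ← RingHom.mapMatrix_apply, ← map_pow, RingHom.mapMatrix_apply, Matrix.trace, Matrix.trace]
    simp
  rw [Matrix.trace_eq_sum_roots_charpoly (B ^ k), roots_charpoly_pow, hS2, hf] at htr
  have hre := congrArg Complex.re htr
  rw [Complex.ofReal_re] at hre
  rw [hre, TT_apply]
  simp only [Multiset.map_add, Multiset.map_map, Multiset.sum_add, Function.comp_apply]
  rw [← Finset.sum, ← Finset.sum, ← Finset.sum_add_distrib, Complex.re_sum]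
  refine Finset.sum_congr rfl fun i _ => ?_
  have hn : ‖f i‖ = 1 := hS1 _ (by rw [hf]; exact Multiset.mem_map_of_mem _ (Finset.mem_univ_val i))
  have hfi : f i = Complex.exp ((f i).arg * Complex.I) := by
    conv_lhs => rw [← Complex.norm_mul_exp_arg_mul_I (f i), hn]
    simp
  rw [fC_apply, cosC_coe, ← map_pow, Complex.add_re, Complex.conj_re, ← two_mul, hfi,
    ← Complex.exp_nat_mul]
  congr 1
  rw [← hfi, ← mul_assoc, ← Complex.exp_ofReal_mul_I_re]
  push_cast
  rfl

end Eigenangles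

section Rotations

set_option linter.unusedSectionVars false

variable {n : Type*} [Fintype n] [DecidableEq n]

/-- The standard generators of the orthogonal Lie algebra. -/
def skewGen (p q : n) : Matrix n n ℝ := Matrix.single p q 1 - Matrix.single q p 1

theorem skewGen_transpose (p q : n) : (skewGen p q)ᵀ = -skewGen p q := by
  simp [skewGen, Matrix.transpose_sub]

theorem skewGen_pow_three (p q : n) :
    skewGen p q * (skewGen p q * skewGen p q) = -skewGen p q := by
  by_cases h : p = q
  · simp [skewGen, h]
  · simp only [skewGen, mul_sub, sub_mul]
    simp [h, Ne.symm h]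
    abel

/-- The rotation by the angle `t` in a coordinate plane. -/
def planeRot (p q : n) (t : ℝ) : Matrix n n ℝ :=
  1 + Real.sin t • skewGen p q + (1 - Real.cos t) • (skewGen p q * skewGen p q)

theorem planeRot_zero (p q : n) : planeRot p q 0 = 1 := by simp [planeRot]

theorem planeRot_add (p q : n) (s t : ℝ) :
    planeRot p q (s + t) = planeRot p q s * planeRot p q t := by
  have h := skewGen_pow_three p q
  have h' : skewGen p q * skewGen p q * skewGen p q = -skewGen p q := by rw [mul_assoc, h]
  have h2 : skewGen p q * skewGen p q * (skewGen p q * skewGen p q)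
      = -(skewGen p q * skewGen p q) := by rw [mul_assoc, h, mul_neg]
  simp only [planeRot, Real.sin_add, Real.cos_add, add_mul, mul_add, one_mul, mul_one,
    smul_mul_smul_comm, h, h', h2]
  module

theorem planeRot_transpose (p q : n) (t : ℝ) : (planeRot p q t)ᵀ = planeRot p q (-t) := by
  simp [planeRot, Matrix.transpose_add, Matrix.transpose_smul, Matrix.transpose_mul,
    skewGen_transpose]

theorem planeRot_mem (p q : n) (t : ℝ) :
    planeRot p q t ∈ Matrix.specialOrthogonalGroup n ℝ := by
  have h : ∀ t, planeRot p q t * (planeRot p q t)ᵀ = 1 := fun t => by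
    rw [planeRot_transpose, ← planeRot_add, add_neg_cancel, planeRot_zero]
  refine Matrix.mem_specialOrthogonalGroup_iff.mpr
    ⟨(Matrix.mem_orthogonalGroup_iff _ _).mpr (h t), ?_⟩
  have h2 := congrArg Matrix.det (h (t / 2))
  rw [Matrix.det_mul, Matrix.det_transpose, Matrix.det_one] at h2
  rw [← add_halves t, planeRot_add, Matrix.det_mul, h2]

/-- Entrywise differentiability at the origin of a curve of matrices. -/
def MatDeriv (f : ℝ → Matrix n n ℝ) (f' : Matrix n n ℝ) : Prop :=
  ∀ i j, HasDerivAt (fun t => f t i j) (f' i j) 0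

theorem MatDeriv.mul {f g : ℝ → Matrix n n ℝ} {f' g' : Matrix n n ℝ} (hf : MatDeriv f f')
    (hg : MatDeriv g g') : MatDeriv (fun t => f t * g t) (f' * g 0 + f 0 * g') := by
  intro i j
  simp only [Matrix.mul_apply, Matrix.add_apply, ← Finset.sum_add_distrib]
  exact HasDerivAt.fun_sum fun l _ => (hf i l).mul (hg l j)

theorem matDeriv_const (B : Matrix n n ℝ) : MatDeriv (fun _ => B) 0 := fun _ _ =>
  hasDerivAt_const _ _

theorem MatDeriv.trace {f : ℝ → Matrix n n ℝ} {f' : Matrix n n ℝ} (hf : MatDeriv f f') :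
    HasDerivAt (fun t => (f t).trace) f'.trace 0 :=
  HasDerivAt.fun_sum fun i _ => hf i i

theorem matDeriv_planeRot (p q : n) : MatDeriv (planeRot p q) (skewGen p q) := by
  intro i j
  have h := ((((Real.hasDerivAt_sin 0).mul_const (skewGen p q i j)).const_add
    ((1 : Matrix n n ℝ) i j)).add (((Real.hasDerivAt_cos 0).const_sub 1).mul_const
      ((skewGen p q * skewGen p q) i j)))
  simp only [Real.cos_zero, Real.sin_zero, one_mul, neg_zero, zero_mul, add_zero] at h
  exact h

theorem matDeriv_planeRot_mul_pow (p q : n) (A : Matrix n n ℝ) (k : ℕ) :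
    MatDeriv (fun t => (planeRot p q t * A) ^ k)
      (∑ i ∈ Finset.range k, A ^ i * skewGen p q * A ^ (k - i)) := by
  induction k with
  | zero => simpa using matDeriv_const 1
  | succ k ih =>
    have h := ih.mul ((matDeriv_planeRot p q).mul (matDeriv_const A))
    simp only [← pow_succ] at h
    convert! h using 1
    rw [Finset.sum_range_succ, planeRot_zero, Finset.sum_mul]
    congr 1
    · refine Finset.sum_congr rfl fun i hi => ?_
      rw [Nat.succ_sub (Finset.mem_range.mp hi).le, pow_succ]
      simp [mul_assoc]
    · simp [mul_assoc]

/-- The sum of the products of the traces of the powers `s j`, `j ∈ S`. -/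
def powTraceProd (S : Finset ℕ) (s : ℕ → ℕ) (A : Matrix n n ℝ) : ℝ := ∏ j ∈ S, (A ^ s j).trace

/-- The derivative at the origin of a trace polynomial along a rotation of a plane. -/
def loopDeriv (S : Finset ℕ) (s : ℕ → ℕ) (k : ℕ) (p q : n) (A : Matrix n n ℝ) : ℝ :=
  (∑ j ∈ S, powTraceProd (S.erase j) s A * (s j * (skewGen p q * A ^ s j).trace))
      * (skewGen p q * A ^ k).trace
    + powTraceProd S s A
      * ∑ i ∈ Finset.range k, (skewGen p q * A ^ i * skewGen p q * A ^ (k - i)).trace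

theorem hasDerivAt_loop (S : Finset ℕ) (s : ℕ → ℕ) (k : ℕ) (p q : n) (A : Matrix n n ℝ) :
    HasDerivAt (fun t => powTraceProd S s (planeRot p q t * A)
      * (skewGen p q * (planeRot p q t * A) ^ k).trace) (loopDeriv S s k p q A) 0 := by
  have h1 : ∀ m : ℕ, HasDerivAt (fun t => ((planeRot p q t * A) ^ m).trace)
      (m * (skewGen p q * A ^ m).trace) 0 := fun m => by
    convert! (matDeriv_planeRot_mul_pow p q A m).trace using 1
    rw [Matrix.trace_sum, Finset.sum_congr rfl (g := fun _ => (skewGen p q * A ^ m).trace)]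
    · simp
    · intro i hi
      rw [Matrix.trace_mul_cycle, ← pow_add, Nat.sub_add_cancel (Finset.mem_range.mp hi).le,
        Matrix.trace_mul_comm]
  have h2 := ((matDeriv_const (skewGen p q)).mul (matDeriv_planeRot_mul_pow p q A k)).trace
  have h3 := HasDerivAt.fun_finsetProd (u := S) fun j _ => h1 (s j)
  convert! h3.mul h2 using 1
  simp only [loopDeriv, powTraceProd, planeRot_zero, one_mul, zero_mul, zero_add, smul_eq_mul,
    Finset.mul_sum, Matrix.trace_sum, mul_assoc]

theorem trace_skewGen_mul (p q : n) (B : Matrix n n ℝ) :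
    (skewGen p q * B).trace = B q p - B p q := by
  simp [skewGen, sub_mul, Matrix.trace_sub, Matrix.trace_single_mul]

theorem trace_skewGen_mul_mul (p q : n) (B C : Matrix n n ℝ) :
    (skewGen p q * B * skewGen p q * C).trace
      = B q p * C q p - B q q * C p p - B p p * C q q + B p q * C p q := by
  have h : ∀ a b c d : n, (Matrix.single a b 1 * B * Matrix.single c d 1 * C).trace
      = B b c * C d a := fun a b c d => by
    rw [Matrix.single_mul_mul_single, Matrix.trace_single_mul]; simp
  simp only [skewGen, sub_mul, mul_sub, Matrix.trace_sub, h]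
  ring

theorem sum_trace_skewGen_mul (B C : Matrix n n ℝ) :
    ∑ p, ∑ q, (skewGen p q * B).trace * (skewGen p q * C).trace
      = 2 * ((B * Cᵀ).trace - (B * C).trace) := by
  have h1 : (B * Cᵀ).trace = ∑ p, ∑ q, B p q * C p q := by
    simp [Matrix.trace, Matrix.mul_apply]
  have h2 : (B * C).trace = ∑ p, ∑ q, B p q * C q p := by
    simp [Matrix.trace, Matrix.mul_apply]
  have h3 : ∑ p, ∑ q, B q p * C q p = ∑ p, ∑ q, B p q * C p q := Finset.sum_comm
  have h4 : ∑ p, ∑ q, B q p * C p q = ∑ p, ∑ q, B p q * C q p := Finset.sum_comm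
  simp only [trace_skewGen_mul, sub_mul, mul_sub, Finset.sum_sub_distrib, h1, h2]
  rw [h3, h4]; ring

theorem sum_trace_skewGen_mul_mul (B C : Matrix n n ℝ) :
    ∑ p, ∑ q, (skewGen p q * B * skewGen p q * C).trace
      = 2 * ((B * Cᵀ).trace - B.trace * C.trace) := by
  have h1 : (B * Cᵀ).trace = ∑ p, ∑ q, B p q * C p q := by
    simp [Matrix.trace, Matrix.mul_apply]
  have h2 : B.trace * C.trace = ∑ p, ∑ q, B p p * C q q := by
    simp [Matrix.trace, Finset.sum_mul_sum]
  have h3 : ∑ p, ∑ q, B q p * C q p = ∑ p, ∑ q, B p q * C p q := Finset.sum_comm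
  have h4 : ∑ p, ∑ q, B q q * C p p = ∑ p, ∑ q, B p p * C q q := Finset.sum_comm
  simp only [trace_skewGen_mul_mul, Finset.sum_sub_distrib, Finset.sum_add_distrib, h1, h2]
  rw [h3, h4]; ring

theorem trace_pow_mul_transpose_pow {A : Matrix n n ℝ}
    (hA : A ∈ Matrix.specialOrthogonalGroup n ℝ) (k l : ℕ) :
    (A ^ k * (A ^ l)ᵀ).trace = (A ^ (k - l : ℤ).natAbs).trace := by
  have h1 : ∀ l, A ^ l * (A ^ l)ᵀ = 1 := fun l =>
    (Matrix.mem_orthogonalGroup_iff _ _).mp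
      (Matrix.mem_specialOrthogonalGroup_iff.mp (pow_mem hA l)).1
  rcases le_total l k with h | h
  · obtain ⟨d, rfl⟩ := Nat.exists_eq_add_of_le h
    rw [add_comm l d, pow_add, mul_assoc, h1, mul_one]
    congr 2; omega
  · obtain ⟨d, rfl⟩ := Nat.exists_eq_add_of_le h
    rw [add_comm k d, pow_add, Matrix.transpose_mul, ← mul_assoc, h1, one_mul,
      Matrix.trace_transpose]
    congr 2; omega

end Rotations

theorem sum_loopDeriv {N : ℕ} {A : Matrix (Fin (2 * N)) (Fin (2 * N)) ℝ}
    (hA : A ∈ Matrix.specialOrthogonalGroup (Fin (2 * N)) ℝ) {θ : Tor N}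
    (hθ : ∀ k : ℕ, (A ^ k).trace = TT N k θ) (S : Finset ℕ) (s : ℕ → ℕ) (k : ℕ) :
    k * ∑ p, ∑ q, loopDeriv S s k p q A = 2 * loopC N S s k θ := by
  have hprod : ∀ S, powTraceProd S s A = traceProd N S s θ := fun S => by
    simp [powTraceProd, traceProd, hθ]
  have e1 : ∑ p, ∑ q, loopDeriv S s k p q A
      = ∑ j ∈ S, traceProd N (S.erase j) s θ * (s j * ∑ p, ∑ q, (skewGen p q * A ^ s j).trace
          * (skewGen p q * A ^ k).trace)
        + traceProd N S s θ * ∑ i ∈ Finset.range k,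
          ∑ p, ∑ q, (skewGen p q * A ^ i * skewGen p q * A ^ (k - i)).trace := by
    simp only [loopDeriv, hprod, Finset.sum_add_distrib, Finset.sum_mul, Finset.mul_sum]
    simp only [mul_assoc]
    congr 1
    · exact (Finset.sum_congr rfl fun _ _ => Finset.sum_comm).trans Finset.sum_comm
    · exact (Finset.sum_congr rfl fun _ _ => Finset.sum_comm).trans Finset.sum_comm
  rw [e1]
  simp only [sum_trace_skewGen_mul, sum_trace_skewGen_mul_mul, trace_pow_mul_transpose_pow hA,
    ← pow_add, hθ, loopC, bb, gam]
  simp only [ContinuousMap.add_apply, ContinuousMap.mul_apply, ContinuousMap.sum_apply,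
    ContinuousMap.smul_apply, ContinuousMap.sub_apply, smul_eq_mul]
  rw [mul_add, mul_add, add_comm]
  congr 1
  · have h : ∀ i ∈ Finset.range k, (2 * (TT N (i - (k - i : ℕ) : ℤ).natAbs θ
        - TT N i θ * TT N (k - i) θ)) = 2 * (TT N (k - 2 * i : ℤ).natAbs θ
        - TT N i θ * TT N (k - i) θ) := fun i hi => by
      have := Finset.mem_range.mp hi
      rw [show (i - (k - i : ℕ) : ℤ).natAbs = (k - 2 * i : ℤ).natAbs by omega]
    rw [Finset.sum_congr rfl h, ← Finset.mul_sum]; ring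
  · simp only [Finset.mul_sum]
    refine Finset.sum_congr rfl fun j _ => ?_
    ring

section Haar

instance matrixBorelSpace {m n : Type*} [Fintype m] [Fintype n] : BorelSpace (Matrix m n ℝ) :=
  show BorelSpace (m → n → ℝ) from inferInstance

variable {N : ℕ} {μ : Measure (Matrix (Fin (2 * N)) (Fin (2 * N)) ℝ)}

theorem abs_apply_le_one {n : Type*} [Fintype n] [DecidableEq n] {A : Matrix n n ℝ}
    (hA : A ∈ Matrix.specialOrthogonalGroup n ℝ) (i j : n) : |A i j| ≤ 1 := by
  have h := (Matrix.mem_orthogonalGroup_iff _ _).mp (Matrix.mem_specialOrthogonalGroup_iff.mp hA).1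
  have h2 := congrFun (congrFun h i) i
  rw [Matrix.mul_apply, Matrix.one_apply_eq] at h2
  have h3 : A i j * A i j ≤ ∑ l, A i l * Aᵀ l i :=
    Finset.single_le_sum (f := fun l => A i l * Aᵀ l i) (fun l _ => mul_self_nonneg (A i l))
      (Finset.mem_univ j)
  rw [h2] at h3
  exact abs_le_one_iff_mul_self_le_one.mpr h3

theorem exists_bound_of_continuous {n : Type*} [Fintype n] [DecidableEq n]
    {f : Matrix n n ℝ → ℝ} (hf : Continuous f) :
    ∃ C, ∀ A ∈ Matrix.specialOrthogonalGroup n ℝ, |f A| ≤ C := by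
  have hK : IsCompact (Set.univ.pi fun _ => Set.univ.pi fun _ => Set.Icc (-1) 1 :
      Set (n → n → ℝ)) := isCompact_univ_pi fun _ => isCompact_univ_pi fun _ => isCompact_Icc
  obtain ⟨C, hC⟩ := hK.exists_bound_of_continuousOn (f := f) (Continuous.continuousOn hf)
  exact ⟨C, fun A hA => hC A fun i _ j _ => abs_le.mp (abs_apply_le_one hA i j)⟩

theorem ae_mem_of_measure_eq_one [IsProbabilityMeasure μ]
    (h1 : μ {A | A ∈ Matrix.specialOrthogonalGroup (Fin (2 * N)) ℝ} = 1) :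
    ∀ᵐ A ∂μ, A ∈ Matrix.specialOrthogonalGroup (Fin (2 * N)) ℝ := by
  have hcl : IsClosed {A : Matrix (Fin (2 * N)) (Fin (2 * N)) ℝ |
      A ∈ Matrix.specialOrthogonalGroup (Fin (2 * N)) ℝ} := by
    have : {A : Matrix (Fin (2 * N)) (Fin (2 * N)) ℝ |
        A ∈ Matrix.specialOrthogonalGroup (Fin (2 * N)) ℝ} = {A | A * Aᵀ = 1} ∩ {A | A.det = 1} := by
      ext A
      exact (Matrix.mem_specialOrthogonalGroup_iff).trans
        (and_congr_left fun _ => Matrix.mem_orthogonalGroup_iff _ _)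
    rw [this]
    exact (isClosed_eq (by fun_prop) continuous_const).inter
      (isClosed_eq (by fun_prop) continuous_const)
  exact (prob_compl_eq_zero_iff hcl.measurableSet).mpr h1

theorem integrable_of_continuous [IsProbabilityMeasure μ]
    (h1 : ∀ᵐ A ∂μ, A ∈ Matrix.specialOrthogonalGroup (Fin (2 * N)) ℝ)
    {f : Matrix (Fin (2 * N)) (Fin (2 * N)) ℝ → ℝ} (hf : Continuous f) : Integrable f μ := by
  obtain ⟨C, hC⟩ := exists_bound_of_continuous hf
  exact Integrable.of_bound hf.measurable.aestronglyMeasurable C (h1.mono hC)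

theorem continuous_powTraceProd {n : Type*} [Fintype n] [DecidableEq n] (S : Finset ℕ)
    (s : ℕ → ℕ) : Continuous (powTraceProd S s : Matrix n n ℝ → ℝ) :=
  continuous_finsetProd _ fun j _ => by fun_prop

theorem continuous_loopDeriv {n : Type*} [Fintype n] [DecidableEq n] (S : Finset ℕ)
    (s : ℕ → ℕ) (k : ℕ) (p q : n) : Continuous (loopDeriv S s k p q) := by
  have := fun S => continuous_powTraceProd (n := n) S s
  unfold loopDeriv
  fun_prop

theorem integral_loopDeriv [IsProbabilityMeasure μ]
    (h1 : ∀ᵐ A ∂μ, A ∈ Matrix.specialOrthogonalGroup (Fin (2 * N)) ℝ)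
    (hinv : ∀ g ∈ Matrix.specialOrthogonalGroup (Fin (2 * N)) ℝ, μ.map (fun A => g * A) = μ)
    (S : Finset ℕ) (s : ℕ → ℕ) (k : ℕ) (p q : Fin (2 * N)) :
    ∫ A, loopDeriv S s k p q A ∂μ = 0 := by
  obtain ⟨C, hC⟩ := exists_bound_of_continuous (continuous_loopDeriv S s k p q)
  have hG : Continuous fun A : Matrix (Fin (2 * N)) (Fin (2 * N)) ℝ =>
      powTraceProd S s A * (skewGen p q * A ^ k).trace := by
    have := continuous_powTraceProd (n := Fin (2 * N)) S s
    fun_prop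
  refine integral_eq_zero_of_flow (R := fun t A => planeRot p q t * A)
    (S := {A | A ∈ Matrix.specialOrthogonalGroup (Fin (2 * N)) ℝ})
    (fun t => ⟨Continuous.measurable (by fun_prop), hinv _ (planeRot_mem p q t)⟩)
    (fun s t A => by rw [planeRot_add, mul_assoc]) hG.measurable
    (continuous_loopDeriv S s k p q).measurable (integrable_of_continuous h1 hG)
    (fun A => hasDerivAt_loop S s k p q A) h1 (fun t A hA => mul_mem (planeRot_mem p q t) hA) hC

/-- A choice of eigenangles. -/
def eigenangles (A : Matrix (Fin (2 * N)) (Fin (2 * N)) ℝ) : Tor N :=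
  open Classical in
  if h : A ∈ Matrix.specialOrthogonalGroup (Fin (2 * N)) ℝ then (exists_eigenangles h).choose else 0

theorem trace_pow_eq {A : Matrix (Fin (2 * N)) (Fin (2 * N)) ℝ}
    (hA : A ∈ Matrix.specialOrthogonalGroup (Fin (2 * N)) ℝ) (k : ℕ) :
    (A ^ k).trace = TT N k (eigenangles A) := by
  rw [eigenangles, dif_pos hA]
  exact (exists_eigenangles hA).choose_spec k

theorem exists_continuous_eq {d : ℕ} {f : C(Tor N, ℝ)} (hf : f ∈ traceSpan N d) :
    ∃ g : Matrix (Fin (2 * N)) (Fin (2 * N)) ℝ → ℝ, Continuous g ∧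
      ∀ A ∈ Matrix.specialOrthogonalGroup (Fin (2 * N)) ℝ, f (eigenangles A) = g A := by
  induction hf using Submodule.span_induction with
  | mem f hf =>
    obtain ⟨m, -, rfl⟩ := hf
    obtain ⟨S, s, -, h⟩ := exists_traceProd (N := N) m
    refine ⟨powTraceProd S s, continuous_powTraceProd S s, fun A hA => ?_⟩
    rw [h]
    simp [traceProd, powTraceProd, trace_pow_eq hA]
  | zero => exact ⟨0, continuous_zero, fun _ _ => rfl⟩
  | add f g _ _ hf hg =>
    obtain ⟨f', hf', hf⟩ := hf
    obtain ⟨g', hg', hg⟩ := hg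
    exact ⟨_, hf'.add hg', fun A hA => congrArg₂ (· + ·) (hf A hA) (hg A hA)⟩
  | smul c f _ hf =>
    obtain ⟨f', hf', hf⟩ := hf
    exact ⟨_, hf'.const_smul c, fun A hA => congrArg (c * ·) (hf A hA)⟩

theorem integrable_eigenangles [IsProbabilityMeasure μ]
    (h1 : ∀ᵐ A ∂μ, A ∈ Matrix.specialOrthogonalGroup (Fin (2 * N)) ℝ)
    {d : ℕ} {f : C(Tor N, ℝ)} (hf : f ∈ traceSpan N d) :
    Integrable (fun A => f (eigenangles A)) μ := by
  obtain ⟨g, hg, h⟩ := exists_continuous_eq hf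
  exact (integrable_of_continuous h1 hg).congr (h1.mono fun A hA => (h A hA).symm)

theorem integral_loopC_eigenangles [IsProbabilityMeasure μ]
    (h1 : ∀ᵐ A ∂μ, A ∈ Matrix.specialOrthogonalGroup (Fin (2 * N)) ℝ)
    (hinv : ∀ g ∈ Matrix.specialOrthogonalGroup (Fin (2 * N)) ℝ, μ.map (fun A => g * A) = μ)
    (S : Finset ℕ) (s : ℕ → ℕ) (k : ℕ) :
    ∫ A, loopC N S s k (eigenangles A) ∂μ = 0 := by
  have h : (fun A => loopC N S s k (eigenangles A)) =ᵐ[μ]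
      fun A => (k / 2 : ℝ) * ∑ p, ∑ q, loopDeriv S s k p q A := h1.mono fun A hA => by
    have := sum_loopDeriv hA (trace_pow_eq hA) S s k
    simp only
    linarith
  have hi := fun p q : Fin (2 * N) =>
    integrable_of_continuous h1 (continuous_loopDeriv S s k p q)
  rw [integral_congr_ae h, integral_const_mul,
    integral_finsetSum _ fun p _ => integrable_finsetSum _ fun q _ => hi p q]
  simp only [integral_finsetSum _ fun q _ => hi _ q, integral_loopDeriv h1 hinv,
    Finset.sum_const_zero, mul_zero]

/-- Weyl's integration formula for trace polynomials. -/
theorem vint_eq_integral [IsProbabilityMeasure μ]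
    (h1 : ∀ᵐ A ∂μ, A ∈ Matrix.specialOrthogonalGroup (Fin (2 * N)) ℝ)
    (hinv : ∀ g ∈ Matrix.specialOrthogonalGroup (Fin (2 * N)) ℝ, μ.map (fun A => g * A) = μ)
    {d : ℕ} {F : C(Tor N, ℝ)} (hF : F ∈ traceSpan N d) :
    vint N F = (∫ A, F (eigenangles A) ∂μ) * vint N 1 :=
  vint_eq_of_loop (L := fun F => ∫ A, F (eigenangles A) ∂μ)
    (fun _ _ hf _ hg => integral_add (integrable_eigenangles h1 hf) (integrable_eigenangles h1 hg))
    (fun _ _ _ _ => integral_const_mul _ _) (integral_loopC_eigenangles h1 hinv) (by simp) hF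

theorem integral_mul_slater_sq [IsProbabilityMeasure μ]
    (h1 : ∀ᵐ A ∂μ, A ∈ Matrix.specialOrthogonalGroup (Fin (2 * N)) ℝ)
    (hinv : ∀ g ∈ Matrix.specialOrthogonalGroup (Fin (2 * N)) ℝ, μ.map (fun A => g * A) = μ)
    {d : ℕ} {F : C(Tor N, ℝ)} (hF : F ∈ traceSpan N d) :
    ∫ θ, F θ * slater θ (modes N) ^ 2 ∂torM N = N.factorial * ∫ A, F (eigenangles A) ∂μ := by
  obtain ⟨c, -, hs⟩ := exists_slater_eq N
  have h : ∀ F : C(Tor N, ℝ), ∫ θ, F θ * slater θ (modes N) ^ 2 ∂torM N = c ^ 2 * vint N F :=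
    fun F => by
      refine Eq.trans ?_ (integral_const_mul (c ^ 2) fun θ => (F * vdm N ^ 2) θ)
      refine integral_congr_ae (.of_forall fun θ => ?_)
      simp only [hs, ContinuousMap.mul_apply, ContinuousMap.pow_apply]
      ring
  have e1 := integral_slater_sq angM (ip_modes N)
  have e2 := h 1
  simp only [ContinuousMap.one_apply, one_mul, sq] at e2
  rw [h F, vint_eq_integral h1 hinv hF, ← e1, e2]
  ring

theorem integral_trace_sq [IsProbabilityMeasure μ]
    (h1 : ∀ᵐ A ∂μ, A ∈ Matrix.specialOrthogonalGroup (Fin (2 * N)) ℝ)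
    (hinv : ∀ g ∈ Matrix.specialOrthogonalGroup (Fin (2 * N)) ℝ, μ.map (fun A => g * A) = μ)
    (k : ℕ) : ∫ A, ((A ^ k).trace) ^ 2 ∂μ = trSq N k := by
  have hF : TT N k * TT N k ∈ traceSpan N (k + k) :=
    mul_mem_traceSpan (TT_mem_traceSpan k) (TT_mem_traceSpan k)
  have h := integral_mul_slater_sq h1 hinv hF
  have e2 := integral_sq_mul_slater_sq angM (ip_modes N) (fC k)
  simp only [ContinuousMap.mul_apply, TT_apply] at h
  simp only [← sq] at h
  rw [e2] at h
  have := mul_left_cancel₀ (Nat.cast_ne_zero.mpr N.factorial_ne_zero) h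
  rw [trSq, this]
  refine integral_congr_ae (h1.mono fun A hA => ?_)
  simp only [trace_pow_eq hA, TT_apply]

theorem integral_trace_sq_mul_trace_sq [IsProbabilityMeasure μ]
    (h1 : ∀ᵐ A ∂μ, A ∈ Matrix.specialOrthogonalGroup (Fin (2 * N)) ℝ)
    (hinv : ∀ g ∈ Matrix.specialOrthogonalGroup (Fin (2 * N)) ℝ, μ.map (fun A => g * A) = μ)
    (k l : ℕ) : ∫ A, ((A ^ k).trace) ^ 2 * ((A ^ l).trace) ^ 2 ∂μ
      = trSq N k * trSq N l + trCov N k l := by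
  have hF : TT N k * TT N k * (TT N l * TT N l) ∈ traceSpan N (k + k + (l + l)) :=
    mul_mem_traceSpan (mul_mem_traceSpan (TT_mem_traceSpan k) (TT_mem_traceSpan k))
      (mul_mem_traceSpan (TT_mem_traceSpan l) (TT_mem_traceSpan l))
  have h := integral_mul_slater_sq h1 hinv hF
  have e2 := integral_sq_mul_sq_mul_slater_sq angM (ip_modes N) (fC k) (fC l)
  simp only [ContinuousMap.mul_apply, TT_apply] at h
  simp only [← sq] at h
  rw [e2] at h
  have := mul_left_cancel₀ (Nat.cast_ne_zero.mpr N.factorial_ne_zero) h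
  rw [trSq, trSq, trCov, this]
  refine integral_congr_ae (h1.mono fun A hA => ?_)
  simp only [trace_pow_eq hA, TT_apply]

end Haar

section Sums

theorem sum_tail_inv_sq_le {c N : ℕ} (hc : 1 ≤ c) (hN : 1 ≤ N) (m : ℕ) :
    ∑ k ∈ Finset.Ico 1 (m + 1), (if N ≤ c * k then ((k : ℝ) ^ 2)⁻¹ else 0) ≤ 2 * c / N := by
  rw [← Finset.sum_filter]
  set a := (N - 1) / c with ha
  have h1 : Finset.filter (fun k => N ≤ c * k) (Finset.Ico 1 (m + 1)) ⊆ Finset.Ioo a (m + 1) := by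
    intro k hk
    rw [Finset.mem_filter, Finset.mem_Ico] at hk
    rw [Finset.mem_Ioo]
    refine ⟨(Nat.div_lt_iff_lt_mul hc).mpr ?_, hk.1.2⟩
    rw [Nat.mul_comm]; omega
  refine (Finset.sum_le_sum_of_subset_of_nonneg h1 fun _ _ _ => by positivity).trans
    ((sum_Ioo_inv_sq_le a (m + 1)).trans ?_)
  have h2 : N - 1 < c * (a + 1) := Nat.lt_mul_div_succ _ hc
  have h3 : (N : ℝ) ≤ c * (a + 1) := by exact_mod_cast (show N ≤ c * (a + 1) by omega)
  rw [div_le_div_iff₀ (by positivity) (by positivity)]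
  linarith

theorem sum_inv_sq_le (m : ℕ) : ∑ k ∈ Finset.Ico 1 (m + 1), ((k : ℝ) ^ 2)⁻¹ ≤ 2 := by
  have h := sum_tail_inv_sq_le le_rfl le_rfl m
  rw [Finset.sum_congr rfl (g := fun k : ℕ => ((k : ℝ) ^ 2)⁻¹)] at h
  · simpa using h
  · intro k hk
    rw [Finset.mem_Ico] at hk
    rw [if_pos (by omega)]

theorem tendsto_sum_Ico {f : ℕ → ℝ} {s : ℝ} (hf : HasSum f s) (h0 : f 0 = 0) :
    Filter.Tendsto (fun m => ∑ k ∈ Finset.Ico 1 (m + 1), f k) Filter.atTop (nhds s) := by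
  refine ((Filter.tendsto_add_atTop_iff_nat 1).mpr hf.tendsto_sum_nat).congr fun m => ?_
  rw [Finset.sum_range_eq_add_Ico _ m.succ_pos, h0, zero_add]

/-- A majorant for the covariances of the squared traces. -/
def covBound (N k l : ℕ) : ℝ :=
  4000 * (((k : ℝ) ^ 2)⁻¹ * if N ≤ 2 * l then ((l : ℝ) ^ 2)⁻¹ else 0)
    + (if k < N ∧ 2 * N ≤ k + l ∧ l < 2 * N + k then 162 / (k * (N : ℝ) ^ 2) else 0)
    + (if l = 2 * k then 2025 / N * ((k : ℝ) ^ 2)⁻¹ else 0)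
    + 1400 * N * ((if N ≤ 1 * k then ((k : ℝ) ^ 2)⁻¹ else 0)
      * if N ≤ 1 * l then ((l : ℝ) ^ 2)⁻¹ else 0)

theorem covBound_nonneg (N k l : ℕ) : 0 ≤ covBound N k l := by
  unfold covBound
  have h : ∀ (p : Prop) [Decidable p] (x : ℝ), 0 ≤ x → 0 ≤ if p then x else 0 := fun p _ x hx => by
    split_ifs <;> simp [hx]
  have := h (N ≤ 2 * l) ((l : ℝ) ^ 2)⁻¹ (by positivity)
  have := h (k < N ∧ 2 * N ≤ k + l ∧ l < 2 * N + k) (162 / (k * (N : ℝ) ^ 2)) (by positivity)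
  have := h (l = 2 * k) (2025 / N * ((k : ℝ) ^ 2)⁻¹) (by positivity)
  have := h (N ≤ 1 * k) ((k : ℝ) ^ 2)⁻¹ (by positivity)
  have := h (N ≤ 1 * l) ((l : ℝ) ^ 2)⁻¹ (by positivity)
  positivity

theorem abs_trCov_mul_le {N k l : ℕ} (hN : 1 ≤ N) (hk : 1 ≤ k) (hkl : k < l) :
    |trCov N k l * (((k : ℝ) ^ 2)⁻¹ * ((l : ℝ) ^ 2)⁻¹)| ≤ covBound N k l := by
  have hk0 : k ≠ 0 := by omega
  have hu : 0 ≤ ((k : ℝ) ^ 2)⁻¹ * ((l : ℝ) ^ 2)⁻¹ := by positivity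
  have hkR : (1 : ℝ) ≤ k := by exact_mod_cast hk
  have hNR : (1 : ℝ) ≤ N := by exact_mod_cast hN
  rcases Nat.lt_or_ge (k + l) N with h | h
  · rw [trCov_eq_zero hk0 hkl h, zero_mul, abs_zero]
    exact covBound_nonneg N k l
  rw [abs_mul, abs_of_nonneg hu]
  rcases Nat.lt_or_ge k N with hkN | hkN
  · refine (mul_le_mul_of_nonneg_right (abs_trCov_le' hk0 hkl hkN) hu).trans ?_
    rw [covBound, if_pos (show N ≤ 2 * l by omega), add_mul, add_mul]
    have hlast : 0 ≤ 1400 * (N : ℝ) * ((if N ≤ 1 * k then ((k : ℝ) ^ 2)⁻¹ else 0)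
        * if N ≤ 1 * l then ((l : ℝ) ^ 2)⁻¹ else 0) := by
      rw [if_neg (by omega)]; simp
    refine (add_le_add (add_le_add le_rfl ?_) ?_).trans (le_add_of_nonneg_right hlast)
    · by_cases hw : 2 * N ≤ k + l ∧ l < 2 * N + k
      · rw [if_pos hw, if_pos ⟨hkN, hw⟩]
        have hl : (N : ℝ) ≤ l := by exact_mod_cast (show N ≤ l by omega)
        have h1 : ((l : ℝ) ^ 2)⁻¹ ≤ ((N : ℝ) ^ 2)⁻¹ := by gcongr
        calc 162 * (k : ℝ) * (((k : ℝ) ^ 2)⁻¹ * ((l : ℝ) ^ 2)⁻¹)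
            = 162 / k * ((l : ℝ) ^ 2)⁻¹ := by field_simp
          _ ≤ 162 / k * ((N : ℝ) ^ 2)⁻¹ := by gcongr
          _ = _ := by field_simp
      · rw [if_neg hw, if_neg (fun h => hw h.2), zero_mul]
    · by_cases hw : l = 2 * k
      · rw [if_pos hw, if_pos hw]
        have hl : (N : ℝ) ≤ 3 * k := by exact_mod_cast (show N ≤ 3 * k by omega)
        have hlk : (l : ℝ) = 2 * k := by exact_mod_cast hw
        have h1 : (N : ℝ) * ((l : ℝ) ^ 2)⁻¹ ≤ 9 / (4 * N) := by
          rw [hlk, ← div_eq_mul_inv, div_le_div_iff₀ (by positivity) (by positivity)]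
          nlinarith
        calc 900 * (N : ℝ) * (((k : ℝ) ^ 2)⁻¹ * ((l : ℝ) ^ 2)⁻¹)
            = 900 * (N * ((l : ℝ) ^ 2)⁻¹) * ((k : ℝ) ^ 2)⁻¹ := by ring
          _ ≤ 900 * (9 / (4 * N)) * ((k : ℝ) ^ 2)⁻¹ := by gcongr
          _ = _ := by field_simp; norm_num
      · rw [if_neg hw, if_neg hw, zero_mul]
  · refine (mul_le_mul_of_nonneg_right (abs_trCov_le hN hk0 hkl) hu).trans ?_
    rw [covBound, if_pos (show N ≤ 2 * l by omega), if_neg (by omega),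
      if_pos (show N ≤ 1 * k by omega), if_pos (show N ≤ 1 * l by omega)]
    have : 0 ≤ if l = 2 * k then 2025 / N * ((k : ℝ) ^ 2)⁻¹ else 0 := by
      split_ifs <;> positivity
    have : 0 ≤ 4000 * (((k : ℝ) ^ 2)⁻¹ * ((l : ℝ) ^ 2)⁻¹) := by positivity
    linarith

theorem sum_covBound_le {N : ℕ} (hN : 1 ≤ N) (m : ℕ) :
    ∑ k ∈ Finset.Ico 1 (m + 1), ∑ l ∈ Finset.Ico 1 (m + 1), covBound N k l ≤ 41974 / (N : ℝ) := by
  have hNR : (1 : ℝ) ≤ N := by exact_mod_cast hN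
  simp only [covBound, Finset.sum_add_distrib, ← Finset.mul_sum, ← Finset.sum_mul]
  have h1 := sum_tail_inv_sq_le (c := 2) (by norm_num) hN m
  have h2 := sum_tail_inv_sq_le (c := 1) le_rfl hN m
  have h3 := sum_inv_sq_le m
  have p1 : 0 ≤ ∑ k ∈ Finset.Ico 1 (m + 1), (if N ≤ 2 * k then ((k : ℝ) ^ 2)⁻¹ else 0) :=
    Finset.sum_nonneg fun k _ => by split_ifs <;> positivity
  have p2 : 0 ≤ ∑ k ∈ Finset.Ico 1 (m + 1), (if N ≤ 1 * k then ((k : ℝ) ^ 2)⁻¹ else 0) :=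
    Finset.sum_nonneg fun k _ => by split_ifs <;> positivity
  have hB : ∑ k ∈ Finset.Ico 1 (m + 1), ∑ l ∈ Finset.Ico 1 (m + 1),
      (if k < N ∧ 2 * N ≤ k + l ∧ l < 2 * N + k then 162 / (k * (N : ℝ) ^ 2) else 0)
        ≤ 324 / (N : ℝ) := by
    calc _ ≤ ∑ k ∈ Finset.Ico 1 (m + 1), (if k < N then 324 / (N : ℝ) ^ 2 else 0) := by
          refine Finset.sum_le_sum fun k hk => ?_
          have hk1 : (1 : ℝ) ≤ k := by exact_mod_cast (Finset.mem_Ico.mp hk).1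
          by_cases hkN : k < N
          · simp only [hkN, true_and, if_true]
            rw [← Finset.sum_filter, Finset.sum_const, nsmul_eq_mul]
            have hc : (Finset.filter (fun l => 2 * N ≤ k + l ∧ l < 2 * N + k)
                (Finset.Ico 1 (m + 1))).card ≤ 2 * k := by
              refine (Finset.card_le_card (t := Finset.Ico (2 * N - k) (2 * N + k)) ?_).trans ?_
              · intro l hl
                rw [Finset.mem_filter] at hl
                rw [Finset.mem_Ico]; omega
              · rw [Nat.card_Ico]; omega
            have hc' : ((Finset.filter (fun l => 2 * N ≤ k + l ∧ l < 2 * N + k)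
                (Finset.Ico 1 (m + 1))).card : ℝ) ≤ 2 * k := by exact_mod_cast hc
            calc _ ≤ 2 * (k : ℝ) * (162 / (k * (N : ℝ) ^ 2)) := by gcongr
              _ = _ := by field_simp; norm_num
          · simp [hkN]
      _ ≤ N * (324 / (N : ℝ) ^ 2) := by
          rw [← Finset.sum_filter, Finset.sum_const, nsmul_eq_mul]
          have hc : (Finset.filter (fun k => k < N) (Finset.Ico 1 (m + 1))).card ≤ N := by
            refine (Finset.card_le_card (t := Finset.range N) ?_).trans (Finset.card_range N).le
            intro l hl
            exact Finset.mem_range.mpr (Finset.mem_filter.mp hl).2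
          gcongr
      _ = _ := by field_simp
  have hC : ∑ k ∈ Finset.Ico 1 (m + 1), ∑ l ∈ Finset.Ico 1 (m + 1),
      (if l = 2 * k then 2025 / N * ((k : ℝ) ^ 2)⁻¹ else 0) ≤ 4050 / N := by
    calc _ ≤ ∑ k ∈ Finset.Ico 1 (m + 1), 2025 / N * ((k : ℝ) ^ 2)⁻¹ := by
          refine Finset.sum_le_sum fun k hk => ?_
          rw [Finset.sum_ite_eq']
          split_ifs <;> first | exact le_rfl | positivity
      _ ≤ 2025 / N * 2 := by rw [← Finset.mul_sum]; gcongr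
      _ = _ := by ring
  have hA : 4000 * ((∑ k ∈ Finset.Ico 1 (m + 1), ((k : ℝ) ^ 2)⁻¹)
      * ∑ k ∈ Finset.Ico 1 (m + 1), (if N ≤ 2 * k then ((k : ℝ) ^ 2)⁻¹ else 0)) ≤ 32000 / N := by
    calc _ ≤ 4000 * (2 * (2 * (2 : ℕ) / (N : ℝ))) := by gcongr
      _ = _ := by push_cast; ring
  have hD : 1400 * (N : ℝ) * ((∑ k ∈ Finset.Ico 1 (m + 1),
      (if N ≤ 1 * k then ((k : ℝ) ^ 2)⁻¹ else 0))
      * ∑ k ∈ Finset.Ico 1 (m + 1), (if N ≤ 1 * k then ((k : ℝ) ^ 2)⁻¹ else 0)) ≤ 5600 / N := by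
    calc _ ≤ 1400 * (N : ℝ) * ((2 * (1 : ℕ) / (N : ℝ)) * (2 * (1 : ℕ) / (N : ℝ))) := by gcongr
      _ = _ := by field_simp; norm_num
  have e : (41974 : ℝ) / N = 32000 / N + 324 / N + 4050 / N + 5600 / N := by ring
  rw [e]
  exact add_le_add (add_le_add (add_le_add hA hB) hC) hD

/-- The limiting variance of the squared `k`-th trace. -/
def diagVar (k : ℕ) : ℝ := 2 * (k : ℝ) ^ 2 + 4 * k * if Even k then 1 else 0

theorem abs_trCov_self_sub_le {N k : ℕ} (hN : 1 ≤ N) (hk : 1 ≤ k) :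
    |(trCov N k k - diagVar k) * (((k : ℝ) ^ 2)⁻¹ * ((k : ℝ) ^ 2)⁻¹)|
      ≤ 20806 * if N ≤ 4 * k then ((k : ℝ) ^ 2)⁻¹ else 0 := by
  have hk0 : k ≠ 0 := by omega
  have hkR : (1 : ℝ) ≤ k := by exact_mod_cast hk
  rcases Nat.lt_or_ge (4 * k) N with h | h
  · rw [trCov_self hk0 h, diagVar, sub_self, zero_mul, abs_zero, if_neg (by omega), mul_zero]
  · rw [if_pos h]
    have h1 := abs_trCov_self_le hN hk0
    have h2 : |diagVar k| ≤ 6 * (k : ℝ) ^ 2 := by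
      rw [diagVar, abs_of_nonneg (by split_ifs <;> positivity)]
      split_ifs <;> nlinarith
    have h3 : (N : ℝ) ≤ 4 * k := by exact_mod_cast h
    have h4 : |trCov N k k - diagVar k| ≤ 20806 * (k : ℝ) ^ 2 := by
      have := abs_sub (trCov N k k) (diagVar k)
      nlinarith
    rw [abs_mul, abs_of_nonneg (by positivity : 0 ≤ ((k : ℝ) ^ 2)⁻¹ * ((k : ℝ) ^ 2)⁻¹)]
    calc _ ≤ 20806 * (k : ℝ) ^ 2 * (((k : ℝ) ^ 2)⁻¹ * ((k : ℝ) ^ 2)⁻¹) := by gcongr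
      _ = _ := by field_simp

theorem abs_sum_trCov_sub_le {N : ℕ} (hN : 1 ≤ N) (m : ℕ) :
    |∑ k ∈ Finset.Ico 1 (m + 1), ∑ l ∈ Finset.Ico 1 (m + 1),
        trCov N k l * (((k : ℝ) ^ 2)⁻¹ * ((l : ℝ) ^ 2)⁻¹)
      - ∑ k ∈ Finset.Ico 1 (m + 1), diagVar k * (((k : ℝ) ^ 2)⁻¹ * ((k : ℝ) ^ 2)⁻¹)|
      ≤ 250396 / N := by
  have e1 : ∑ k ∈ Finset.Ico 1 (m + 1), diagVar k * (((k : ℝ) ^ 2)⁻¹ * ((k : ℝ) ^ 2)⁻¹)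
      = ∑ k ∈ Finset.Ico 1 (m + 1), ∑ l ∈ Finset.Ico 1 (m + 1),
        if k = l then diagVar k * (((k : ℝ) ^ 2)⁻¹ * ((l : ℝ) ^ 2)⁻¹) else 0 := by
    refine Finset.sum_congr rfl fun k hk => ?_
    rw [Finset.sum_ite_eq, if_pos hk]
  have hpt : ∀ k ∈ Finset.Ico 1 (m + 1), ∀ l ∈ Finset.Ico 1 (m + 1),
      |trCov N k l * (((k : ℝ) ^ 2)⁻¹ * ((l : ℝ) ^ 2)⁻¹)
        - if k = l then diagVar k * (((k : ℝ) ^ 2)⁻¹ * ((l : ℝ) ^ 2)⁻¹) else 0|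
      ≤ covBound N k l + covBound N l k
        + if k = l then 20806 * (if N ≤ 4 * k then ((k : ℝ) ^ 2)⁻¹ else 0) else 0 := by
    intro k hk l hl
    have hk1 := (Finset.mem_Ico.mp hk).1
    have hl1 := (Finset.mem_Ico.mp hl).1
    have c1 := covBound_nonneg N k l
    have c2 := covBound_nonneg N l k
    rcases lt_trichotomy k l with h | rfl | h
    · rw [if_neg h.ne, if_neg h.ne, sub_zero]
      have := abs_trCov_mul_le hN hk1 h
      linarith
    · rw [if_pos rfl, if_pos rfl, ← sub_mul]
      have := abs_trCov_self_sub_le hN hk1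
      linarith
    · rw [if_neg h.ne', if_neg h.ne', sub_zero, trCov_symm, mul_comm (((k : ℝ) ^ 2)⁻¹)]
      have := abs_trCov_mul_le hN hl1 h
      linarith
  rw [e1]
  simp only [← Finset.sum_sub_distrib]
  refine (Finset.abs_sum_le_sum_abs _ _).trans ((Finset.sum_le_sum fun k hk =>
    (Finset.abs_sum_le_sum_abs _ _).trans (Finset.sum_le_sum (hpt k hk))).trans ?_)
  simp only [Finset.sum_add_distrib]
  have s1 := sum_covBound_le hN m
  have s2 : ∑ k ∈ Finset.Ico 1 (m + 1), ∑ l ∈ Finset.Ico 1 (m + 1), covBound N l k ≤ 41974 / N := by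
    rw [Finset.sum_comm]; exact s1
  have s3 : ∑ k ∈ Finset.Ico 1 (m + 1), ∑ l ∈ Finset.Ico 1 (m + 1),
      (if k = l then 20806 * (if N ≤ 4 * k then ((k : ℝ) ^ 2)⁻¹ else 0) else 0)
      ≤ 166448 / N := by
    have h4 := sum_tail_inv_sq_le (c := 4) (by norm_num) hN m
    calc _ = ∑ k ∈ Finset.Ico 1 (m + 1), 20806 * (if N ≤ 4 * k then ((k : ℝ) ^ 2)⁻¹ else 0) := by
          refine Finset.sum_congr rfl fun k hk => ?_
          rw [Finset.sum_ite_eq, if_pos hk]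
      _ ≤ 20806 * (2 * (4 : ℕ) / (N : ℝ)) := by rw [← Finset.mul_sum]; gcongr
      _ = _ := by push_cast; ring
  have e : (250396 : ℝ) / N = 41974 / N + 41974 / N + 166448 / N := by ring
  rw [e]
  exact add_le_add (add_le_add s1 s2) s3

end Sums

section Limits

theorem hasSum_ite_even_mul {g : ℕ → ℝ} {s : ℝ} (h : HasSum (fun n => g (2 * n)) s) :
    HasSum (fun k => (if Even k then 1 else 0) * g k) s := by
  have hinj : Function.Injective fun n : ℕ => 2 * n := fun a b hab => by
    simp only at hab; omega
  refine (hinj.hasSum_iff ?_).mp ?_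
  · intro x hx
    rw [if_neg, zero_mul]
    rintro ⟨r, hr⟩
    exact hx ⟨r, by simp only; omega⟩
  · convert h using 2 with n
    simp

theorem hasSum_inv_sq : HasSum (fun k : ℕ => ((k : ℝ) ^ 2)⁻¹) (Real.pi ^ 2 / 6) := by
  simpa only [one_div] using hasSum_zeta_two

theorem hasSum_inv_cube : HasSum (fun k : ℕ => ((k : ℝ) ^ 3)⁻¹) (riemannZeta 3).re := by
  have h := zeta_nat_eq_tsum_of_gt_one (k := 3) (by norm_num)
  have hs : Summable fun k : ℕ => ((k : ℝ) ^ 3)⁻¹ := Real.summable_nat_pow_inv.mpr (by norm_num)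
  have e : riemannZeta 3 = ((∑' k : ℕ, ((k : ℝ) ^ 3)⁻¹ : ℝ) : ℂ) := by
    rw [Complex.ofReal_tsum]
    simpa using h
  rw [e, Complex.ofReal_re]
  exact hs.hasSum

theorem hasSum_even_inv_sq :
    HasSum (fun k : ℕ => (if Even k then 1 else 0) * ((k : ℝ) ^ 2)⁻¹) (Real.pi ^ 2 / 24) := by
  refine hasSum_ite_even_mul (g := fun k : ℕ => ((k : ℝ) ^ 2)⁻¹) ?_
  have h := hasSum_inv_sq.mul_left (1 / 4)
  rw [show 1 / 4 * (Real.pi ^ 2 / 6) = Real.pi ^ 2 / 24 by ring] at h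
  refine h.congr_fun fun n => ?_
  rw [Nat.cast_mul, mul_pow, mul_inv]
  norm_num

theorem hasSum_diagVar :
    HasSum (fun k : ℕ => diagVar k * (((k : ℝ) ^ 2)⁻¹ * ((k : ℝ) ^ 2)⁻¹))
      (Real.pi ^ 2 / 3 + (riemannZeta 3).re / 2) := by
  have h := hasSum_ite_even_mul (g := fun k : ℕ => ((k : ℝ) ^ 3)⁻¹)
    (s := (riemannZeta 3).re / 8) (by
      rw [div_eq_inv_mul]
      refine (hasSum_inv_cube.mul_left 8⁻¹).congr_fun fun n => ?_
      rw [Nat.cast_mul, mul_pow, mul_inv]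
      norm_num)
  rw [show Real.pi ^ 2 / 3 + (riemannZeta 3).re / 2
    = 2 * (Real.pi ^ 2 / 6) + 4 * ((riemannZeta 3).re / 8) by ring]
  refine ((hasSum_inv_sq.mul_left 2).add (h.mul_left 4)).congr_fun fun k => ?_
  rcases Nat.eq_zero_or_pos k with rfl | hk
  · simp
  · have : (k : ℝ) ≠ 0 := by positivity
    rw [diagVar]
    field_simp

theorem sum_min_mul_inv_sq_bounds {M : ℕ} (hM : 1 ≤ M) {m : ℕ} (hm : M ≤ m) :
    (harmonic M : ℝ) + M / (M + 1) - M / (m + 1)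
        ≤ ∑ k ∈ Finset.Ico 1 (m + 1), ((min k M : ℕ) : ℝ) * ((k : ℝ) ^ 2)⁻¹ ∧
      ∑ k ∈ Finset.Ico 1 (m + 1), ((min k M : ℕ) : ℝ) * ((k : ℝ) ^ 2)⁻¹
        ≤ (harmonic M : ℝ) + 1 - M / m := by
  have hMR : (1 : ℝ) ≤ M := by exact_mod_cast hM
  induction m, hm using Nat.le_induction with
  | base =>
    have e : ∑ k ∈ Finset.Ico 1 (M + 1), ((min k M : ℕ) : ℝ) * ((k : ℝ) ^ 2)⁻¹ = harmonic M := by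
      rw [harmonic_eq_sum_Icc, Rat.cast_sum]
      refine Finset.sum_congr (Finset.ext fun k => by simp) fun k hk => ?_
      rw [Finset.mem_Icc] at hk
      have : (k : ℝ) ≠ 0 := by exact_mod_cast (show k ≠ 0 by omega)
      rw [min_eq_left (show k ≤ M by omega), Rat.cast_inv, Rat.cast_natCast]
      field_simp
    rw [e, div_self (by positivity)]
    constructor <;> linarith
  | succ m hm ih =>
    have hmR : (M : ℝ) ≤ m := by exact_mod_cast hm
    have hm0 : (0 : ℝ) < m := by linarith
    rw [Finset.sum_Ico_succ_top (by omega), min_eq_right (show M ≤ m + 1 by omega), Nat.cast_succ]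
    have h1 : (M : ℝ) * (((m : ℝ) + 1) ^ 2)⁻¹ ≤ M / m - M / (m + 1) := by
      rw [div_sub_div _ _ (by positivity) (by positivity), ← div_eq_mul_inv,
        div_le_div_iff₀ (by positivity) (by positivity)]
      nlinarith [mul_pos (show (0 : ℝ) < M by linarith) hm0]
    have h2 : (M : ℝ) / (m + 1) - M / (m + 1 + 1) ≤ (M : ℝ) * (((m : ℝ) + 1) ^ 2)⁻¹ := by
      rw [div_sub_div _ _ (by positivity) (by positivity), ← div_eq_mul_inv,
        div_le_div_iff₀ (by positivity) (by positivity)]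
      nlinarith [mul_pos (show (0 : ℝ) < M by linarith) hm0]
    constructor <;> linarith [ih.1, ih.2]

theorem abs_sum_min_mul_inv_sq_sub_le {M : ℕ} (hM : 1 ≤ M) {m : ℕ} (hm : M ≤ m) :
    |∑ k ∈ Finset.Ico 1 (m + 1), ((min k M : ℕ) : ℝ) * ((k : ℝ) ^ 2)⁻¹
      - (Real.log M + Real.eulerMascheroniConstant + 1)| ≤ 1 / M + M * (1 / ((m : ℝ) + 1)) := by
  have hMR : (1 : ℝ) ≤ M := by exact_mod_cast hM
  obtain ⟨h1, h2⟩ := sum_min_mul_inv_sq_bounds hM hm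
  have h3 := Real.eulerMascheroniSeq_lt_eulerMascheroniConstant M
  have h4 := Real.eulerMascheroniConstant_lt_eulerMascheroniSeq' M
  rw [Real.eulerMascheroniSeq] at h3
  rw [Real.eulerMascheroniSeq', if_neg (by omega)] at h4
  have h5 : Real.log ((M : ℝ) + 1) - Real.log M ≤ 1 / M := by
    rw [← Real.log_div (by positivity) (by positivity)]
    refine (Real.log_le_sub_one_of_pos (by positivity)).trans (le_of_eq ?_)
    field_simp
    ring
  have h6 : (1 : ℝ) - 1 / M ≤ M / (M + 1) := by
    rw [one_sub_div (by positivity), div_le_div_iff₀ (by positivity) (by positivity)]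
    nlinarith
  have h7 : 0 ≤ (M : ℝ) / m := by positivity
  have h8 : (M : ℝ) / (m + 1) = M * (1 / ((m : ℝ) + 1)) := by ring
  have h9 : 0 ≤ M * (1 / ((m : ℝ) + 1)) := by positivity
  rw [abs_le]
  constructor <;> linarith

theorem abs_trSq_sub_mul_le {N k : ℕ} (hN : 1 ≤ N) (hk : 1 ≤ k) :
    |trSq N k * ((k : ℝ) ^ 2)⁻¹ - (((min k (2 * N) : ℕ) : ℝ) * ((k : ℝ) ^ 2)⁻¹
      + (if Even k then 1 else 0) * ((k : ℝ) ^ 2)⁻¹)|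
      ≤ 3 * if N ≤ 1 * k then ((k : ℝ) ^ 2)⁻¹ else 0 := by
  have hk0 : k ≠ 0 := by omega
  rcases Nat.lt_or_ge k N with h | h
  · rw [trSq_of_lt hk0 h, if_neg (show ¬ N ≤ 1 * k by omega), min_eq_left (by omega)]
    simp [add_mul]
  · rw [if_pos (show N ≤ 1 * k by omega), ← add_mul, ← sub_mul, abs_mul,
      abs_of_nonneg (show 0 ≤ ((k : ℝ) ^ 2)⁻¹ by positivity)]
    have h1 := abs_trSq_sub_le hN hk0 h
    refine mul_le_mul_of_nonneg_right ?_ (by positivity)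
    rw [abs_le] at h1 ⊢
    split_ifs <;> constructor <;> linarith [h1.1, h1.2]

theorem abs_sum_trSq_sub_le {N : ℕ} (hN : 1 ≤ N) {m : ℕ} (hm : 2 * N ≤ m) :
    |∑ k ∈ Finset.Ico 1 (m + 1), trSq N k * ((k : ℝ) ^ 2)⁻¹
      - (∑ k ∈ Finset.Ico 1 (m + 1), (if Even k then 1 else 0) * ((k : ℝ) ^ 2)⁻¹
        + (Real.log (2 * N) + Real.eulerMascheroniConstant + 1))|
      ≤ 7 / N + (2 * N) * (1 / ((m : ℝ) + 1)) := by
  have hNR : (1 : ℝ) ≤ N := by exact_mod_cast hN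
  have h1 := abs_sum_min_mul_inv_sq_sub_le (M := 2 * N) (by omega) hm
  have h2 : |∑ k ∈ Finset.Ico 1 (m + 1), (trSq N k * ((k : ℝ) ^ 2)⁻¹
      - (((min k (2 * N) : ℕ) : ℝ) * ((k : ℝ) ^ 2)⁻¹
      + (if Even k then 1 else 0) * ((k : ℝ) ^ 2)⁻¹))| ≤ 3 * (2 * (1 : ℕ) / (N : ℝ)) := by
    refine (Finset.abs_sum_le_sum_abs _ _).trans ((Finset.sum_le_sum fun k hk =>
      abs_trSq_sub_mul_le hN (Finset.mem_Ico.mp hk).1).trans ?_)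
    rw [← Finset.mul_sum]
    exact mul_le_mul_of_nonneg_left (sum_tail_inv_sq_le le_rfl hN m) (by norm_num)
  rw [Finset.sum_sub_distrib, Finset.sum_add_distrib] at h2
  rw [Nat.cast_mul, Nat.cast_ofNat] at h1
  have h3 : (1 : ℝ) / (2 * N) ≤ 1 / N := by gcongr; linarith
  have h4 : (7 : ℝ) / N = 3 * (2 * (1 : ℕ) / (N : ℝ)) + 1 / N := by push_cast; ring
  rw [h4]
  rw [abs_le] at h1 h2 ⊢
  constructor <;> linarith [h1.1, h1.2, h2.1, h2.2]

end Limits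

section Transport

/-- The partial sums of the series defining `Q`. -/
def partialQ (N m : ℕ) (A : Matrix (Fin (2 * N)) (Fin (2 * N)) ℝ) : ℝ :=
  2 * ∑ k ∈ Finset.Ico 1 (m + 1), ((A ^ k).trace) ^ 2 * ((k : ℝ) ^ 2)⁻¹

theorem continuous_trace_pow (N k : ℕ) :
    Continuous fun A : Matrix (Fin (2 * N)) (Fin (2 * N)) ℝ => (A ^ k).trace :=
  (continuous_id.pow k).matrix_trace

theorem continuous_partialQ (N m : ℕ) : Continuous (partialQ N m) :=
  continuous_const.mul (continuous_finsetSum _ fun k _ =>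
    ((continuous_trace_pow N k).pow 2).mul continuous_const)

variable {N : ℕ}

theorem trace_pow_sq_le {A : Matrix (Fin (2 * N)) (Fin (2 * N)) ℝ}
    (hA : A ∈ Matrix.specialOrthogonalGroup (Fin (2 * N)) ℝ) (k : ℕ) :
    ((A ^ k).trace) ^ 2 ≤ (2 * N) ^ 2 := by
  have h : |(A ^ k).trace| ≤ 2 * N := by
    refine (Finset.abs_sum_le_sum_abs _ _).trans
      ((Finset.sum_le_sum fun i _ => abs_apply_le_one (pow_mem hA k) i i).trans ?_)
    simp
  exact sq_le_sq' (by linarith [neg_abs_le (A ^ k).trace]) ((le_abs_self _).trans h)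

theorem hasSum_half_Q {A : Matrix (Fin (2 * N)) (Fin (2 * N)) ℝ}
    (hA : A ∈ Matrix.specialOrthogonalGroup (Fin (2 * N)) ℝ) :
    HasSum (fun k : ℕ => ((A ^ k).trace) ^ 2 * ((k : ℝ) ^ 2)⁻¹) (Q N A / 2) := by
  have hs : Summable fun k : ℕ => ((A ^ k).trace) ^ 2 * ((k : ℝ) ^ 2)⁻¹ :=
    Summable.of_nonneg_of_le (fun k => by positivity)
      (fun k => mul_le_mul_of_nonneg_right (trace_pow_sq_le hA k) (by positivity))
      (hasSum_inv_sq.mul_left ((2 * (N : ℝ)) ^ 2)).summable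
  convert hs.hasSum using 1
  rw [hs.tsum_eq_zero_add, Q, mul_div_cancel_left₀ _ two_ne_zero]
  simp [div_eq_mul_inv]

theorem tendsto_partialQ {A : Matrix (Fin (2 * N)) (Fin (2 * N)) ℝ}
    (hA : A ∈ Matrix.specialOrthogonalGroup (Fin (2 * N)) ℝ) :
    Filter.Tendsto (fun m => partialQ N m A) Filter.atTop (nhds (Q N A)) := by
  have h := (tendsto_sum_Ico (hasSum_half_Q hA) (by simp)).const_mul 2
  rwa [mul_div_cancel₀ _ two_ne_zero] at h

theorem abs_partialQ_le {A : Matrix (Fin (2 * N)) (Fin (2 * N)) ℝ}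
    (hA : A ∈ Matrix.specialOrthogonalGroup (Fin (2 * N)) ℝ) (m : ℕ) :
    |partialQ N m A| ≤ 2 * ((2 * N) ^ 2 * 2) := by
  rw [partialQ, abs_of_nonneg (by positivity)]
  gcongr
  calc _ ≤ ∑ k ∈ Finset.Ico 1 (m + 1), (2 * (N : ℝ)) ^ 2 * ((k : ℝ) ^ 2)⁻¹ :=
        Finset.sum_le_sum fun k _ =>
          mul_le_mul_of_nonneg_right (trace_pow_sq_le hA k) (by positivity)
    _ ≤ _ := by
        rw [← Finset.mul_sum]
        exact mul_le_mul_of_nonneg_left (sum_inv_sq_le m) (by positivity)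

variable {μ : Measure (Matrix (Fin (2 * N)) (Fin (2 * N)) ℝ)} [IsProbabilityMeasure μ]

theorem integral_partialQ
    (h1 : ∀ᵐ A ∂μ, A ∈ Matrix.specialOrthogonalGroup (Fin (2 * N)) ℝ)
    (hinv : ∀ g ∈ Matrix.specialOrthogonalGroup (Fin (2 * N)) ℝ, μ.map (fun A => g * A) = μ)
    (m : ℕ) :
    ∫ A, partialQ N m A ∂μ
      = 2 * ∑ k ∈ Finset.Ico 1 (m + 1), trSq N k * ((k : ℝ) ^ 2)⁻¹ := by
  simp only [partialQ]
  rw [integral_const_mul, integral_finsetSum]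
  · simp only [integral_mul_const, integral_trace_sq h1 hinv]
  · exact fun k _ => integrable_of_continuous h1
      (((continuous_trace_pow N k).pow 2).mul continuous_const)

theorem integral_partialQ_sq
    (h1 : ∀ᵐ A ∂μ, A ∈ Matrix.specialOrthogonalGroup (Fin (2 * N)) ℝ)
    (hinv : ∀ g ∈ Matrix.specialOrthogonalGroup (Fin (2 * N)) ℝ, μ.map (fun A => g * A) = μ)
    (m : ℕ) :
    ∫ A, partialQ N m A ^ 2 ∂μ - (∫ A, partialQ N m A ∂μ) ^ 2
      = 4 * ∑ k ∈ Finset.Ico 1 (m + 1), ∑ l ∈ Finset.Ico 1 (m + 1),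
        trCov N k l * (((k : ℝ) ^ 2)⁻¹ * ((l : ℝ) ^ 2)⁻¹) := by
  have e : ∀ A, partialQ N m A ^ 2 = 4 * ∑ k ∈ Finset.Ico 1 (m + 1), ∑ l ∈ Finset.Ico 1 (m + 1),
      ((A ^ k).trace) ^ 2 * ((A ^ l).trace) ^ 2 * (((k : ℝ) ^ 2)⁻¹ * ((l : ℝ) ^ 2)⁻¹) := by
    intro A
    rw [partialQ, mul_pow, sq (∑ k ∈ _, _), Finset.sum_mul_sum]
    norm_num
    refine Finset.sum_congr rfl fun k _ => Finset.sum_congr rfl fun l _ => ?_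
    ring
  have h_int : ∀ k l : ℕ, Integrable (fun A : Matrix (Fin (2 * N)) (Fin (2 * N)) ℝ =>
      ((A ^ k).trace) ^ 2 * ((A ^ l).trace) ^ 2 * (((k : ℝ) ^ 2)⁻¹ * ((l : ℝ) ^ 2)⁻¹)) μ :=
    fun k l => integrable_of_continuous h1
      ((((continuous_trace_pow N k).pow 2).mul ((continuous_trace_pow N l).pow 2)).mul
        continuous_const)
  rw [integral_partialQ h1 hinv, mul_pow, sq (∑ k ∈ _, _), Finset.sum_mul_sum]
  simp only [e]
  rw [integral_const_mul, integral_finsetSum _ fun k _ => integrable_finsetSum _ fun l _ => h_int k l]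
  simp_rw [integral_finsetSum _ fun l _ => h_int _ l, integral_mul_const,
    integral_trace_sq_mul_trace_sq h1 hinv]
  rw [show (2 : ℝ) ^ 2 = 4 by norm_num, ← mul_sub]
  simp only [← Finset.sum_sub_distrib]
  congr 1
  refine Finset.sum_congr rfl fun k _ => Finset.sum_congr rfl fun l _ => ?_
  ring

theorem aestronglyMeasurable_Q
    (h1 : ∀ᵐ A ∂μ, A ∈ Matrix.specialOrthogonalGroup (Fin (2 * N)) ℝ) :
    AEStronglyMeasurable (Q N) μ :=
  aestronglyMeasurable_of_tendsto_ae Filter.atTop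
    (fun m => (integrable_of_continuous h1 (continuous_partialQ N m)).aestronglyMeasurable)
    (h1.mono fun _ hA => tendsto_partialQ hA)

theorem memLp_Q (h1 : ∀ᵐ A ∂μ, A ∈ Matrix.specialOrthogonalGroup (Fin (2 * N)) ℝ) :
    MemLp (Q N) 2 μ :=
  MemLp.of_bound (aestronglyMeasurable_Q h1) (2 * ((2 * N) ^ 2 * 2)) (h1.mono fun _ hA =>
    le_of_tendsto (tendsto_partialQ hA).norm (Filter.Eventually.of_forall fun m =>
      abs_partialQ_le hA m))

theorem tendsto_integral_partialQ
    (h1 : ∀ᵐ A ∂μ, A ∈ Matrix.specialOrthogonalGroup (Fin (2 * N)) ℝ) :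
    Filter.Tendsto (fun m => ∫ A, partialQ N m A ∂μ) Filter.atTop (nhds (∫ A, Q N A ∂μ)) :=
  tendsto_integral_of_dominated_convergence (fun _ => 2 * ((2 * (N : ℝ)) ^ 2 * 2))
    (fun m => (integrable_of_continuous h1 (continuous_partialQ N m)).aestronglyMeasurable)
    (integrable_const _) (fun m => h1.mono fun _ hA => abs_partialQ_le hA m)
    (h1.mono fun _ hA => tendsto_partialQ hA)

theorem tendsto_integral_partialQ_sq
    (h1 : ∀ᵐ A ∂μ, A ∈ Matrix.specialOrthogonalGroup (Fin (2 * N)) ℝ) :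
    Filter.Tendsto (fun m => ∫ A, partialQ N m A ^ 2 ∂μ) Filter.atTop
      (nhds (∫ A, Q N A ^ 2 ∂μ)) :=
  tendsto_integral_of_dominated_convergence (fun _ => (2 * ((2 * (N : ℝ)) ^ 2 * 2)) ^ 2)
    (fun m => (integrable_of_continuous h1 ((continuous_partialQ N m).pow 2)).aestronglyMeasurable)
    (integrable_const _)
    (fun m => h1.mono fun A hA => by
      rw [norm_pow]
      exact pow_le_pow_left₀ (norm_nonneg _) (abs_partialQ_le hA m) 2)
    (h1.mono fun _ hA => (tendsto_partialQ hA).pow 2)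

theorem abs_integral_Q_sub_le (hN : 1 ≤ N)
    (h1 : ∀ᵐ A ∂μ, A ∈ Matrix.specialOrthogonalGroup (Fin (2 * N)) ℝ)
    (hinv : ∀ g ∈ Matrix.specialOrthogonalGroup (Fin (2 * N)) ℝ, μ.map (fun A => g * A) = μ) :
    |(∫ A, Q N A ∂μ) - 2 * Real.log (2 * N)
      - (2 * Real.eulerMascheroniConstant + 2 + Real.pi ^ 2 / 12)| ≤ 14 / (N : ℝ) := by
  have hlim := ((tendsto_integral_partialQ h1).sub
    ((tendsto_sum_Ico hasSum_even_inv_sq (by simp)).add_const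
      (Real.log (2 * N) + Real.eulerMascheroniConstant + 1) |>.const_mul 2)).abs
  have hbd : Filter.Tendsto (fun m : ℕ => 2 * (7 / (N : ℝ) + (2 * N) * (1 / ((m : ℝ) + 1))))
      Filter.atTop (nhds (2 * (7 / (N : ℝ) + (2 * N) * 0))) :=
    ((tendsto_one_div_add_atTop_nhds_zero_nat.const_mul _).const_add _).const_mul _
  have h := le_of_tendsto_of_tendsto hlim hbd (by
    filter_upwards [Filter.eventually_ge_atTop (2 * N)] with m hm
    rw [integral_partialQ h1 hinv, ← mul_sub, abs_mul, abs_two]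
    exact mul_le_mul_of_nonneg_left (abs_sum_trSq_sub_le hN hm) two_pos.le)
  refine (le_of_eq ?_).trans (h.trans (le_of_eq ?_))
  · congr 1; ring
  · ring

theorem abs_variance_Q_sub_le (hN : 1 ≤ N)
    (h1 : ∀ᵐ A ∂μ, A ∈ Matrix.specialOrthogonalGroup (Fin (2 * N)) ℝ)
    (hinv : ∀ g ∈ Matrix.specialOrthogonalGroup (Fin (2 * N)) ℝ, μ.map (fun A => g * A) = μ) :
    |variance (Q N) μ - (4 * Real.pi ^ 2 / 3 + 2 * (riemannZeta 3).re)| ≤ 1001584 / (N : ℝ) := by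
  have hlim := (((tendsto_integral_partialQ_sq h1).sub
    ((tendsto_integral_partialQ h1).pow 2)).sub
    ((tendsto_sum_Ico hasSum_diagVar (by simp)).const_mul 4)).abs
  have h := le_of_tendsto hlim (b := 4 * (250396 / (N : ℝ))) (Filter.Eventually.of_forall fun m => by
    rw [integral_partialQ_sq h1 hinv, ← mul_sub, abs_mul, abs_of_pos (by norm_num : (0 : ℝ) < 4)]
    exact mul_le_mul_of_nonneg_left (abs_sum_trCov_sub_le hN m) (by norm_num))
  rw [variance_eq_sub (memLp_Q h1)]
  refine (le_of_eq ?_).trans (h.trans (le_of_eq ?_))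
  · congr 1
    simp only [Pi.pow_apply]
    ring
  · ring

end Transport

/-- There is a universal constant `C > 0` such that for all `N ≥ 1` and `A` Haar-distributed
on `SO(2N)`: `|E[Q_N] − 2 log(2N) − (2γ + 2 + π²/12)| ≤ C/N` and
`|Var(Q_N) − (4π²/3 + 2 ζ(3))| ≤ C/N`. -/
theorem expectation_variance_asymptotics_specialOrthogonal_even :
    ∃ C : ℝ, 0 < C ∧ ∀ N : ℕ, 1 ≤ N →
      ∀ μ : Measure (Matrix (Fin (2 * N)) (Fin (2 * N)) ℝ), IsProbabilityMeasure μ →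
        μ {A | A ∈ Matrix.specialOrthogonalGroup (Fin (2 * N)) ℝ} = 1 →
        (∀ g ∈ Matrix.specialOrthogonalGroup (Fin (2 * N)) ℝ,
          μ.map (fun A => g * A) = μ) →
        |(∫ A, Q N A ∂μ) - 2 * Real.log (2 * N)
            - (2 * Real.eulerMascheroniConstant + 2 + Real.pi ^ 2 / 12)| ≤ C / N ∧
        |variance (Q N) μ - (4 * Real.pi ^ 2 / 3 + 2 * (riemannZeta 3).re)| ≤ C / N := by
  refine ⟨1001584, by norm_num, fun N hN μ _ hμ hinv => ?_⟩
  have h1 := ae_mem_of_measure_eq_one hμ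
  refine ⟨(abs_integral_Q_sub_le hN h1 hinv).trans ?_, abs_variance_Q_sub_le hN h1 hinv⟩
  gcongr
  norm_num
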